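/- (Bombieri–Vinogradov theorem.) For every real A > 0 there exist reals B > 0 and C > 0 such that for all real z > 3, the sum over positive integers m ≤ √z / (log z)^B of max over reals y ≤ z of max over residues a with gcd(a, m) = 1 of |ψ(y; m, a) − y/φ(m)| is at most C · z / (log z)^A. -/

import Mathlib

/-- `ψ(y; m, a) = Σ_{n ≤ y, n ≡ a (mod m)} Λ(n)`, where `Λ` is the von Mangoldt function. -/
noncomputable def psi (y : ℝ) (m a : ℕ) : ℝ :=
  ∑ n ∈ Finset.Icc 1 ⌊y⌋₊,
    if n % m = a % m then ArithmeticFunction.vonMangoldt n else 0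

section

open Complex MeasureTheory Set Filter Topology

/-- The partial sums of a nontrivial character are bounded by the modulus. -/
lemma norm_sum_Icc_char_le {q : ℕ} [NeZero q] {χ : DirichletCharacter ℂ q} (hχ : χ ≠ 1) (n : ℕ) :
    ‖∑ k ∈ Finset.Icc 1 n, χ k‖ ≤ q := by
  have hper : ∀ m : ℕ, ∑ k ∈ Finset.range q, χ ((m * q + k : ℕ) : ZMod q) = 0 := by
    intro m
    have h1 : ∑ k ∈ Finset.range q, χ ((m * q + k : ℕ) : ZMod q) = ∑ a : ZMod q, χ a := by
      refine Finset.sum_bij (fun k _ => (k : ZMod q)) (fun _ _ => Finset.mem_univ _) ?_ ?_ ?_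
      · intro a ha b hb hab
        rw [ZMod.natCast_eq_natCast_iff'] at hab
        rwa [Nat.mod_eq_of_lt (Finset.mem_range.1 ha),
          Nat.mod_eq_of_lt (Finset.mem_range.1 hb)] at hab
      · intro b _
        exact ⟨b.val, Finset.mem_range.2 (ZMod.val_lt b), by simp⟩
      · intro a _
        simp
    rw [h1, MulChar.sum_eq_zero_of_ne_one hχ]
  have hfull : ∀ m : ℕ, ∑ k ∈ Finset.range (m * q), χ (k : ZMod q) = 0 := by
    intro m
    induction m with
    | zero => simp
    | succ m ih => rw [Nat.succ_mul, Finset.sum_range_add, ih, hper, zero_add]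
  have hq1 : q ≠ 1 := by
    rintro rfl
    exact hχ (DirichletCharacter.level_one χ)
  have h0 : ∑ k ∈ Finset.Icc 1 n, χ k = ∑ k ∈ Finset.range (n + 1), χ (k : ZMod q) := by
    rw [Finset.range_eq_Ico, Finset.sum_eq_sum_Ico_succ_bot (Nat.succ_pos n)]
    simp only [Nat.cast_zero]
    rw [DirichletCharacter.map_zero' χ hq1, zero_add]
    rfl
  rw [h0, ← Nat.div_add_mod' (n + 1) q, Finset.sum_range_add, hfull, zero_add]
  refine (norm_sum_le _ _).trans ?_
  refine (Finset.sum_le_sum (fun k _ => DirichletCharacter.norm_le_one χ _)).trans ?_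
  simp only [Finset.sum_const, Finset.card_range, nsmul_eq_mul, mul_one]
  exact_mod_cast (Nat.mod_lt _ (Nat.pos_of_ne_zero (NeZero.ne q))).le

lemma differentiableAt_integral_Ioi_one_cpow {R : ℝ → ℂ} {B : ℝ} (hm : Measurable R)
    (hB : ∀ t, ‖R t‖ ≤ B) {s : ℂ} (hs : 0 < s.re) :
    DifferentiableAt ℂ (fun s : ℂ => ∫ t in Ioi (1 : ℝ), R t * (t : ℂ) ^ (-(s + 1))) s := by
  set f : ℝ → ℂ := (Ioi (1 : ℝ)).indicator R with hf
  have hfm : Measurable f := hm.indicator measurableSet_Ioi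
  have hfB : ∀ t, ‖f t‖ ≤ B := fun t => (norm_indicator_le_norm_self _ _).trans (hB t)
  have hloc : LocallyIntegrableOn f (Ioi 0) volume := by
    have : LocallyIntegrable f volume := by
      refine (locallyIntegrable_const B).mono hfm.aestronglyMeasurable ?_
      exact Eventually.of_forall fun t => (hfB t).trans (le_abs_self B)
    exact this.locallyIntegrableOn _
  have hkey : DifferentiableAt ℂ (mellin f) (-s) := by
    refine mellin_differentiableAt_of_isBigO_rpow (a := 0) (b := (-s).re - 1) hloc ?_ ?_ ?_ ?_
    · simp only [neg_zero, Real.rpow_zero]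
      exact Asymptotics.isBigO_of_le' (c := B) _ (fun t => by simpa using hfB t)
    · simpa using hs
    · refine Asymptotics.IsBigO.of_bound 0 ?_
      have : Iio (1 : ℝ) ∈ 𝓝[>] (0 : ℝ) := mem_nhdsWithin_of_mem_nhds (Iio_mem_nhds one_pos)
      filter_upwards [this] with t ht
      have : t ∉ Ioi (1 : ℝ) := by simpa using le_of_lt ht
      simp [hf, this]
    · linarith
  have heq : (fun s : ℂ => ∫ t in Ioi (1 : ℝ), R t * (t : ℂ) ^ (-(s + 1)))
      = fun s => mellin f (-s) := by
    ext w
    rw [mellin, hf, ← integral_indicator measurableSet_Ioi, ← integral_indicator measurableSet_Ioi]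
    congr 1
    ext t
    by_cases ht : 1 < t
    · have ht0 : (0 : ℝ) < t := one_pos.trans ht
      simp [indicator, ht, ht0, smul_eq_mul, mul_comm]
      left
      congr 1
      ring
    · simp [indicator, ht]
  rw [heq]
  exact hkey.comp s differentiableAt_id.neg

lemma norm_integral_Ioi_one_cpow_le {R : ℝ → ℂ} {B : ℝ} (hB : ∀ t, ‖R t‖ ≤ B) {N : ℕ}
    (hN : 1 ≤ N) (hR : ∀ t : ℝ, t ≤ N → R t = 0) {s : ℂ} (hs : 0 < s.re) :
    ‖∫ t in Ioi (1 : ℝ), R t * (t : ℂ) ^ (-(s + 1))‖ ≤ B * (N : ℝ) ^ (-s.re) / s.re := by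
  have hN' : (1 : ℝ) ≤ N := by exact_mod_cast hN
  have hN0 : (0 : ℝ) < N := by linarith
  have h1 : ∫ t in Ioi (1 : ℝ), R t * (t : ℂ) ^ (-(s + 1))
      = ∫ t in Ioi (N : ℝ), R t * (t : ℂ) ^ (-(s + 1)) := by
    refine (setIntegral_eq_of_subset_of_forall_sdiff_eq_zero measurableSet_Ioi
      (Ioi_subset_Ioi hN') ?_)
    intro t ht
    have : t ≤ N := by simpa using ht.2
    simp [hR t this]
  rw [h1]
  have h2 : ∫ t in Ioi (N : ℝ), B * t ^ (-s.re - 1) = B * (N : ℝ) ^ (-s.re) / s.re := by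
    rw [integral_const_mul, integral_Ioi_rpow_of_lt (by linarith) hN0]
    have : -s.re - 1 + 1 = -s.re := by ring
    rw [this]
    field_simp
  rw [← h2]
  refine norm_integral_le_of_norm_le ?_ ?_
  · exact (integrableOn_Ioi_rpow_of_lt (by linarith) hN0).const_mul B
  · refine (ae_restrict_iff' measurableSet_Ioi).2 (Eventually.of_forall fun t ht => ?_)
    have ht0 : 0 < t := hN0.trans ht
    rw [norm_mul, norm_cpow_eq_rpow_re_of_pos ht0]
    have : (-(s + 1)).re = -s.re - 1 := by simp; ring
    rw [this]
    gcongr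
    exact hB t

/-- The partial sums from `N + 1` on. -/
noncomputable def tailSum (f : ℕ → ℂ) (N : ℕ) (t : ℝ) : ℂ := ∑ k ∈ Finset.Ioc N ⌊t⌋₊, f k

lemma measurable_tailSum (f : ℕ → ℂ) (N : ℕ) : Measurable (tailSum f N) :=
  (measurable_from_nat (f := fun n : ℕ => ∑ k ∈ Finset.Ioc N n, f k)).comp Nat.measurable_floor

lemma tailSum_eq_zero (f : ℕ → ℂ) (N : ℕ) {t : ℝ} (ht : t ≤ N) : tailSum f N t = 0 := by
  rw [tailSum, Finset.Ioc_eq_empty, Finset.sum_empty]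
  exact not_lt.2 (Nat.floor_le_of_le ht)

lemma LSeries_eq_sum_add_integral {f : ℕ → ℂ} (hf : ∀ n, ‖f n‖ ≤ 1) (N : ℕ) {s : ℂ}
    (hs : 1 < s.re) :
    LSeries f s = ∑ n ∈ Finset.Icc 1 N, f n * (n : ℂ) ^ (-s)
      + s * ∫ t in Ioi (1 : ℝ), tailSum f N t * (t : ℂ) ^ (-(s + 1)) := by
  classical
  set g : ℕ → ℂ := fun n => if N < n then f n else 0 with hg
  set h : ℕ → ℂ := fun n => if N < n then 0 else f n with hh
  have hgn : ∀ n, ‖g n‖ ≤ 1 := by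
    intro n
    by_cases hn : N < n <;> simp [hg, hn, hf n]
  have hhn : ∀ n, ‖h n‖ ≤ 1 := by
    intro n
    by_cases hn : N < n <;> simp [hh, hn, hf n]
  have hgs : LSeriesSummable g s := LSeriesSummable_of_bounded_of_one_lt_re (fun n _ => hgn n) hs
  have hhs : LSeriesSummable h s := LSeriesSummable_of_bounded_of_one_lt_re (fun n _ => hhn n) hs
  have hfg : f = h + g := by
    ext n
    by_cases hn : N < n <;> simp [hg, hh, hn]
  have h1 : LSeries f s = LSeries h s + LSeries g s := by
    rw [hfg, LSeries_add hhs hgs]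
  rw [h1]
  congr 1
  · rw [LSeries, tsum_eq_sum (s := Finset.Icc 1 N)]
    · refine Finset.sum_congr rfl fun n hn => ?_
      rw [Finset.mem_Icc] at hn
      rw [LSeries.term_of_ne_zero (by omega), cpow_neg, div_eq_mul_inv]
      simp [hh, not_lt.2 hn.2]
    · intro n hn
      rcases Nat.eq_zero_or_pos n with rfl | hn0
      · simp
      · have : N < n := by
          by_contra hcon
          exact hn (Finset.mem_Icc.2 ⟨hn0, not_lt.1 hcon⟩)
        rw [LSeries.term_of_ne_zero (by omega)]
        simp [hh, this]
  · rw [LSeries_eq_mul_integral' g zero_le_one hs]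
    · congr 1
      refine integral_congr_ae (Eventually.of_forall fun t => ?_)
      simp only
      congr 1
      rw [tailSum, hg, ← Finset.sum_filter]
      refine Finset.sum_congr ?_ fun _ _ => rfl
      ext k
      simp only [Finset.mem_filter, Finset.mem_Icc, Finset.mem_Ioc]
      omega
    · refine Asymptotics.IsBigO.of_bound 1 (Eventually.of_forall fun n => ?_)
      rw [one_mul, Real.rpow_one, Real.norm_of_nonneg (Finset.sum_nonneg fun _ _ => norm_nonneg _)]
      refine (Finset.sum_le_sum fun k _ => hgn k).trans ?_
      simp

lemma isPreconnected_re_pos : IsPreconnected {s : ℂ | 0 < s.re} :=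
  (convex_halfSpace_re_gt 0).isPreconnected

lemma isOpen_re_pos : IsOpen {s : ℂ | 0 < s.re} := isOpen_lt continuous_const continuous_re

lemma norm_tailSum_char_le {q : ℕ} [NeZero q] {χ : DirichletCharacter ℂ q} (hχ : χ ≠ 1) (N : ℕ)
    (t : ℝ) : ‖tailSum (fun n => χ n) N t‖ ≤ 2 * q := by
  rcases le_total N ⌊t⌋₊ with h | h
  · have h2 : tailSum (fun n => χ n) N t
        = ∑ k ∈ Finset.Icc 1 ⌊t⌋₊, χ k - ∑ k ∈ Finset.Icc 1 N, χ k := by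
      rw [eq_sub_iff_add_eq, tailSum, add_comm]
      have : Finset.Icc 1 ⌊t⌋₊ = Finset.Icc 1 N ∪ Finset.Ioc N ⌊t⌋₊ := by
        ext k
        simp only [Finset.mem_union, Finset.mem_Icc, Finset.mem_Ioc]
        omega
      rw [this, Finset.sum_union]
      rw [Finset.disjoint_left]
      intro k
      simp only [Finset.mem_Icc, Finset.mem_Ioc]
      omega
    rw [h2]
    refine (norm_sub_le _ _).trans ?_
    linarith [norm_sum_Icc_char_le hχ ⌊t⌋₊, norm_sum_Icc_char_le hχ N]
  · rw [tailSum, Finset.Ioc_eq_empty (not_lt.2 h)]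
    simp

/-- Approximate formula for Dirichlet `L`-functions in the half plane `0 < re s`. -/
lemma LFunction_eq_sum_add_integral {q : ℕ} [NeZero q] {χ : DirichletCharacter ℂ q} (hχ : χ ≠ 1)
    (N : ℕ) {s : ℂ} (hs : 0 < s.re) :
    DirichletCharacter.LFunction χ s = ∑ n ∈ Finset.Icc 1 N, χ n * (n : ℂ) ^ (-s)
      + s * ∫ t in Ioi (1 : ℝ), tailSum (fun n => χ n) N t * (t : ℂ) ^ (-(s + 1)) := by
  have hbd := norm_tailSum_char_le hχ N
  have hL : AnalyticOnNhd ℂ (DirichletCharacter.LFunction χ) {s : ℂ | 0 < s.re} :=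
    (DirichletCharacter.differentiable_LFunction hχ).differentiableOn.analyticOnNhd isOpen_re_pos
  have hR : AnalyticOnNhd ℂ (fun s : ℂ => ∑ n ∈ Finset.Icc 1 N, χ n * (n : ℂ) ^ (-s)
      + s * ∫ t in Ioi (1 : ℝ), tailSum (fun n => χ n) N t * (t : ℂ) ^ (-(s + 1)))
      {s : ℂ | 0 < s.re} := by
    refine DifferentiableOn.analyticOnNhd ?_ isOpen_re_pos
    intro w hw
    refine DifferentiableAt.differentiableWithinAt ?_
    refine DifferentiableAt.add ?_ (differentiableAt_id.mul
      (differentiableAt_integral_Ioi_one_cpow (measurable_tailSum _ _) hbd hw))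
    refine DifferentiableAt.fun_sum fun n hn => ?_
    have : (n : ℂ) ≠ 0 := by
      have := (Finset.mem_Icc.1 hn).1
      exact_mod_cast (by omega : n ≠ 0)
    exact (differentiableAt_id.neg.const_cpow (Or.inl this)).const_mul _
  refine hL.eqOn_of_preconnected_of_eventuallyEq hR isPreconnected_re_pos (z₀ := 2) (by simp) ?_ hs
  have : {s : ℂ | 1 < s.re} ∈ 𝓝 (2 : ℂ) :=
    (isOpen_lt continuous_const continuous_re).mem_nhds (by simp)
  filter_upwards [this] with w hw
  rw [DirichletCharacter.LFunction_eq_LSeries χ hw]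
  exact LSeries_eq_sum_add_integral (fun n => DirichletCharacter.norm_le_one χ _) N hw

lemma sum_Icc_rpow_neg_le {η σ : ℝ} (hη : 0 < η) (hσ : 1 - η ≤ σ) (N : ℕ) (hN : 1 ≤ N) :
    ∑ n ∈ Finset.Icc 1 N, (n : ℝ) ^ (-σ) ≤ (1 + 1 / η) * (N : ℝ) ^ (2 * η) := by
  have hN1 : (1 : ℝ) ≤ N := by exact_mod_cast hN
  have h1 : ∑ n ∈ Finset.Icc 1 N, (n : ℝ) ^ (-σ)
      ≤ ∑ n ∈ Finset.Icc 1 N, (N : ℝ) ^ η * (n : ℝ)⁻¹ := by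
    refine Finset.sum_le_sum fun n hn => ?_
    rw [Finset.mem_Icc] at hn
    have hn1 : (1 : ℝ) ≤ n := by exact_mod_cast hn.1
    have hnN : (n : ℝ) ≤ N := by exact_mod_cast hn.2
    calc (n : ℝ) ^ (-σ) ≤ (n : ℝ) ^ (η - 1) := Real.rpow_le_rpow_of_exponent_le hn1 (by linarith)
      _ = (n : ℝ) ^ η * (n : ℝ)⁻¹ := by
        rw [Real.rpow_sub (by linarith), Real.rpow_one, div_eq_mul_inv]
      _ ≤ _ := by gcongr
  have h2 : ∑ n ∈ Finset.Icc 1 N, (n : ℝ)⁻¹ ≤ 1 + Real.log N := by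
    have := harmonic_le_one_add_log N
    rw [harmonic_eq_sum_Icc] at this
    push_cast at this
    exact this
  have h3 : Real.log N ≤ (N : ℝ) ^ η / η := Real.log_le_rpow_div (by linarith) hη
  have h4 : 1 ≤ (N : ℝ) ^ η := Real.one_le_rpow hN1 hη.le
  calc _ ≤ _ := h1
    _ = (N : ℝ) ^ η * ∑ n ∈ Finset.Icc 1 N, (n : ℝ)⁻¹ := by rw [Finset.mul_sum]
    _ ≤ (N : ℝ) ^ η * ((N : ℝ) ^ η + (N : ℝ) ^ η / η) := by
      gcongr
      linarith
    _ = (1 + 1 / η) * ((N : ℝ) ^ η * (N : ℝ) ^ η) := by ring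
    _ = _ := by rw [← Real.rpow_add (by linarith)]; ring_nf

lemma norm_sum_Icc_mul_cpow_le {f : ℕ → ℂ} (hf : ∀ n, ‖f n‖ ≤ 1) {η : ℝ} {s : ℂ} (hη : 0 < η)
    (hs : 1 - η ≤ s.re) (N : ℕ) (hN : 1 ≤ N) :
    ‖∑ n ∈ Finset.Icc 1 N, f n * (n : ℂ) ^ (-s)‖ ≤ (1 + 1 / η) * (N : ℝ) ^ (2 * η) := by
  refine (norm_sum_le _ _).trans ((Finset.sum_le_sum fun n hn => ?_).trans
    (sum_Icc_rpow_neg_le hη hs N hN))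
  have hn0 : (0 : ℝ) < n := by exact_mod_cast (Finset.mem_Icc.1 hn).1
  rw [norm_mul, ← ofReal_natCast, norm_cpow_eq_rpow_re_of_pos hn0, neg_re]
  exact mul_le_of_le_one_left (by positivity) (hf n)

lemma norm_mul_tail_le {s J : ℂ} {q T η : ℝ} {N : ℕ} (hq : 1 ≤ q) (hT : T = q * (|s.im| + 2))
    (hN : T ≤ N) (hη : 0 < η) (hη' : η ≤ 1 / 2) (hs : 1 - η ≤ s.re)
    (hJ : ‖J‖ ≤ 2 * q * (N : ℝ) ^ (-s.re) / s.re) :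
    ‖s * J‖ ≤ 4 * (N : ℝ) ^ (2 * η) := by
  have hσ : 0 < s.re := by linarith
  have hT2 : 2 ≤ T := by rw [hT]; nlinarith [abs_nonneg s.im]
  have hN1 : (1 : ℝ) ≤ N := by linarith
  have hns : ‖s‖ ≤ s.re + |s.im| := by
    have := norm_le_abs_re_add_abs_im s
    rwa [abs_of_pos hσ] at this
  have h1 : ‖s‖ / s.re ≤ 2 * (|s.im| + 2) := by
    rw [div_le_iff₀ hσ]
    nlinarith [abs_nonneg s.im]
  rw [norm_mul]
  calc ‖s‖ * ‖J‖ ≤ ‖s‖ * (2 * q * (N : ℝ) ^ (-s.re) / s.re) := by gcongr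
    _ = (‖s‖ / s.re) * (2 * q * (N : ℝ) ^ (-s.re)) := by ring
    _ ≤ (2 * (|s.im| + 2)) * (2 * q * (N : ℝ) ^ (-s.re)) := by gcongr
    _ = 4 * T * (N : ℝ) ^ (-s.re) := by rw [hT]; ring
    _ ≤ 4 * N * (N : ℝ) ^ (-s.re) := by gcongr
    _ = 4 * (N : ℝ) ^ (1 - s.re) := by
      rw [sub_eq_add_neg, Real.rpow_add (by linarith), Real.rpow_one]; ring
    _ ≤ 4 * (N : ℝ) ^ (2 * η) := by
      gcongr
      linarith

lemma ceil_rpow_le {T ε : ℝ} (hT : 1 ≤ T) (hε : 0 < ε) (hε1 : ε ≤ 1) :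
    ((⌈T⌉₊ : ℕ) : ℝ) ^ ε ≤ 2 * T ^ ε := by
  have h1 : ((⌈T⌉₊ : ℕ) : ℝ) ≤ 2 * T := by
    have := (Nat.ceil_lt_add_one (by linarith : (0 : ℝ) ≤ T)).le
    linarith
  calc ((⌈T⌉₊ : ℕ) : ℝ) ^ ε ≤ (2 * T) ^ ε := by gcongr
    _ = 2 ^ ε * T ^ ε := Real.mul_rpow (by norm_num) (by linarith)
    _ ≤ 2 ^ (1 : ℝ) * T ^ ε := by
      gcongr
      norm_num
    _ = _ := by rw [Real.rpow_one]

/-- Upper bound for Dirichlet `L`-functions near and to the right of the line `re s = 1`. -/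
theorem norm_LFunction_le (ε : ℝ) (hε : 0 < ε) (hε1 : ε ≤ 1) :
    ∃ C : ℝ, 1 ≤ C ∧ ∀ (q : ℕ) [NeZero q] (χ : DirichletCharacter ℂ q), χ ≠ 1 → ∀ s : ℂ,
      1 - ε / 2 ≤ s.re → ‖DirichletCharacter.LFunction χ s‖ ≤ C * (q * (|s.im| + 2)) ^ ε := by
  refine ⟨2 * (5 + 1 / (ε / 2)), ?_, ?_⟩
  · have : 0 < 1 / (ε / 2) := by positivity
    linarith
  intro q _ χ hχ s hs
  have hq : (1 : ℝ) ≤ q := by exact_mod_cast Nat.one_le_iff_ne_zero.2 (NeZero.ne q)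
  set T : ℝ := q * (|s.im| + 2) with hT
  have hT2 : 2 ≤ T := by rw [hT]; nlinarith [abs_nonneg s.im]
  set N := ⌈T⌉₊ with hN
  have hTN : T ≤ N := Nat.le_ceil T
  have hN1 : 1 ≤ N := by
    have : (1 : ℝ) ≤ N := by linarith
    exact_mod_cast this
  have hσ : 0 < s.re := by linarith
  rw [LFunction_eq_sum_add_integral hχ _ hσ]
  have hbd : ∀ t, ‖tailSum (fun n => χ n) N t‖ ≤ 2 * q := norm_tailSum_char_le hχ N
  have h1 := norm_sum_Icc_mul_cpow_le (fun n => DirichletCharacter.norm_le_one χ (n : ZMod q))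
    (half_pos hε) hs N hN1
  have h2 := norm_mul_tail_le hq hT hTN (half_pos hε) (by linarith) hs
    (norm_integral_Ioi_one_cpow_le hbd hN1 (fun t ht => tailSum_eq_zero _ N ht) hσ)
  have h3 : 2 * (ε / 2) = ε := by ring
  rw [h3] at h1 h2
  have h4 := ceil_rpow_le (by linarith : 1 ≤ T) hε hε1
  refine (norm_add_le _ _).trans ((add_le_add h1 h2).trans ?_)
  have h5 : 0 ≤ 1 / (ε / 2) := by positivity
  calc (1 + 1 / (ε / 2)) * (N : ℝ) ^ ε + 4 * (N : ℝ) ^ ε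
      = (5 + 1 / (ε / 2)) * (N : ℝ) ^ ε := by ring
    _ ≤ (5 + 1 / (ε / 2)) * (2 * T ^ ε) := by gcongr
    _ = _ := by ring

/-- The entire function `(s - 1) ζ(s)`. -/
noncomputable abbrev zetaMulSub (s : ℂ) : ℂ := DirichletCharacter.LFunctionTrivChar₁ 1 s

lemma zetaMulSub_one : zetaMulSub 1 = 1 := by
  simp [zetaMulSub, DirichletCharacter.LFunctionTrivChar₁]

lemma zetaMulSub_of_ne {s : ℂ} (hs : s ≠ 1) : zetaMulSub s = (s - 1) * riemannZeta s := by
  simp [zetaMulSub, DirichletCharacter.LFunctionTrivChar₁, hs,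
    DirichletCharacter.LFunctionTrivChar, DirichletCharacter.LFunction_modOne_eq]

lemma differentiable_zetaMulSub : Differentiable ℂ zetaMulSub :=
  DirichletCharacter.differentiable_LFunctionTrivChar₁ 1

/-- The entire function `ζ(s) - 1 / (s - 1)`. -/
noncomputable def zetaReg : ℂ → ℂ := dslope zetaMulSub 1

lemma differentiable_zetaReg : Differentiable ℂ zetaReg := by
  rw [← differentiableOn_univ]
  exact (Complex.differentiableOn_dslope univ_mem).2 differentiable_zetaMulSub.differentiableOn

lemma zetaReg_of_ne {s : ℂ} (hs : s ≠ 1) : zetaReg s = riemannZeta s - 1 / (s - 1) := by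
  have : s - 1 ≠ 0 := sub_ne_zero.2 hs
  rw [zetaReg, dslope_of_ne _ hs, slope_def_field, zetaMulSub_one, zetaMulSub_of_ne hs]
  field_simp

lemma zetaMulSub_eq {s : ℂ} : zetaMulSub s = 1 + (s - 1) * zetaReg s := by
  rcases eq_or_ne s 1 with rfl | hs
  · simp
  · have : s - 1 ≠ 0 := sub_ne_zero.2 hs
    rw [zetaReg_of_ne hs, zetaMulSub_of_ne hs]
    field_simp
    ring

/-- The difference between the number of integers in `(N, t]` and `t - N`. -/
noncomputable def tailFrac (N : ℕ) (t : ℝ) : ℂ :=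
  tailSum 1 N t - ((max (t - N) 0 : ℝ) : ℂ)

lemma measurable_tailFrac (N : ℕ) : Measurable (tailFrac N) := by
  refine (measurable_tailSum _ _).sub (measurable_ofReal.comp ?_)
  fun_prop

lemma tailFrac_eq_zero (N : ℕ) {t : ℝ} (ht : t ≤ N) : tailFrac N t = 0 := by
  rw [tailFrac, tailSum_eq_zero _ _ ht, max_eq_right (by linarith)]
  simp

lemma norm_tailFrac_le (N : ℕ) (t : ℝ) : ‖tailFrac N t‖ ≤ 2 * (1 : ℝ) := by
  rcases le_total t N with h | h
  · rw [tailFrac_eq_zero N h]; simp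
  · have h1 : N ≤ ⌊t⌋₊ := Nat.le_floor h
    have h2 : tailFrac N t = (((⌊t⌋₊ : ℝ) - t : ℝ) : ℂ) := by
      rw [tailFrac, tailSum, max_eq_left (by linarith)]
      simp [Nat.cast_sub h1]
    rw [h2, norm_real, Real.norm_eq_abs, abs_le]
    have h3 := Nat.lt_floor_add_one t
    have h4 := Nat.floor_le ((Nat.cast_nonneg N).trans h)
    constructor <;> linarith

lemma zetaMulSub_formula {N : ℕ} (hN : 1 ≤ N) {s : ℂ} (hs : 0 < s.re) :
    zetaMulSub s = (s - 1) * ∑ n ∈ Finset.Icc 1 N, (1 : ℕ → ℂ) n * (n : ℂ) ^ (-s)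
      + (N : ℂ) ^ (1 - s)
      + (s - 1) * (s * ∫ t in Ioi (1 : ℝ), tailFrac N t * (t : ℂ) ^ (-(s + 1))) := by
  have hN0 : (N : ℂ) ≠ 0 := by exact_mod_cast (by omega : N ≠ 0)
  have hN0' : (0 : ℝ) < N := by exact_mod_cast hN
  have hL : AnalyticOnNhd ℂ zetaMulSub {s : ℂ | 0 < s.re} :=
    differentiable_zetaMulSub.differentiableOn.analyticOnNhd isOpen_re_pos
  have hR : AnalyticOnNhd ℂ (fun s : ℂ =>
      (s - 1) * ∑ n ∈ Finset.Icc 1 N, (1 : ℕ → ℂ) n * (n : ℂ) ^ (-s) + (N : ℂ) ^ (1 - s)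
      + (s - 1) * (s * ∫ t in Ioi (1 : ℝ), tailFrac N t * (t : ℂ) ^ (-(s + 1))))
      {s : ℂ | 0 < s.re} := by
    refine DifferentiableOn.analyticOnNhd ?_ isOpen_re_pos
    intro w hw
    refine DifferentiableAt.differentiableWithinAt ?_
    have hd : DifferentiableAt ℂ (fun s : ℂ => s - 1) w := differentiableAt_id.sub_const 1
    refine ((hd.mul (DifferentiableAt.fun_sum fun n hn => ?_)).add ?_).add
      (hd.mul (differentiableAt_id.mul (differentiableAt_integral_Ioi_one_cpow
        (measurable_tailFrac N) (norm_tailFrac_le N) hw)))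
    · have : (n : ℂ) ≠ 0 := by
        have := (Finset.mem_Icc.1 hn).1
        exact_mod_cast (by omega : n ≠ 0)
      exact (differentiableAt_id.neg.const_cpow (Or.inl this)).const_mul _
    · exact ((differentiableAt_const 1).sub differentiableAt_id).const_cpow (Or.inl hN0)
  refine hL.eqOn_of_preconnected_of_eventuallyEq hR isPreconnected_re_pos (z₀ := 2) (by simp) ?_ hs
  have : {s : ℂ | 1 < s.re} ∈ 𝓝 (2 : ℂ) :=
    (isOpen_lt continuous_const continuous_re).mem_nhds (by simp)
  filter_upwards [this] with w hw
  have hw : 1 < w.re := hw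
  have hw1 : w ≠ 1 := by rintro rfl; simp at hw
  have hw1' : w - 1 ≠ 0 := sub_ne_zero.2 hw1
  have hw0 : w ≠ 0 := by rintro rfl; norm_num at hw
  have h1 := LSeries_eq_sum_add_integral (f := 1) (fun n => by simp) N hw
  rw [LSeries_one_eq_riemannZeta hw] at h1
  have hI1 : IntegrableOn (fun t : ℝ => (t : ℂ) ^ (-w)) (Ioi (N : ℝ)) :=
    integrableOn_Ioi_cpow_of_lt (by simpa using hw) hN0'
  have hI2 : IntegrableOn (fun t : ℝ => (N : ℂ) * (t : ℂ) ^ (-(w + 1))) (Ioi (N : ℝ)) :=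
    (integrableOn_Ioi_cpow_of_lt (by simp; linarith) hN0').const_mul _
  have hEq : EqOn (fun t : ℝ => ((max (t - N) 0 : ℝ) : ℂ) * (t : ℂ) ^ (-(w + 1)))
      (fun t : ℝ => (t : ℂ) ^ (-w) - (N : ℂ) * (t : ℂ) ^ (-(w + 1))) (Ioi (N : ℝ)) := by
    intro t ht
    have ht' : (N : ℝ) < t := ht
    have ht0 : (t : ℂ) ≠ 0 := by exact_mod_cast (hN0'.trans ht').ne'
    simp only
    rw [max_eq_left (by linarith)]
    have : (t : ℂ) ^ (-w) = t * (t : ℂ) ^ (-(w + 1)) := by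
      rw [show -w = 1 + -(w + 1) by ring, cpow_add _ _ ht0, cpow_one]
    rw [this]
    push_cast
    ring
  have hIm : IntegrableOn (fun t : ℝ => ((max (t - N) 0 : ℝ) : ℂ) * (t : ℂ) ^ (-(w + 1)))
      (Ioi (N : ℝ)) := (hI1.sub hI2).congr_fun hEq.symm measurableSet_Ioi
  have hzero : ∀ t ∈ Ioi (1 : ℝ) \ Ioi (N : ℝ),
      ((max (t - N) 0 : ℝ) : ℂ) * (t : ℂ) ^ (-(w + 1)) = 0 := by
    intro t ht
    have : t ≤ N := by simpa using ht.2
    rw [max_eq_right (by linarith)]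
    simp
  have hsub : Ioi (N : ℝ) ⊆ Ioi (1 : ℝ) := Ioi_subset_Ioi (by exact_mod_cast hN)
  have hIm1 : IntegrableOn (fun t : ℝ => ((max (t - N) 0 : ℝ) : ℂ) * (t : ℂ) ^ (-(w + 1)))
      (Ioi (1 : ℝ)) := hIm.of_forall_sdiff_eq_zero measurableSet_Ioi hzero
  have hIt : IntegrableOn (fun t : ℝ => tailFrac N t * (t : ℂ) ^ (-(w + 1))) (Ioi (1 : ℝ)) := by
    refine Integrable.bdd_mul (c := 2 * 1) ?_ (measurable_tailFrac N).aestronglyMeasurable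
      (Eventually.of_forall (norm_tailFrac_le N))
    exact integrableOn_Ioi_cpow_of_lt (by simp; linarith) one_pos
  have h2 : ∫ t in Ioi (1 : ℝ), tailSum 1 N t * (t : ℂ) ^ (-(w + 1))
      = (∫ t in Ioi (1 : ℝ), tailFrac N t * (t : ℂ) ^ (-(w + 1)))
        + ∫ t in Ioi (1 : ℝ), ((max (t - N) 0 : ℝ) : ℂ) * (t : ℂ) ^ (-(w + 1)) := by
    rw [← integral_add hIt hIm1]
    refine integral_congr_ae (Eventually.of_forall fun t => ?_)
    simp only [tailFrac]
    ring
  have h3 : ∫ t in Ioi (1 : ℝ), ((max (t - N) 0 : ℝ) : ℂ) * (t : ℂ) ^ (-(w + 1))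
      = (N : ℂ) ^ (1 - w) / (w * (w - 1)) := by
    rw [setIntegral_eq_of_subset_of_forall_sdiff_eq_zero measurableSet_Ioi hsub hzero,
      setIntegral_congr_fun measurableSet_Ioi hEq, integral_sub hI1 hI2, integral_const_mul,
      integral_Ioi_cpow_of_lt (by simpa using hw) hN0',
      integral_Ioi_cpow_of_lt (by simp; linarith) hN0']
    have e1 : -w + 1 = 1 - w := by ring
    have e2 : -(w + 1) + 1 = -w := by ring
    have e3 : (N : ℂ) ^ (1 - w) = N * (N : ℂ) ^ (-w) := by
      rw [sub_eq_add_neg, cpow_add _ _ hN0, cpow_one]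
    have e4 : 1 - w ≠ 0 := by rw [← neg_sub]; exact neg_ne_zero.2 hw1'
    rw [e1, e2]
    push_cast
    rw [e3]
    field_simp
    ring
  rw [zetaMulSub_of_ne hw1, h1, h2, h3]
  field_simp
  ring

/-- Upper bound for `ζ(s) - 1 / (s - 1)` near and to the right of the line `re s = 1`. -/
theorem norm_zetaReg_le (ε : ℝ) (hε : 0 < ε) (hε1 : ε ≤ 1) :
    ∃ C : ℝ, 1 ≤ C ∧ ∀ s : ℂ, 1 - ε / 2 ≤ s.re → ‖zetaReg s‖ ≤ C * (|s.im| + 2) ^ ε := by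
  obtain ⟨C₀, hC₀⟩ := (isCompact_closedBall (1 : ℂ) 1).exists_bound_of_continuousOn
    differentiable_zetaReg.continuous.continuousOn
  have h5 : 0 ≤ 1 / (ε / 2) := by positivity
  refine ⟨max C₀ (2 * (7 + 1 / (ε / 2))), le_max_of_le_right (by linarith), ?_⟩
  intro s hs
  have hT1 : 1 ≤ (|s.im| + 2) ^ ε :=
    Real.one_le_rpow (by linarith [abs_nonneg s.im]) hε.le
  by_cases hb : s ∈ Metric.closedBall (1 : ℂ) 1
  · calc ‖zetaReg s‖ ≤ C₀ := hC₀ s hb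
      _ ≤ max C₀ (2 * (7 + 1 / (ε / 2))) := le_max_left _ _
      _ ≤ _ := by
        refine le_mul_of_one_le_right ?_ hT1
        exact le_max_of_le_right (by linarith)
  have hs1 : 1 ≤ ‖s - 1‖ := by
    rw [Metric.mem_closedBall, dist_eq_norm, not_le] at hb
    exact hb.le
  have hne : s - 1 ≠ 0 := by
    intro h
    rw [h] at hs1
    norm_num at hs1
  set T : ℝ := 1 * (|s.im| + 2) with hT
  have hT2 : 2 ≤ T := by rw [hT]; linarith [abs_nonneg s.im]
  set N := ⌈T⌉₊ with hN
  have hTN : T ≤ N := Nat.le_ceil T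
  have hN1' : (1 : ℝ) ≤ N := by linarith
  have hN1 : 1 ≤ N := by exact_mod_cast hN1'
  have hσ : 0 < s.re := by linarith
  have hform := zetaMulSub_formula hN1 hσ
  rw [zetaMulSub_eq] at hform
  set S₁ := ∑ n ∈ Finset.Icc 1 N, (1 : ℕ → ℂ) n * (n : ℂ) ^ (-s)
  set J := ∫ t in Ioi (1 : ℝ), tailFrac N t * (t : ℂ) ^ (-(s + 1))
  have hz : zetaReg s = S₁ + ((N : ℂ) ^ (1 - s) - 1) / (s - 1) + s * J := by
    field_simp
    linear_combination hform
  have h1 := norm_sum_Icc_mul_cpow_le (f := 1) (fun n => by simp)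
    (half_pos hε) hs N hN1
  have h2 := norm_mul_tail_le (le_refl (1 : ℝ)) hT hTN (half_pos hε) (by linarith) hs
    (norm_integral_Ioi_one_cpow_le (norm_tailFrac_le N) hN1
      (fun t ht => tailFrac_eq_zero N ht) hσ)
  have h3 : 2 * (ε / 2) = ε := by ring
  rw [h3] at h1 h2
  have hNε : 1 ≤ (N : ℝ) ^ ε := Real.one_le_rpow hN1' hε.le
  have h6 : ‖((N : ℂ) ^ (1 - s) - 1) / (s - 1)‖ ≤ 2 * (N : ℝ) ^ ε := by
    rw [norm_div]
    refine (div_le_self (norm_nonneg _) hs1).trans ((norm_sub_le _ _).trans ?_)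
    rw [← ofReal_natCast, norm_cpow_eq_rpow_re_of_pos (by linarith), norm_one]
    have : (N : ℝ) ^ (1 - s).re ≤ (N : ℝ) ^ ε := by
      refine Real.rpow_le_rpow_of_exponent_le hN1' ?_
      simp
      linarith
    linarith
  have h4 := ceil_rpow_le (by linarith : 1 ≤ T) hε hε1
  rw [hz]
  have h7 : |s.im| + 2 = T := by rw [hT, one_mul]
  rw [h7]
  have hTε : 0 ≤ T ^ ε := by positivity
  calc ‖S₁ + ((N : ℂ) ^ (1 - s) - 1) / (s - 1) + s * J‖
      ≤ (1 + 1 / (ε / 2)) * (N : ℝ) ^ ε + 2 * (N : ℝ) ^ ε + 4 * (N : ℝ) ^ ε :=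
        norm_add₃_le.trans (add_le_add_three h1 h6 h2)
    _ = (7 + 1 / (ε / 2)) * (N : ℝ) ^ ε := by ring
    _ ≤ (7 + 1 / (ε / 2)) * (2 * T ^ ε) := by gcongr
    _ = 2 * (7 + 1 / (ε / 2)) * T ^ ε := by ring
    _ ≤ _ := by gcongr; exact le_max_right _ _

lemma norm_deriv_le_of_forall_re {f : ℂ → ℂ} (hf : Differentiable ℂ f) {R U : ℝ} (hR : 0 < R)
    {s : ℂ} (hU : ∀ w ∈ Metric.closedBall s R, ‖f w‖ ≤ U) : ‖deriv f s‖ ≤ U / R :=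
  norm_deriv_le_of_forall_mem_sphere_norm_le hR hf.diffContOnCl
    fun z hz => hU z (Metric.sphere_subset_closedBall hz)

lemma abs_re_sub_le_of_mem_closedBall {s w : ℂ} {R : ℝ} (hw : w ∈ Metric.closedBall s R) :
    |w.re - s.re| ≤ R ∧ |w.im - s.im| ≤ R := by
  rw [Metric.mem_closedBall, dist_eq] at hw
  exact ⟨by simpa using (abs_re_le_norm (w - s)).trans hw,
    by simpa using (abs_im_le_norm (w - s)).trans hw⟩

lemma one_le_of_three_four_one {f : ℂ → ℂ} {t D M : ℝ} (hD : 1 ≤ D) (hM : 1 ≤ M)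
    (h34 : ∀ x : ℝ, 0 < x → x ≤ 1 → x ^ 3 ≤ D * ‖f (1 + x + I * t)‖ ^ 4)
    (hder : ∀ w : ℂ, 1 ≤ w.re → w.re ≤ 2 → w.im = t → DifferentiableAt ℂ f w ∧ ‖deriv f w‖ ≤ M)
    {x : ℝ} (hx : 0 < x) (hx1 : x ≤ 1) : 1 / (16 * D * M ^ 3) ≤ ‖f (1 + x + I * t)‖ := by
  set x₀ : ℝ := 1 / (16 * D * M ^ 4) with hx₀
  have hD0 : 0 < D := by linarith
  have hM0 : 0 < M := by linarith
  have hx₀0 : 0 < x₀ := by positivity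
  have hx₀1 : x₀ ≤ 1 := by
    rw [hx₀, div_le_one (by positivity)]
    have : 1 ≤ M ^ 4 := one_le_pow₀ hM
    nlinarith
  have hMx : 1 / (16 * D * M ^ 3) = M * x₀ := by
    rw [hx₀]; field_simp
  have key : ∀ y : ℝ, x₀ ≤ y → y ≤ 1 → 2 * (M * x₀) ≤ ‖f (1 + y + I * t)‖ := by
    intro y hy hy1
    have h1 := h34 y (by linarith) hy1
    have h2 : x₀ ^ 3 ≤ y ^ 3 := by gcongr
    have h3 : x₀ ^ 3 = D * (2 * (M * x₀)) ^ 4 := by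
      rw [hx₀]; field_simp; norm_num
    have h4 : (2 * (M * x₀)) ^ 4 ≤ ‖f (1 + y + I * t)‖ ^ 4 := by
      have : D * (2 * (M * x₀)) ^ 4 ≤ D * ‖f (1 + y + I * t)‖ ^ 4 := by linarith
      exact le_of_mul_le_mul_left this hD0
    exact le_of_pow_le_pow_left₀ (by norm_num) (norm_nonneg _) h4
  rw [hMx]
  rcases le_total x₀ x with h | h
  · have := key x h hx1
    have : 0 < M * x₀ := by positivity
    linarith
  · have hconv : Convex ℝ (Icc (1 : ℝ) 2 ×ℂ {t}) := by
      intro a ha b hb u v hu hv huv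
      simp only [mem_reProdIm, mem_Icc, mem_singleton_iff] at ha hb ⊢
      simp only [add_re, add_im, real_smul, re_ofReal_mul, im_ofReal_mul]
      refine ⟨⟨by nlinarith, by nlinarith⟩, ?_⟩
      rw [ha.2, hb.2, ← add_mul, huv, one_mul]
    have hmem : ∀ y : ℝ, 0 ≤ y → y ≤ 1 → (1 + y + I * t : ℂ) ∈ Icc (1 : ℝ) 2 ×ℂ {t} := by
      intro y h0 h1
      simp only [mem_reProdIm, mem_Icc, mem_singleton_iff]
      simp
      constructor <;> linarith
    have h1 := hconv.norm_image_sub_le_of_norm_deriv_le (f := f) (C := M)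
      (fun w hw => (hder w hw.1.1 hw.1.2 hw.2).1) (fun w hw => (hder w hw.1.1 hw.1.2 hw.2).2)
      (hmem x hx.le hx1) (hmem x₀ hx₀0.le hx₀1)
    have h2 : ‖(1 + x₀ + I * t : ℂ) - (1 + x + I * t)‖ ≤ x₀ := by
      have : (1 + x₀ + I * t : ℂ) - (1 + x + I * t) = ((x₀ - x : ℝ) : ℂ) := by push_cast; ring
      rw [this, norm_real, Real.norm_eq_abs, abs_of_nonneg (by linarith)]
      linarith
    have h3 := key x₀ le_rfl hx₀1
    have h4 := norm_sub_norm_le (f (1 + x₀ + I * t)) (f (1 + x + I * t))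
    have h5 : M * ‖(1 + x₀ + I * t : ℂ) - (1 + x + I * t)‖ ≤ M * x₀ := by gcongr
    linarith

/-- The bound for the derivative of a Dirichlet `L`-function that follows from Cauchy's estimate. -/
theorem norm_deriv_LFunction_le (ε : ℝ) (hε : 0 < ε) (hε1 : ε ≤ 1) :
    ∃ C : ℝ, 1 ≤ C ∧ ∀ (q : ℕ) [NeZero q] (χ : DirichletCharacter ℂ q), χ ≠ 1 → ∀ s : ℂ,
      1 - ε / 4 ≤ s.re →
      ‖deriv (DirichletCharacter.LFunction χ) s‖ ≤ C * (q * (|s.im| + 2)) ^ ε := by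
  obtain ⟨C, hC, h⟩ := norm_LFunction_le ε hε hε1
  refine ⟨C * 2 / (ε / 4), ?_, ?_⟩
  · rw [le_div_iff₀ (by positivity)]; linarith
  intro q _ χ hχ s hs
  have hq : (1 : ℝ) ≤ q := by exact_mod_cast NeZero.one_le
  have hb : ∀ w ∈ Metric.closedBall s (ε / 4),
      ‖DirichletCharacter.LFunction χ w‖ ≤ C * 2 * (q * (|s.im| + 2)) ^ ε := by
    intro w hw
    obtain ⟨h1, h2⟩ := abs_re_sub_le_of_mem_closedBall hw
    rw [abs_le] at h1
    refine (h q χ hχ w (by linarith)).trans ?_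
    rw [mul_assoc]
    gcongr
    have h3 : |w.im| ≤ |s.im| + 1 / 4 := by
      have := abs_sub_abs_le_abs_sub w.im s.im
      linarith
    have h4 : (q : ℝ) * (|w.im| + 2) ≤ 2 * (q * (|s.im| + 2)) := by
      have : |w.im| + 2 ≤ 2 * (|s.im| + 2) := by linarith [abs_nonneg s.im]
      nlinarith
    calc (q * (|w.im| + 2) : ℝ) ^ ε ≤ (2 * (q * (|s.im| + 2))) ^ ε := by gcongr
      _ = 2 ^ ε * (q * (|s.im| + 2)) ^ ε := by
        rw [Real.mul_rpow (by norm_num) (by positivity)]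
      _ ≤ 2 * (q * (|s.im| + 2)) ^ ε := by
        gcongr
        calc (2 : ℝ) ^ ε ≤ 2 ^ (1 : ℝ) := by gcongr; norm_num
          _ = 2 := by norm_num
  have := norm_deriv_le_of_forall_re (DirichletCharacter.differentiable_LFunction hχ)
    (by positivity) hb
  calc _ ≤ _ := this
    _ = _ := by ring

theorem norm_deriv_zetaReg_le (ε : ℝ) (hε : 0 < ε) (hε1 : ε ≤ 1) :
    ∃ C : ℝ, 1 ≤ C ∧ ∀ s : ℂ, 1 - ε / 4 ≤ s.re →
      ‖deriv zetaReg s‖ ≤ C * (|s.im| + 2) ^ ε := by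
  obtain ⟨C, hC, h⟩ := norm_zetaReg_le ε hε hε1
  refine ⟨C * 2 / (ε / 4), ?_, ?_⟩
  · rw [le_div_iff₀ (by positivity)]; linarith
  intro s hs
  have hb : ∀ w ∈ Metric.closedBall s (ε / 4), ‖zetaReg w‖ ≤ C * 2 * (|s.im| + 2) ^ ε := by
    intro w hw
    obtain ⟨h1, h2⟩ := abs_re_sub_le_of_mem_closedBall hw
    rw [abs_le] at h1
    refine (h w (by linarith)).trans ?_
    rw [mul_assoc]
    gcongr
    have h3 : |w.im| ≤ |s.im| + 1 / 4 := by
      have := abs_sub_abs_le_abs_sub w.im s.im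
      linarith
    calc (|w.im| + 2 : ℝ) ^ ε ≤ (2 * (|s.im| + 2)) ^ ε := by
          gcongr
          nlinarith [abs_nonneg s.im]
      _ = 2 ^ ε * (|s.im| + 2) ^ ε := by
        rw [Real.mul_rpow (by norm_num) (by positivity)]
      _ ≤ 2 * (|s.im| + 2) ^ ε := by
        gcongr
        calc (2 : ℝ) ^ ε ≤ 2 ^ (1 : ℝ) := by gcongr; norm_num
          _ = 2 := by norm_num
  have := norm_deriv_le_of_forall_re differentiable_zetaReg (by positivity) hb
  calc _ ≤ _ := this
    _ = _ := by ring

lemma prod_one_sub_pow_three_mul_le (S : Finset ℕ) (hS : ∀ p ∈ S, p.Prime) {x : ℝ} (hx : 0 < x)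
    (t : ℝ) : ‖∏ p ∈ S, (1 - (p : ℂ) ^ (-(1 + x : ℂ)))‖ ^ 3
      * ‖∏ p ∈ S, (1 - (p : ℂ) ^ (-(1 + x + 2 * I * t : ℂ)))‖ ≤ 1 := by
  rw [norm_prod, norm_prod, ← Finset.prod_pow, ← Finset.prod_mul_distrib]
  refine Finset.prod_le_one (fun _ _ => by positivity) fun p hp => ?_
  have hp0 : (0 : ℝ) < p := by exact_mod_cast (hS p hp).pos
  have hp2 : (1 : ℝ) ≤ p := by exact_mod_cast (hS p hp).one_lt.le
  set u : ℝ := (p : ℝ) ^ (-(1 + x)) with hu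
  have hu0 : 0 < u := by positivity
  have hu1 : u ≤ 1 := Real.rpow_le_one_of_one_le_of_nonpos hp2 (by linarith)
  have h1 : ((p : ℂ) ^ (-(1 + x : ℂ))) = (u : ℂ) := by
    rw [hu, ofReal_cpow hp0.le]; push_cast; rfl
  have h2 : ‖(1 : ℂ) - (p : ℂ) ^ (-(1 + x + 2 * I * t : ℂ))‖ ≤ 1 + u := by
    refine (norm_sub_le _ _).trans ?_
    rw [norm_one, ← ofReal_natCast, norm_cpow_eq_rpow_re_of_pos hp0]
    simp [hu]
  have h3 : ‖(1 : ℂ) - (p : ℂ) ^ (-(1 + x : ℂ))‖ = 1 - u := by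
    rw [h1, ← ofReal_one, ← ofReal_sub, norm_real, Real.norm_eq_abs, abs_of_nonneg (by linarith)]
  rw [h3]
  calc (1 - u) ^ 3 * _ ≤ (1 - u) ^ 3 * (1 + u) := by
        have : 0 ≤ 1 - u := by linarith
        gcongr
    _ ≤ 1 := by nlinarith [mul_nonneg hu0.le (sub_nonneg.2 hu1), sq_nonneg u, pow_le_one₀ (n := 2) hu0.le hu1]

lemma norm_prod_one_sub_le_one (S : Finset ℕ) (hS : ∀ p ∈ S, p.Prime) {x : ℝ} (hx : 0 < x) :
    ‖∏ p ∈ S, (1 - (p : ℂ) ^ (-(1 + x : ℂ)))‖ ≤ 1 := by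
  rw [norm_prod]
  refine Finset.prod_le_one (fun _ _ => by positivity) fun p hp => ?_
  have hp0 : (0 : ℝ) < p := by exact_mod_cast (hS p hp).pos
  have hp2 : (1 : ℝ) ≤ p := by exact_mod_cast (hS p hp).one_lt.le
  set u : ℝ := (p : ℝ) ^ (-(1 + x)) with hu
  have hu0 : 0 < u := by positivity
  have hu1 : u ≤ 1 := Real.rpow_le_one_of_one_le_of_nonpos hp2 (by linarith)
  have h1 : ((p : ℂ) ^ (-(1 + x : ℂ))) = (u : ℂ) := by
    rw [hu, ofReal_cpow hp0.le]; push_cast; rfl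
  rw [h1, ← ofReal_one, ← ofReal_sub, norm_real, Real.norm_eq_abs, abs_of_nonneg (by linarith)]
  linarith

lemma exists_norm_riemannZeta_one_add_le :
    ∃ C : ℝ, 1 ≤ C ∧ ∀ x : ℝ, 0 < x → x ≤ 1 → ‖riemannZeta (1 + x)‖ ≤ C / x := by
  obtain ⟨C, hC, h⟩ := norm_zetaReg_le 1 one_pos le_rfl
  refine ⟨C * 2 + 1, by linarith, fun x hx hx1 => ?_⟩
  have hne : (1 + x : ℂ) ≠ 1 := by
    simpa using hx.ne'
  have h1 := zetaReg_of_ne hne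
  have h2 : riemannZeta (1 + x) = zetaReg (1 + x) + 1 / x := by
    rw [h1]; simp
  have h3 := h (1 + x) (by simp; linarith)
  rw [h2]
  refine (norm_add_le _ _).trans ?_
  have h4 : ‖(1 / x : ℂ)‖ = 1 / x := by
    rw [norm_div, norm_one, norm_real, Real.norm_eq_abs, abs_of_pos hx]
  rw [h4, add_div]
  gcongr
  refine h3.trans ?_
  simp
  rw [le_div_iff₀ hx]
  nlinarith

theorem exists_three_four_one :
    ∃ C : ℝ, 1 ≤ C ∧ ∀ (q : ℕ) [NeZero q] (χ : DirichletCharacter ℂ q) (x t : ℝ),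
      0 < x → x ≤ 1 →
      x ^ 3 ≤ C * ‖DirichletCharacter.LFunction (χ ^ 2) (1 + x + 2 * I * t)‖
        * ‖DirichletCharacter.LFunction χ (1 + x + I * t)‖ ^ 4 ∧
      (χ ^ 2 = 1 → x ^ 3 ≤ C * ‖riemannZeta (1 + x + 2 * I * t)‖
        * ‖DirichletCharacter.LFunction χ (1 + x + I * t)‖ ^ 4) := by
  obtain ⟨C, hC, h⟩ := exists_norm_riemannZeta_one_add_le
  refine ⟨C ^ 3, one_le_pow₀ hC, fun q _ χ x t hx hx1 => ?_⟩
  have h0 := DirichletCharacter.norm_LFunction_product_ge_one χ hx t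
  have hne : (1 + x : ℂ) ≠ 1 := by simpa using hx.ne'
  have hne2 : (1 + x + 2 * I * t : ℂ) ≠ 1 := by
    intro h
    have := congrArg re h
    simp at this
    exact hx.ne' this
  have hz := h x hx hx1
  have hx3 : ‖riemannZeta (1 + x)‖ ^ 3 * x ^ 3 ≤ C ^ 3 := by
    rw [← mul_pow]
    gcongr
    rwa [le_div_iff₀ hx] at hz
  rw [norm_mul, norm_mul, norm_pow, norm_pow,
    DirichletCharacter.LFunctionTrivChar_eq_mul_riemannZeta hne, norm_mul] at h0
  set L := ‖DirichletCharacter.LFunction χ (1 + x + I * t)‖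
  set ζ₁ := ‖riemannZeta (1 + x)‖
  have hS : ∀ p ∈ q.primeFactors, p.Prime := fun p hp => Nat.prime_of_mem_primeFactors hp
  constructor
  · set L₂ := ‖DirichletCharacter.LFunction (χ ^ 2) (1 + x + 2 * I * t)‖
    have hP := norm_prod_one_sub_le_one q.primeFactors hS hx
    set P := ‖∏ p ∈ q.primeFactors, (1 - (p : ℂ) ^ (-(1 + x : ℂ)))‖
    calc x ^ 3 = x ^ 3 * 1 := by ring
      _ ≤ x ^ 3 * ((P * ζ₁) ^ 3 * L ^ 4 * L₂) := by gcongr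
      _ ≤ x ^ 3 * ((1 * ζ₁) ^ 3 * L ^ 4 * L₂) := by gcongr
      _ = (ζ₁ ^ 3 * x ^ 3) * L₂ * L ^ 4 := by ring
      _ ≤ _ := by gcongr
  · intro h2
    rw [h2] at h0
    change _ * ‖DirichletCharacter.LFunctionTrivChar q _‖ ≥ 1 at h0
    rw [DirichletCharacter.LFunctionTrivChar_eq_mul_riemannZeta hne2, norm_mul] at h0
    have hP := prod_one_sub_pow_three_mul_le q.primeFactors hS hx t
    set P := ‖∏ p ∈ q.primeFactors, (1 - (p : ℂ) ^ (-(1 + x : ℂ)))‖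
    set P₂ := ‖∏ p ∈ q.primeFactors, (1 - (p : ℂ) ^ (-(1 + x + 2 * I * t : ℂ)))‖
    set ζ₂ := ‖riemannZeta (1 + x + 2 * I * t)‖
    calc x ^ 3 = x ^ 3 * 1 := by ring
      _ ≤ x ^ 3 * ((P * ζ₁) ^ 3 * L ^ 4 * (P₂ * ζ₂)) := by gcongr
      _ = (P ^ 3 * P₂) * ((ζ₁ ^ 3 * x ^ 3) * ζ₂ * L ^ 4) := by ring
      _ ≤ 1 * ((C ^ 3) * ζ₂ * L ^ 4) := by gcongr
      _ = _ := by ring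

section

open scoped ComplexOrder

lemma iteratedDeriv_inv_sub_one_two (k : ℕ) :
    iteratedDeriv k (fun s : ℂ => (s - 1)⁻¹) 2 = (-1) ^ k * k.factorial := by
  have h := iteratedDeriv_comp_sub_const k (fun s : ℂ => s⁻¹) (1 : ℂ)
  have h2 := congrFun h 2
  rw [h2, iteratedDeriv_eq_iterate]
  have h3 : (2 : ℂ) - 1 = 1 := by norm_num
  rw [h3]
  simp

lemma geom_sum_le_four {v : ℝ} (hv : 0 ≤ v) (hv1 : v ≤ 3 / 4) (m : ℕ) :
    ∑ i ∈ Finset.range m, v ^ i ≤ 4 := by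
  calc _ ≤ ∑' i, v ^ i := (summable_geometric_of_lt_one hv (by linarith)).sum_le_tsum _
        (fun i _ => by positivity)
    _ = (1 - v)⁻¹ := tsum_geometric_of_lt_one hv (by linarith)
    _ ≤ 4 := by
      rw [inv_le_comm₀ (by linarith) (by norm_num)]
      linarith

lemma re_lower_bound_of_hasSum {g : ℕ → ℝ} {l S B u : ℝ} (hu : 1 < u) (hu1 : u ≤ 11 / 10)
    (hS : HasSum (fun k => g k * u ^ k) S) (hg : ∀ k, -l ≤ g k) (hg0 : 1 / 100 - l ≤ g 0)
    (hB : ∀ k, |g k| ≤ B * (2 / 3) ^ k) {K : ℕ} (hK : 1 ≤ K)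
    (hKB : B * (3 / 4) ^ K ≤ 1 / 800) : 1 / 200 - l * ((u ^ K - 1) / (u - 1)) ≤ S := by
  have hB0 : 0 ≤ B := by simpa using (abs_nonneg _).trans (hB 0)
  have hlim := (hS.tendsto_sum_nat).comp (tendsto_add_atTop_nat K)
  refine ge_of_tendsto' hlim fun m => ?_
  simp only [Function.comp]
  rw [add_comm, Finset.sum_range_add]
  have h1 : 1 / 100 - l * ((u ^ K - 1) / (u - 1)) ≤ ∑ k ∈ Finset.range K, g k * u ^ k := by
    rw [← geom_sum_eq hu.ne', Finset.mul_sum]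
    obtain ⟨K', rfl⟩ : ∃ K', K = K' + 1 := ⟨K - 1, by omega⟩
    rw [Finset.sum_range_succ', Finset.sum_range_succ' (fun k => g k * u ^ k)]
    have : -∑ k ∈ Finset.range K', l * u ^ (k + 1) ≤
        ∑ k ∈ Finset.range K', g (k + 1) * u ^ (k + 1) := by
      rw [← Finset.sum_neg_distrib]
      refine Finset.sum_le_sum fun k _ => ?_
      rw [← neg_mul]
      have := hg (k + 1)
      have hu0 : 0 < u := by linarith
      gcongr
    simp only [pow_zero, mul_one]
    linarith
  have h2 : -(1 / 200) ≤ ∑ x ∈ Finset.range m, g (K + x) * u ^ (K + x) := by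
    have hv0 : 0 ≤ 2 / 3 * u := by linarith
    have h3 : ∀ x, -(B * (3 / 4) ^ K * (2 / 3 * u) ^ x) ≤ g (K + x) * u ^ (K + x) := by
      intro x
      have h4 : |g (K + x) * u ^ (K + x)| ≤ B * (3 / 4) ^ K * (2 / 3 * u) ^ x := by
        rw [abs_mul, abs_of_nonneg (by positivity : 0 ≤ u ^ (K + x))]
        calc |g (K + x)| * u ^ (K + x) ≤ B * (2 / 3) ^ (K + x) * u ^ (K + x) := by
              gcongr; exact hB _
          _ = B * (2 / 3 * u) ^ K * (2 / 3 * u) ^ x := by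
            rw [mul_assoc, ← mul_pow, pow_add, mul_assoc]
          _ ≤ _ := by gcongr; linarith
      exact (abs_le.1 h4).1
    have h5 := Finset.sum_le_sum (s := Finset.range m) fun x _ => h3 x
    rw [Finset.sum_neg_distrib, ← Finset.mul_sum] at h5
    have h6 := geom_sum_le_four hv0 (by linarith) m
    have h7 : B * (3 / 4) ^ K * ∑ i ∈ Finset.range m, (2 / 3 * u) ^ i ≤ 1 / 800 * 4 := by
      gcongr
    linarith
  linarith

/-- Estermann's lower bound for the residue at `1` of `ζ · P`. -/
theorem estermann_lower_bound :
    ∃ c : ℝ, 0 < c ∧ ∀ (P : ℂ → ℂ) (M : ℝ), Differentiable ℂ P → 1 ≤ M →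
      (∀ s ∈ Metric.closedBall (2 : ℂ) (3 / 2), ‖P s‖ ≤ M) →
      (∀ k : ℕ, 0 ≤ (-1) ^ k * iteratedDeriv k (fun s => riemannZeta s * P s) 2) →
      1 / 100 ≤ (riemannZeta 2 * P 2).re → ∀ σ : ℝ, 9 / 10 ≤ σ → σ < 1 →
      (riemannZeta σ * P σ).re ≤ 0 → c * (1 - σ) * M ^ (-(4 * (1 - σ))) ≤ ‖P 1‖ := by
  obtain ⟨C₀, hC₀⟩ := (isCompact_closedBall (2 : ℂ) (3 / 2)).exists_bound_of_continuousOn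
    differentiable_zetaReg.continuous.continuousOn
  have hC₀0 : 0 ≤ C₀ := (norm_nonneg _).trans (hC₀ 2 (Metric.mem_closedBall_self (by norm_num)))
  set C₁ : ℝ := 4 + C₀ with hC₁
  refine ⟨1 / (400 * (800 * C₁)), by positivity, ?_⟩
  intro P M hP hM hPM hpos h2 σ hσ hσ1 hneg
  set G : ℂ → ℂ := fun s => dslope P 1 s + zetaReg s * P s with hG
  have hds : Differentiable ℂ (dslope P 1) := by
    rw [← differentiableOn_univ]
    exact (Complex.differentiableOn_dslope univ_mem).2 hP.differentiableOn
  have hGd : Differentiable ℂ G := hds.add (differentiable_zetaReg.mul hP)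
  have hGeq : ∀ s : ℂ, s ≠ 1 → G s = riemannZeta s * P s - P 1 * (s - 1)⁻¹ := by
    intro s hs
    have : s - 1 ≠ 0 := sub_ne_zero.2 hs
    simp only [hG]
    rw [dslope_of_ne _ hs, slope_def_field, zetaReg_of_ne hs]
    field_simp
    ring
  have h1mem : (1 : ℂ) ∈ Metric.closedBall (2 : ℂ) (3 / 2) := by
    rw [Metric.mem_closedBall, dist_eq]
    norm_num
  have hGM : ∀ s ∈ Metric.sphere (2 : ℂ) (3 / 2), ‖G s‖ ≤ C₁ * M := by
    intro s hs
    have hs' := Metric.sphere_subset_closedBall hs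
    have hdist : 1 / 2 ≤ ‖s - 1‖ := by
      rw [mem_sphere_iff_norm] at hs
      have := norm_sub_norm_le (s - 2) (1 - 2 : ℂ)
      rw [hs, sub_sub_sub_cancel_right] at this
      norm_num at this
      linarith
    have hs1 : s ≠ 1 := by
      rintro rfl
      norm_num at hdist
    simp only [hG]
    rw [dslope_of_ne _ hs1, slope_def_field]
    refine (norm_add_le _ _).trans ?_
    rw [norm_div, norm_mul]
    have e1 : ‖P s - P 1‖ ≤ 2 * M := by
      refine (norm_sub_le _ _).trans ?_
      have := hPM s hs'
      have := hPM 1 h1mem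
      linarith
    have e2 : ‖P s - P 1‖ / ‖s - 1‖ ≤ 4 * M := by
      rw [div_le_iff₀ (by linarith)]
      nlinarith
    have e3 : ‖zetaReg s‖ * ‖P s‖ ≤ C₀ * M := by
      gcongr
      · exact hC₀ s hs'
      · exact hPM s hs'
    rw [hC₁]
    linarith
  have hGcoef : ∀ k : ℕ, iteratedDeriv k G 2 =
      iteratedDeriv k (fun s => riemannZeta s * P s) 2 - P 1 * ((-1) ^ k * k.factorial) := by
    intro k
    have hev : G =ᶠ[𝓝 2] (fun s => riemannZeta s * P s) - (fun s => P 1 * (s - 1)⁻¹) := by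
      have : ∀ᶠ s : ℂ in 𝓝 2, s ≠ 1 := isOpen_ne.mem_nhds (by norm_num)
      filter_upwards [this] with s hs
      simp [hGeq s hs]
    rw [hev.iteratedDeriv_eq, iteratedDeriv_sub, iteratedDeriv_const_mul_field,
      iteratedDeriv_inv_sub_one_two]
    · have hd : DifferentiableOn ℂ (fun s => riemannZeta s * P s) {s | s ≠ 1} := fun s hs =>
        ((differentiableAt_riemannZeta hs).mul (hP s)).differentiableWithinAt
      exact (hd.analyticAt (isOpen_ne.mem_nhds (by norm_num))).contDiffAt
    · refine contDiffAt_const.mul (ContDiffAt.inv (by fun_prop) (by norm_num))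
  set g : ℕ → ℝ := fun k => (((-1) ^ k * iteratedDeriv k G 2).re) / k.factorial with hg
  set l := (P 1).re with hl
  have hgl : ∀ k, g k = ((-1) ^ k * iteratedDeriv k (fun s => riemannZeta s * P s) 2).re
      / k.factorial - l := by
    intro k
    have hk : (k.factorial : ℝ) ≠ 0 := by positivity
    simp only [hg]
    rw [hGcoef, mul_sub]
    have : (-1 : ℂ) ^ k * (P 1 * ((-1) ^ k * k.factorial)) = ((k.factorial : ℝ) : ℂ) * P 1 := by
      have : (-1 : ℂ) ^ k * (-1) ^ k = 1 := by rw [← mul_pow]; simp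
      push_cast
      linear_combination (P 1 * k.factorial) * this
    rw [this, sub_re, re_ofReal_mul, ← hl]
    field_simp
  set u : ℝ := 2 - σ with hu
  have hsum : HasSum (fun k => g k * u ^ k) (G σ).re := by
    have h := Complex.hasSum_taylorSeries_on_ball (f := G) (c := 2) (r := 3 / 2) (z := (σ : ℂ))
      hGd.differentiableOn (by
        rw [Metric.mem_ball, dist_eq, show (σ : ℂ) - 2 = ((σ - 2 : ℝ) : ℂ) by push_cast; ring,
          norm_real, Real.norm_eq_abs, abs_lt]
        constructor <;> linarith)
    have h' := Complex.hasSum_re h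
    refine h'.congr_fun ?_ |> fun h => h
    intro k
    simp only [hg, smul_eq_mul]
    have e : ((σ : ℂ) - 2) ^ k = ((u ^ k : ℝ) : ℂ) * (-1) ^ k := by
      rw [hu, show (σ : ℂ) - 2 = ((2 - σ : ℝ) : ℂ) * (-1) by push_cast; ring, mul_pow]
      push_cast; ring
    rw [e, show ((k.factorial : ℂ)⁻¹ * (((u ^ k : ℝ) : ℂ) * (-1) ^ k * iteratedDeriv k G 2)) =
      (((k.factorial : ℝ)⁻¹ * u ^ k : ℝ) : ℂ) * ((-1) ^ k * iteratedDeriv k G 2) by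
        push_cast; ring, re_ofReal_mul]
    ring
  have hgB : ∀ k, |g k| ≤ C₁ * M * (2 / 3) ^ k := by
    intro k
    have hk : (0 : ℝ) < k.factorial := by positivity
    have := norm_iteratedDeriv_le_of_forall_mem_sphere_norm_le k (by norm_num) hGd.diffContOnCl hGM
    simp only [hg]
    rw [abs_div, abs_of_pos hk, div_le_iff₀ hk]
    refine (abs_re_le_norm _).trans ?_
    rw [norm_mul, norm_pow, norm_neg, norm_one, one_pow, one_mul]
    refine this.trans (le_of_eq ?_)
    rw [div_eq_mul_inv, ← inv_pow]
    norm_num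
    ring
  have hC₁4 : 4 ≤ C₁ := by linarith
  have hCM : 1 ≤ 800 * C₁ * M := by nlinarith
  set K : ℕ := ⌈4 * Real.log (800 * C₁ * M)⌉₊ with hK
  have hlogpos : 0 < Real.log (800 * C₁ * M) := Real.log_pos (by nlinarith)
  have hK1 : 1 ≤ K := Nat.one_le_ceil_iff.2 (by positivity)
  have hKB : C₁ * M * (3 / 4) ^ K ≤ 1 / 800 := by
    have e1 : (3 / 4 : ℝ) ^ K ≤ Real.exp (-(Real.log (800 * C₁ * M))) := by
      have e2 : (3 / 4 : ℝ) ≤ Real.exp (-(1 / 4)) := by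
        have := Real.add_one_le_exp (-(1 / 4) : ℝ)
        linarith
      calc (3 / 4 : ℝ) ^ K ≤ Real.exp (-(1 / 4)) ^ K := by gcongr
        _ = Real.exp (-(K / 4)) := by
          rw [← Real.exp_nat_mul]; congr 1; ring
        _ ≤ _ := by
          apply Real.exp_le_exp.2
          have := Nat.le_ceil (4 * Real.log (800 * C₁ * M))
          linarith
    rw [Real.exp_neg, Real.exp_log (by positivity)] at e1
    calc C₁ * M * (3 / 4) ^ K ≤ C₁ * M * (800 * C₁ * M)⁻¹ := by gcongr
      _ = 1 / 800 := by field_simp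
  have hu1 : 1 < u := by rw [hu]; linarith
  have hmain := re_lower_bound_of_hasSum (l := l) hu1 (by rw [hu]; linarith) hsum
    (fun k => by
      rw [hgl]
      have := (Complex.nonneg_iff.1 (hpos k)).1
      have : 0 ≤ ((-1) ^ k * iteratedDeriv k (fun s => riemannZeta s * P s) 2).re / k.factorial :=
        by positivity
      linarith)
    (by
      rw [hgl]
      simpa using h2) hgB hK1 hKB
  have hGσ : (G σ).re ≤ l / (1 - σ) := by
    rw [hGeq σ (by exact_mod_cast hσ1.ne), sub_re]
    have : P 1 * ((σ : ℂ) - 1)⁻¹ = (((σ - 1)⁻¹ : ℝ) : ℂ) * P 1 := by push_cast; ring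
    rw [this, re_ofReal_mul, ← hl]
    have e : (σ - 1)⁻¹ = -(1 - σ)⁻¹ := by rw [← inv_neg]; congr 1; ring
    rw [e, div_eq_mul_inv]
    linarith
  have hσ0 : 0 < 1 - σ := by linarith
  have hfin : 1 / 200 * (1 - σ) ≤ l * u ^ K := by
    have e : u - 1 = 1 - σ := by rw [hu]; ring
    rw [e] at hmain
    have h3 := hmain.trans hGσ
    have h4 : 1 / 200 ≤ (l * u ^ K) / (1 - σ) := by
      have : l * u ^ K / (1 - σ) = l / (1 - σ) + l * ((u ^ K - 1) / (1 - σ)) := by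
        field_simp; ring
      linarith
    rwa [le_div_iff₀ hσ0] at h4
  have hlP : l ≤ ‖P 1‖ := re_le_norm _
  have huK : u ^ K ≤ 2 * (800 * C₁) * M ^ (4 * (1 - σ)) := by
    have e1 : u ≤ Real.exp (1 - σ) := by
      have := Real.add_one_le_exp (1 - σ)
      rw [hu]; linarith
    have e2 : (K : ℝ) ≤ 4 * Real.log (800 * C₁ * M) + 1 := (Nat.ceil_lt_add_one (by positivity)).le
    calc u ^ K ≤ Real.exp (1 - σ) ^ K := by gcongr
      _ = Real.exp (K * (1 - σ)) := by rw [← Real.exp_nat_mul]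
      _ ≤ Real.exp ((1 - σ) + Real.log (800 * C₁ * M) * (4 * (1 - σ))) := by
        apply Real.exp_le_exp.2
        nlinarith
      _ = Real.exp (1 - σ) * ((800 * C₁) ^ (4 * (1 - σ)) * M ^ (4 * (1 - σ))) := by
        rw [Real.exp_add, ← Real.rpow_def_of_pos (by positivity), Real.mul_rpow (by positivity)
          (by positivity)]
      _ ≤ 2 * ((800 * C₁) * M ^ (4 * (1 - σ))) := by
        gcongr
        · calc Real.exp (1 - σ) ≤ Real.exp (1 / 2) := Real.exp_le_exp.2 (by linarith)
            _ ≤ 2 := by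
              have := Real.exp_one_lt_d9
              rw [show (1 / 2 : ℝ) = 1 / 2 by rfl]
              have h := Real.exp_half 1
              rw [h, Real.sqrt_le_left (by norm_num)]
              linarith
        · calc (800 * C₁) ^ (4 * (1 - σ)) ≤ (800 * C₁) ^ (1 : ℝ) := by
                gcongr
                · linarith
                · linarith
            _ = _ := Real.rpow_one _
      _ = _ := by ring
  have hl0 : 0 < l := by
    by_contra h
    have : l * u ^ K ≤ 0 := mul_nonpos_of_nonpos_of_nonneg (not_lt.1 h) (by positivity)
    nlinarith
  rw [Real.rpow_neg (by linarith)]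
  have hMp : 0 < M ^ (4 * (1 - σ)) := by positivity
  refine le_trans ?_ hlP
  have h5 : 1 / 200 * (1 - σ) ≤ l * (2 * (800 * C₁) * M ^ (4 * (1 - σ))) := hfin.trans (by gcongr)
  calc _ = (1 / 200 * (1 - σ)) / (2 * (800 * C₁) * M ^ (4 * (1 - σ))) := by
        field_simp; norm_num
    _ ≤ l := by rwa [div_le_iff₀ (by positivity)]

lemma iteratedDeriv_alternating_of_deriv_eq {F K : ℂ → ℂ} {s₀ : ℂ} (hF : AnalyticAt ℂ F s₀)
    (hK : AnalyticAt ℂ K s₀) (hFK : deriv F =ᶠ[𝓝 s₀] fun s => -(K s * F s))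
    (hKpos : ∀ k : ℕ, 0 ≤ (-1) ^ k * iteratedDeriv k K s₀) (h0 : 0 ≤ F s₀) (k : ℕ) :
    0 ≤ (-1) ^ k * iteratedDeriv k F s₀ := by
  induction k using Nat.strong_induction_on with
  | _ k ih =>
    rcases k with _ | n
    · simpa using h0
    · rw [iteratedDeriv_succ', hFK.iteratedDeriv_eq]
      have h1 : iteratedDeriv n (fun s => -(K s * F s)) s₀ =
          -∑ i ∈ Finset.range (n + 1),
            n.choose i * iteratedDeriv i K s₀ * iteratedDeriv (n - i) F s₀ := by
        rw [← iteratedDeriv_mul hK.contDiffAt hF.contDiffAt]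
        exact iteratedDeriv_neg n (K * F) s₀
      rw [h1, pow_succ, mul_neg_one, neg_mul_neg, Finset.mul_sum]
      refine Finset.sum_nonneg fun i hi => ?_
      rw [Finset.mem_range] at hi
      have h2 : (-1 : ℂ) ^ n = (-1) ^ i * (-1) ^ (n - i) := by
        rw [← pow_add]; congr 1; omega
      have h3 : (-1 : ℂ) ^ n * (n.choose i * iteratedDeriv i K s₀ * iteratedDeriv (n - i) F s₀) =
          n.choose i * (((-1) ^ i * iteratedDeriv i K s₀) *
            ((-1) ^ (n - i) * iteratedDeriv (n - i) F s₀)) := by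
        rw [h2]; ring
      rw [h3]
      exact mul_nonneg (Nat.cast_nonneg _) (mul_nonneg (hKpos i) (ih _ (by omega)))

lemma iteratedDeriv_alternating_of_logDeriv {F : ℂ → ℂ} {a : ℕ → ℂ}
    (hF : DifferentiableOn ℂ F {s | 1 < s.re}) (ha : 0 ≤ a)
    (hsum : ∀ s : ℂ, 1 < s.re → LSeriesSummable a s)
    (hFa : ∀ s : ℂ, 1 < s.re → deriv F s = -(LSeries a s * F s)) (h0 : 0 ≤ F 2) (k : ℕ) :
    0 ≤ (-1) ^ k * iteratedDeriv k F 2 := by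
  have hopen : IsOpen {s : ℂ | 1 < s.re} := isOpen_lt continuous_const continuous_re
  have hmem : {s : ℂ | 1 < s.re} ∈ 𝓝 (2 : ℂ) := hopen.mem_nhds (by simp)
  have hab : LSeries.abscissaOfAbsConv a < ((2 : ℝ) : EReal) := by
    refine lt_of_le_of_lt (LSeries.abscissaOfAbsConv_le_of_forall_lt_LSeriesSummable (x := 1)
      fun y hy => hsum y (by simpa using hy)) ?_
    norm_cast
  refine iteratedDeriv_alternating_of_deriv_eq (K := LSeries a) (hF.analyticAt hmem) ?_ ?_ ?_ h0 k
  · exact LSeries_analyticOnNhd a 2 (by simpa using hab)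
  · filter_upwards [hmem] with s hs using hFa s hs
  · intro j
    simpa using LSeries.iteratedDeriv_alternating ha hab j

lemma im_eq_zero_of_forall_gt {f : ℂ → ℂ} (hf : Differentiable ℂ f)
    (h : ∀ x : ℝ, 1 < x → (f x).im = 0) (x : ℝ) : (f x).im = 0 := by
  have han : AnalyticOnNhd ℝ (fun x : ℝ => (f x).im) univ := by
    intro y _
    have h1 : AnalyticAt ℝ f (y : ℂ) := (hf.analyticAt y).restrictScalars
    have h2 : AnalyticAt ℝ (fun x : ℝ => (x : ℂ)) y := ofRealCLM.analyticAt y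
    exact (imCLM.analyticAt _).comp (h1.comp h2)
  have h0 : (fun x : ℝ => (f x).im) =ᶠ[𝓝 2] 0 := by
    filter_upwards [isOpen_Ioi.mem_nhds (show (2 : ℝ) ∈ Ioi 1 by norm_num)] with y hy
    exact h y hy
  exact han.eqOn_zero_of_preconnected_of_eventuallyEq_zero isPreconnected_univ (mem_univ 2) h0
    (mem_univ x)

lemma DirichletCharacter.apply_of_sq_eq_one {q : ℕ} {χ : DirichletCharacter ℂ q} (h : χ ^ 2 = 1)
    (a : ZMod q) : χ a = 0 ∨ χ a = 1 ∨ χ a = -1 := by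
  by_cases ha : IsUnit a
  · right
    have h1 : (χ ^ 2) a = 1 := by rw [h, MulChar.one_apply ha]
    rw [MulChar.pow_apply' _ two_ne_zero] at h1
    have h2 : (χ a - 1) * (χ a + 1) = 0 := by linear_combination h1
    rcases mul_eq_zero.1 h2 with h3 | h3
    · exact Or.inl (by linear_combination h3)
    · exact Or.inr (by linear_combination h3)
  · left
    exact χ.map_nonunit ha

lemma hasSum_LSeries_two {q : ℕ} (χ : DirichletCharacter ℂ q) :
    HasSum (fun n : ℕ => χ n * ((1 / (n : ℝ) ^ 2 : ℝ) : ℂ)) (LSeries (fun n => χ n) 2) := by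
  have h := (χ.LSeriesSummable_of_one_lt_re (s := 2) (by simp)).LSeriesHasSum
  unfold LSeriesHasSum at h
  convert! h using 2 with n
  rw [LSeries.term_def]
  split_ifs with hn
  · simp [hn]
  · push_cast
    rw [show (2 : ℂ) = ((2 : ℕ) : ℂ) by norm_num, cpow_natCast]
    ring

lemma LFunction_two_of_sq_eq_one {q : ℕ} [NeZero q] {χ : DirichletCharacter ℂ q} (h : χ ^ 2 = 1) :
    ((1 / 3 : ℝ) : ℂ) ≤ DirichletCharacter.LFunction χ 2 := by
  rw [DirichletCharacter.LFunction_eq_LSeries χ (by simp)]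
  have hs := hasSum_LSeries_two χ
  have him : (LSeries (fun n => χ n) 2).im = 0 := by
    refine (hasSum_im hs).unique ?_
    convert! hasSum_zero using 2 with n
    rw [im_mul_ofReal]
    rcases DirichletCharacter.apply_of_sq_eq_one h (n : ZMod q) with h | h | h <;> simp [h]
  have hre : 1 / 3 ≤ (LSeries (fun n => χ n) 2).re := by
    have h1 := hasSum_re hs
    have h2 := hasSum_zeta_two
    have h3 : HasSum (fun n : ℕ => if n = 1 then (2 : ℝ) else 0) 2 := hasSum_ite_eq 1 2
    have h4 := h3.sub h2
    have h5 := hasSum_le (fun n => ?_) h4 h1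
    · have := Real.pi_lt_d2
      have := Real.pi_pos
      nlinarith
    · rw [re_mul_ofReal]
      by_cases hn : n = 1
      · simp [hn]
        norm_num
      · rw [if_neg hn]
        have : 0 ≤ 1 / (n : ℝ) ^ 2 := by positivity
        rcases DirichletCharacter.apply_of_sq_eq_one h (n : ZMod q) with h | h | h <;>
          simp only [h, one_re, zero_re, neg_re] <;> linarith
  rw [Complex.le_def]
  simp [him]
  linarith

lemma riemannZeta_two_ge_one : (1 : ℂ) ≤ riemannZeta 2 := by
  rw [riemannZeta_two]
  have h : (1 : ℝ) ≤ Real.pi ^ 2 / 6 := by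
    have := Real.pi_gt_three
    nlinarith
  have : ((1 : ℝ) : ℂ) ≤ ((Real.pi ^ 2 / 6 : ℝ) : ℂ) := by exact_mod_cast h
  simpa using this

lemma deriv_LFunction_eq_neg {q : ℕ} [NeZero q] (χ : DirichletCharacter ℂ q) {s : ℂ}
    (hs : 1 < s.re) : deriv (DirichletCharacter.LFunction χ) s =
      -(LSeries ((fun n : ℕ => χ n) * fun n : ℕ => (ArithmeticFunction.vonMangoldt n : ℂ)) s
        * DirichletCharacter.LFunction χ s) := by
  have hne : DirichletCharacter.LFunction χ s ≠ 0 :=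
    DirichletCharacter.LFunction_ne_zero_of_one_le_re χ (Or.inr (by rintro rfl; simp at hs)) hs.le
  rw [DirichletCharacter.LSeries_twist_vonMangoldt_eq χ hs,
    DirichletCharacter.deriv_LFunction_eq_deriv_LSeries χ hs,
    ← DirichletCharacter.LFunction_eq_LSeries χ hs]
  field_simp

lemma deriv_riemannZeta_eq_neg {s : ℂ} (hs : 1 < s.re) : deriv riemannZeta s =
    -(LSeries (fun n => (ArithmeticFunction.vonMangoldt n : ℂ)) s * riemannZeta s) := by
  have hne := riemannZeta_ne_zero_of_one_le_re hs.le
  rw [ArithmeticFunction.LSeries_vonMangoldt_eq_deriv_riemannZeta_div hs]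
  field_simp

lemma alternating_zeta_mul_LFunction {q : ℕ} [NeZero q] {χ : DirichletCharacter ℂ q}
    (h1 : χ ≠ 1) (h : χ ^ 2 = 1) (k : ℕ) :
    0 ≤ (-1) ^ k * iteratedDeriv k (fun s => riemannZeta s * DirichletCharacter.LFunction χ s) 2 := by
  have hne : ∀ s : ℂ, 1 < s.re → s ≠ 1 := by rintro s hs rfl; simp at hs
  have hd := DirichletCharacter.differentiable_LFunction h1
  have e1 : ∀ s : ℂ, 1 < s.re →
      LSeriesSummable (fun n => (ArithmeticFunction.vonMangoldt n : ℂ)) s := fun s hs =>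
    ArithmeticFunction.LSeriesSummable_vonMangoldt hs
  have e2 : ∀ s : ℂ, 1 < s.re → LSeriesSummable
      ((fun n : ℕ => χ n) * fun n : ℕ => (ArithmeticFunction.vonMangoldt n : ℂ)) s := fun s hs =>
    DirichletCharacter.LSeriesSummable_twist_vonMangoldt χ hs
  refine iteratedDeriv_alternating_of_logDeriv
    (a := (fun n => (ArithmeticFunction.vonMangoldt n : ℂ)) +
      ((fun n : ℕ => χ n) * fun n : ℕ => (ArithmeticFunction.vonMangoldt n : ℂ))) ?_ ?_ ?_ ?_ ?_ k
  · exact fun s hs => ((differentiableAt_riemannZeta (hne s hs)).mul (hd s)).differentiableWithinAt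
  · intro n
    have hΛ : (0 : ℂ) ≤ (ArithmeticFunction.vonMangoldt n : ℂ) := by
      exact_mod_cast ArithmeticFunction.vonMangoldt_nonneg
    simp only [Pi.add_apply, Pi.mul_apply, Pi.zero_apply]
    rcases DirichletCharacter.apply_of_sq_eq_one h (n : ZMod q) with h | h | h <;> simp only [h]
    · simp
    · simpa using add_nonneg hΛ hΛ
    · simp
  · exact fun s hs => (e1 s hs).add (e2 s hs)
  · intro s hs
    rw [LSeries_add (e1 s hs) (e2 s hs),
      deriv_fun_mul (differentiableAt_riemannZeta (hne s hs)) (hd s), deriv_LFunction_eq_neg χ hs,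
      deriv_riemannZeta_eq_neg hs]
    ring
  · exact mul_nonneg (zero_le_one.trans riemannZeta_two_ge_one)
      (le_trans (by simp) (LFunction_two_of_sq_eq_one h))

lemma alternating_zeta_mul_three {q₁ q₂ q₃ : ℕ} [NeZero q₁] [NeZero q₂] [NeZero q₃]
    {χ₁ : DirichletCharacter ℂ q₁} {χ₂ : DirichletCharacter ℂ q₂} {χ₃ : DirichletCharacter ℂ q₃}
    (h1 : χ₁ ≠ 1) (h2 : χ₂ ≠ 1) (h3 : χ₃ ≠ 1) (hs1 : χ₁ ^ 2 = 1) (hs2 : χ₂ ^ 2 = 1)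
    (hs3 : χ₃ ^ 2 = 1) (hmul : ∀ n : ℕ, χ₃ n = χ₁ n * χ₂ n) (k : ℕ) :
    0 ≤ (-1) ^ k * iteratedDeriv k (fun s => riemannZeta s *
      (DirichletCharacter.LFunction χ₁ s * DirichletCharacter.LFunction χ₂ s *
        DirichletCharacter.LFunction χ₃ s)) 2 := by
  have hne : ∀ s : ℂ, 1 < s.re → s ≠ 1 := by rintro s hs rfl; simp at hs
  have hd1 := DirichletCharacter.differentiable_LFunction h1
  have hd2 := DirichletCharacter.differentiable_LFunction h2
  have hd3 := DirichletCharacter.differentiable_LFunction h3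
  have e0 : ∀ s : ℂ, 1 < s.re →
      LSeriesSummable (fun n => (ArithmeticFunction.vonMangoldt n : ℂ)) s := fun s hs =>
    ArithmeticFunction.LSeriesSummable_vonMangoldt hs
  have e1 : ∀ s : ℂ, 1 < s.re → LSeriesSummable
      ((fun n : ℕ => χ₁ n) * fun n : ℕ => (ArithmeticFunction.vonMangoldt n : ℂ)) s := fun s hs =>
    DirichletCharacter.LSeriesSummable_twist_vonMangoldt χ₁ hs
  have e2 : ∀ s : ℂ, 1 < s.re → LSeriesSummable
      ((fun n : ℕ => χ₂ n) * fun n : ℕ => (ArithmeticFunction.vonMangoldt n : ℂ)) s := fun s hs =>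
    DirichletCharacter.LSeriesSummable_twist_vonMangoldt χ₂ hs
  have e3 : ∀ s : ℂ, 1 < s.re → LSeriesSummable
      ((fun n : ℕ => χ₃ n) * fun n : ℕ => (ArithmeticFunction.vonMangoldt n : ℂ)) s := fun s hs =>
    DirichletCharacter.LSeriesSummable_twist_vonMangoldt χ₃ hs
  refine iteratedDeriv_alternating_of_logDeriv
    (a := (fun n => (ArithmeticFunction.vonMangoldt n : ℂ)) +
      (((fun n : ℕ => χ₁ n) * fun n : ℕ => (ArithmeticFunction.vonMangoldt n : ℂ)) +
      (((fun n : ℕ => χ₂ n) * fun n : ℕ => (ArithmeticFunction.vonMangoldt n : ℂ)) +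
      ((fun n : ℕ => χ₃ n) * fun n : ℕ => (ArithmeticFunction.vonMangoldt n : ℂ))))) ?_ ?_ ?_ ?_ ?_ k
  · exact fun s hs => ((differentiableAt_riemannZeta (hne s hs)).mul
      (((hd1 s).mul (hd2 s)).mul (hd3 s))).differentiableWithinAt
  · intro n
    have hΛ : (0 : ℂ) ≤ (ArithmeticFunction.vonMangoldt n : ℂ) := by
      exact_mod_cast ArithmeticFunction.vonMangoldt_nonneg
    simp only [Pi.add_apply, Pi.mul_apply, Pi.zero_apply, hmul]
    set Λ := (ArithmeticFunction.vonMangoldt n : ℂ)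
    have hfac : ∀ χ : ℂ, χ = 0 ∨ χ = 1 ∨ χ = -1 → 0 ≤ 1 + χ := by
      rintro χ (rfl | rfl | rfl) <;> norm_num
    have : Λ + (χ₁ n * Λ + (χ₂ n * Λ + χ₁ n * χ₂ n * Λ)) = (1 + χ₁ n) * (1 + χ₂ n) * Λ := by ring
    rw [this]
    exact mul_nonneg (mul_nonneg (hfac _ (DirichletCharacter.apply_of_sq_eq_one hs1 _))
      (hfac _ (DirichletCharacter.apply_of_sq_eq_one hs2 _))) hΛ
  · exact fun s hs => (e0 s hs).add ((e1 s hs).add ((e2 s hs).add (e3 s hs)))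
  · intro s hs
    rw [LSeries_add (e0 s hs) ((e1 s hs).add ((e2 s hs).add (e3 s hs))),
      LSeries_add (e1 s hs) ((e2 s hs).add (e3 s hs)), LSeries_add (e2 s hs) (e3 s hs)]
    refine ((differentiableAt_riemannZeta (hne s hs)).hasDerivAt.fun_mul
      (((hd1 s).hasDerivAt.fun_mul (hd2 s).hasDerivAt).fun_mul (hd3 s).hasDerivAt)).deriv.trans ?_
    rw [deriv_LFunction_eq_neg χ₁ hs, deriv_LFunction_eq_neg χ₂ hs, deriv_LFunction_eq_neg χ₃ hs,
      deriv_riemannZeta_eq_neg hs]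
    ring
  · have hp' : (0 : ℂ) ≤ ((1 / 3 : ℝ) : ℂ) := by simp
    exact mul_nonneg (zero_le_one.trans riemannZeta_two_ge_one)
      (mul_nonneg (mul_nonneg (hp'.trans (LFunction_two_of_sq_eq_one hs1))
        (hp'.trans (LFunction_two_of_sq_eq_one hs2))) (hp'.trans (LFunction_two_of_sq_eq_one hs3)))

lemma LFunction_ofReal_im {q : ℕ} [NeZero q] {χ : DirichletCharacter ℂ q} (h1 : χ ≠ 1)
    (h : χ ^ 2 = 1) (x : ℝ) : (DirichletCharacter.LFunction χ x).im = 0 := by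
  refine im_eq_zero_of_forall_gt (DirichletCharacter.differentiable_LFunction h1) ?_ x
  intro y hy
  rw [DirichletCharacter.LFunction_eq_LSeries χ (by simpa using hy)]
  have hs := (χ.LSeriesSummable_of_one_lt_re (s := y) (by simpa using hy)).LSeriesHasSum
  refine (hasSum_im hs).unique ?_
  convert! hasSum_zero using 2 with n
  rw [LSeries.term_def]
  split_ifs with hn
  · simp
  · have hc : (n : ℂ) ^ (y : ℂ) = (((n : ℝ) ^ y : ℝ) : ℂ) := by
      rw [Complex.ofReal_cpow (Nat.cast_nonneg n)]
      simp
    rw [hc, div_ofReal_im]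
    rcases DirichletCharacter.apply_of_sq_eq_one h (n : ZMod q) with h | h | h <;> simp [h]

lemma exists_riemannZeta_re_neg : ∃ δ : ℝ, 0 < δ ∧ ∀ σ : ℝ, 1 - δ < σ → σ < 1 →
    (riemannZeta σ).re < 0 := by
  have hc : Continuous fun s => (zetaMulSub s).re :=
    continuous_re.comp differentiable_zetaMulSub.continuous
  have h1 : ∀ᶠ s in 𝓝 (1 : ℂ), 0 < (zetaMulSub s).re :=
    hc.continuousAt.eventually (isOpen_Ioi.mem_nhds (by simp))
  obtain ⟨δ, hδ, h⟩ := Metric.eventually_nhds_iff.1 h1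
  refine ⟨δ, hδ, fun σ h2 h3 => ?_⟩
  have hne : (σ : ℂ) ≠ 1 := by exact_mod_cast h3.ne
  have h4 := @h σ (by
    rw [dist_eq_norm, ← ofReal_one, ← ofReal_sub, norm_real, Real.norm_eq_abs, abs_lt]
    constructor <;> linarith)
  rw [zetaMulSub_of_ne hne, ← ofReal_one, ← ofReal_sub, re_ofReal_mul] at h4
  nlinarith

lemma exists_norm_LFunction_le_closedBall : ∃ K : ℝ, 1 ≤ K ∧ ∀ (q : ℕ) [NeZero q]
    (χ : DirichletCharacter ℂ q), χ ≠ 1 → ∀ s ∈ Metric.closedBall (2 : ℂ) (3 / 2),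
      ‖DirichletCharacter.LFunction χ s‖ ≤ K * q := by
  obtain ⟨C, hC1, hC⟩ := norm_LFunction_le 1 one_pos le_rfl
  refine ⟨C * 4, by linarith, fun q _ χ hχ s hs => ?_⟩
  rw [mem_closedBall_iff_norm] at hs
  have h1 : |(s - 2).re| ≤ 3 / 2 := (abs_re_le_norm _).trans hs
  have h2 : |(s - 2).im| ≤ 3 / 2 := (abs_im_le_norm _).trans hs
  simp only [sub_re, sub_im, re_ofNat, im_ofNat, sub_zero] at h1 h2
  refine (hC q χ hχ s (by linarith [(abs_le.1 h1).1])).trans ?_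
  rw [Real.rpow_one, mul_assoc, mul_comm (4 : ℝ)]
  gcongr
  linarith

lemma LFunction_re_pos_of_forall_ne_zero {q : ℕ} [NeZero q] {χ : DirichletCharacter ℂ q}
    (h1 : χ ≠ 1) (h : χ ^ 2 = 1) {σ : ℝ} (hσ : σ < 1)
    (hne : ∀ β : ℝ, σ ≤ β → β < 1 → DirichletCharacter.LFunction χ β ≠ 0) :
    0 < (DirichletCharacter.LFunction χ σ).re := by
  by_contra! hcon
  have hcont : ContinuousOn (fun x : ℝ => (DirichletCharacter.LFunction χ x).re) (Icc σ 2) :=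
    (continuous_re.comp ((DirichletCharacter.differentiable_LFunction h1).continuous.comp
      continuous_ofReal)).continuousOn
  have h2 : 0 ≤ (DirichletCharacter.LFunction χ (2 : ℝ)).re := by
    have h3 := (Complex.le_def.1 (LFunction_two_of_sq_eq_one h)).1
    have h4 : ((1 / 3 : ℝ) : ℂ).re = 1 / 3 := ofReal_re _
    rw [h4] at h3
    push_cast
    linarith
  obtain ⟨β, hβ, h0⟩ := intermediate_value_Icc (by linarith) hcont
    (show (0 : ℝ) ∈ Icc _ _ from ⟨hcon, h2⟩)
  have hz : DirichletCharacter.LFunction χ β = 0 :=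
    Complex.ext h0 (LFunction_ofReal_im h1 h β)
  rcases lt_or_ge β 1 with hlt | hge
  · exact hne β hβ.1 hlt hz
  · exact DirichletCharacter.LFunction_ne_zero_of_one_le_re χ (Or.inl h1) (by simpa using hge) hz

lemma DirichletCharacter.changeLevel_mul_apply {q₁ q₂ : ℕ} [NeZero q₁] [NeZero q₂]
    (χ₁ : DirichletCharacter ℂ q₁) (χ₂ : DirichletCharacter ℂ q₂) (n : ℕ) :
    (changeLevel (Nat.dvd_mul_right q₁ q₂) χ₁ * changeLevel (Nat.dvd_mul_left q₂ q₁) χ₂) n =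
      χ₁ n * χ₂ n := by
  rw [MulChar.mul_apply]
  by_cases hn : IsUnit (n : ZMod (q₁ * q₂))
  · obtain ⟨u, hu⟩ := hn
    rw [← hu, changeLevel_eq_cast_of_dvd, changeLevel_eq_cast_of_dvd, hu,
      ZMod.cast_natCast (Nat.dvd_mul_right q₁ q₂), ZMod.cast_natCast (Nat.dvd_mul_left q₂ q₁)]
  · rw [MulChar.map_nonunit _ hn, zero_mul]
    rw [ZMod.isUnit_iff_coprime, Nat.coprime_mul_iff_right, not_and_or] at hn
    rcases hn with hn | hn
    · rw [χ₁.map_nonunit (by rwa [ZMod.isUnit_iff_coprime]), zero_mul]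
    · rw [χ₂.map_nonunit (by rwa [ZMod.isUnit_iff_coprime]), mul_zero]

lemma DirichletCharacter.eq_of_changeLevel_mul_eq_one {q₁ q₂ : ℕ} [NeZero q₁] [NeZero q₂]
    {χ₁ : DirichletCharacter ℂ q₁} {χ₂ : DirichletCharacter ℂ q₂} (hp1 : χ₁.IsPrimitive)
    (hp2 : χ₂.IsPrimitive) (hs1 : χ₁ ^ 2 = 1)
    (h : changeLevel (Nat.dvd_mul_right q₁ q₂) χ₁ * changeLevel (Nat.dvd_mul_left q₂ q₁) χ₂ = 1) :
    ‖LFunction χ₁ 1‖ = ‖LFunction χ₂ 1‖ := by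
  have hsq : changeLevel (Nat.dvd_mul_right q₁ q₂) χ₁ * changeLevel (Nat.dvd_mul_right q₁ q₂) χ₁
      = 1 := by
    rw [← map_mul, ← sq, hs1, map_one]
  have he : changeLevel (Nat.dvd_mul_right q₁ q₂) χ₁ = changeLevel (Nat.dvd_mul_left q₂ q₁) χ₂ :=
    mul_left_cancel (hsq.trans h.symm)
  have hc : χ₁.conductor = χ₂.conductor := by
    rw [← conductor_changeLevel χ₁ (Nat.dvd_mul_right q₁ q₂), he, conductor_changeLevel]
  have hq : q₁ = q₂ := by
    rw [← hp1, ← hp2, hc]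
  subst hq
  have := changeLevel_injective _ he
  rw [this]

lemma siegel_of_no_zero {δ : ℝ} (hδ : 0 < δ) (hδ1 : δ ≤ 1 / 10)
    (hζ : ∀ σ : ℝ, 1 - δ < σ → σ < 1 → (riemannZeta σ).re < 0)
    (hno : ∀ (q : ℕ) [NeZero q] (χ : DirichletCharacter ℂ q), χ.IsPrimitive → χ ^ 2 = 1 → χ ≠ 1 →
      ∀ β : ℝ, 1 - δ < β → β < 1 → DirichletCharacter.LFunction χ β ≠ 0) :
    ∃ c : ℝ, 0 < c ∧ ∀ (q : ℕ) [NeZero q] (χ : DirichletCharacter ℂ q), χ.IsPrimitive →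
      χ ^ 2 = 1 → χ ≠ 1 → c * (q : ℝ) ^ (-(2 * δ)) ≤ ‖DirichletCharacter.LFunction χ 1‖ := by
  obtain ⟨c, hc, hest⟩ := estermann_lower_bound
  obtain ⟨K, hK1, hK⟩ := exists_norm_LFunction_le_closedBall
  refine ⟨c * (δ / 2) * K ^ (-(2 * δ)), by positivity, fun q _ χ hp hs h1 => ?_⟩
  have hq : (1 : ℝ) ≤ q := by exact_mod_cast Nat.one_le_iff_ne_zero.2 (NeZero.ne q)
  have h := hest (DirichletCharacter.LFunction χ) (K * q)
    (DirichletCharacter.differentiable_LFunction h1) (by nlinarith) (hK q χ h1)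
    (alternating_zeta_mul_LFunction h1 hs) ?_ (1 - δ / 2) (by linarith) (by linarith) ?_
  · refine le_trans (le_of_eq ?_) h
    rw [Real.mul_rpow (by linarith) (by linarith), show -(4 * (1 - (1 - δ / 2))) = -(2 * δ) by ring]
    ring
  · have h2 := mul_le_mul riemannZeta_two_ge_one (LFunction_two_of_sq_eq_one hs) (by simp)
      (zero_le_one.trans riemannZeta_two_ge_one)
    have h3 := (Complex.le_def.1 h2).1
    rw [one_mul, ofReal_re] at h3
    linarith
  · have h2 := LFunction_re_pos_of_forall_ne_zero h1 hs (σ := 1 - δ / 2) (by linarith)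
      (fun β hβ hβ1 => hno q χ hp hs h1 β (by linarith) hβ1)
    have h3 := hζ (1 - δ / 2) (by linarith) (by linarith)
    rw [mul_re, LFunction_ofReal_im h1 hs, mul_zero, sub_zero]
    exact (mul_neg_of_neg_of_pos h3 h2).le

lemma siegel_of_zero {δ : ℝ} (hδ1 : δ ≤ 1 / 10) (hδ2 : 0 < δ) {q₁ : ℕ} [NeZero q₁]
    {χ₁ : DirichletCharacter ℂ q₁} (hp1 : χ₁.IsPrimitive) (hs1 : χ₁ ^ 2 = 1) (h1 : χ₁ ≠ 1)
    {β : ℝ} (hβ : 1 - δ < β) (hβ1 : β < 1) (hz : DirichletCharacter.LFunction χ₁ β = 0) :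
    ∃ c : ℝ, 0 < c ∧ ∀ (q : ℕ) [NeZero q] (χ : DirichletCharacter ℂ q), χ.IsPrimitive →
      χ ^ 2 = 1 → χ ≠ 1 → c * (q : ℝ) ^ (-(9 * δ)) ≤ ‖DirichletCharacter.LFunction χ 1‖ := by
  obtain ⟨c, hc, hest⟩ := estermann_lower_bound
  obtain ⟨K, hK1, hK⟩ := exists_norm_LFunction_le_closedBall
  obtain ⟨C, hC1, hC⟩ := norm_LFunction_le δ hδ2 (by linarith)
  have hq1 : (1 : ℝ) ≤ q₁ := by exact_mod_cast Nat.one_le_iff_ne_zero.2 (NeZero.ne q₁)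
  have hL1 : 0 < ‖DirichletCharacter.LFunction χ₁ 1‖ :=
    norm_pos_iff.2 (DirichletCharacter.LFunction_apply_one_ne_zero h1)
  set c₂ : ℝ := c * (1 - β) * (K ^ 3 * q₁ ^ 2) ^ (-(4 * δ)) / (K * q₁ * (C * (q₁ * 2) ^ δ)) with hc₂
  have hc2 : 0 < c₂ := by
    have : 0 < 1 - β := by linarith
    positivity
  refine ⟨min ‖DirichletCharacter.LFunction χ₁ 1‖ c₂, lt_min hL1 hc2, fun q _ χ hp hs hχ => ?_⟩
  have hq : (1 : ℝ) ≤ q := by exact_mod_cast Nat.one_le_iff_ne_zero.2 (NeZero.ne q)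
  set χ₃ : DirichletCharacter ℂ (q₁ * q) :=
    DirichletCharacter.changeLevel (Nat.dvd_mul_right q₁ q) χ₁ *
      DirichletCharacter.changeLevel (Nat.dvd_mul_left q q₁) χ with hχ₃
  by_cases h3 : χ₃ = 1
  · rw [← DirichletCharacter.eq_of_changeLevel_mul_eq_one hp1 hp hs1 h3]
    have h4 : (q : ℝ) ^ (-(9 * δ)) ≤ 1 := Real.rpow_le_one_of_one_le_of_nonpos hq (by linarith)
    calc _ ≤ ‖DirichletCharacter.LFunction χ₁ 1‖ * 1 := by
          gcongr
          exact min_le_left _ _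
      _ = _ := mul_one _
  have hs3 : χ₃ ^ 2 = 1 := by
    rw [hχ₃, mul_pow, ← map_pow, ← map_pow, hs1, hs, map_one, map_one, one_mul]
  have hd1 := DirichletCharacter.differentiable_LFunction h1
  have hd2 := DirichletCharacter.differentiable_LFunction hχ
  have hd3 := DirichletCharacter.differentiable_LFunction h3
  have hM1 : 1 ≤ K * q₁ * (K * q) * (K * (q₁ * q)) := by
    have e1 : 1 ≤ K * q₁ := one_le_mul_of_one_le_of_one_le hK1 hq1
    have e2 : 1 ≤ K * q := one_le_mul_of_one_le_of_one_le hK1 hq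
    have e3 : 1 ≤ K * (q₁ * q) :=
      one_le_mul_of_one_le_of_one_le hK1 (one_le_mul_of_one_le_of_one_le hq1 hq)
    exact one_le_mul_of_one_le_of_one_le (one_le_mul_of_one_le_of_one_le e1 e2) e3
  have h := hest (fun s => DirichletCharacter.LFunction χ₁ s * DirichletCharacter.LFunction χ s *
      DirichletCharacter.LFunction χ₃ s) (K * q₁ * (K * q) * (K * (q₁ * q)))
    ((hd1.fun_mul hd2).fun_mul hd3) hM1 ?_
    (alternating_zeta_mul_three h1 hχ h3 hs1 hs hs3
      (DirichletCharacter.changeLevel_mul_apply χ₁ χ)) ?_ β (by linarith) hβ1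
      (by simp [hz])
  · have b1 : ‖DirichletCharacter.LFunction χ₁ 1‖ ≤ K * q₁ := hK q₁ χ₁ h1 1 (by
      rw [mem_closedBall_iff_norm]; norm_num)
    have b3 : ‖DirichletCharacter.LFunction χ₃ 1‖ ≤ C * (q₁ * 2) ^ δ * (q : ℝ) ^ δ := by
      refine (hC _ χ₃ h3 1 (by simp; linarith)).trans (le_of_eq ?_)
      rw [mul_assoc, ← Real.mul_rpow (by positivity) (by positivity)]
      push_cast
      simp
      left
      congr 1
      ring
    have hlow : c * (1 - β) * (K ^ 3 * q₁ ^ 2) ^ (-(4 * δ)) * (q : ℝ) ^ (-(8 * δ)) ≤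
        c * (1 - β) * (K * q₁ * (K * q) * (K * (q₁ * q))) ^ (-(4 * (1 - β))) := by
      have e1 : K * q₁ * (K * q) * (K * (q₁ * q)) = (K ^ 3 * q₁ ^ 2) * (q : ℝ) ^ (2 : ℝ) := by
        rw [Real.rpow_two]; ring
      have e2 : (K * q₁ * (K * q) * (K * (q₁ * q))) ^ (-(4 * δ)) =
          (K ^ 3 * q₁ ^ 2) ^ (-(4 * δ)) * (q : ℝ) ^ (-(8 * δ)) := by
        rw [e1, Real.mul_rpow (by positivity) (by positivity), ← Real.rpow_mul (by positivity)]
        congr 2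
        ring
      rw [mul_assoc, ← e2]
      have : 0 < 1 - β := by linarith
      gcongr ?_ * ?_
      exact Real.rpow_le_rpow_of_exponent_le hM1 (by linarith)
    have hup : ‖DirichletCharacter.LFunction χ₁ 1 * DirichletCharacter.LFunction χ 1 *
        DirichletCharacter.LFunction χ₃ 1‖ ≤ K * q₁ * ‖DirichletCharacter.LFunction χ 1‖ *
          (C * (q₁ * 2) ^ δ * (q : ℝ) ^ δ) := by
      rw [norm_mul, norm_mul]
      gcongr
    have hall := hlow.trans (h.trans hup)
    have e3 : (q : ℝ) ^ (-(9 * δ)) * (q : ℝ) ^ δ = (q : ℝ) ^ (-(8 * δ)) := by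
      rw [← Real.rpow_add (by linarith)]
      congr 1
      ring
    have hqδ : 0 < (q : ℝ) ^ δ := by positivity
    calc _ ≤ c₂ * (q : ℝ) ^ (-(9 * δ)) := by
          gcongr
          exact min_le_right _ _
      _ ≤ _ := by
          rw [hc₂, div_mul_eq_mul_div, div_le_iff₀ (by positivity)]
          rw [← mul_le_mul_iff_of_pos_right hqδ]
          calc _ = c * (1 - β) * (K ^ 3 * q₁ ^ 2) ^ (-(4 * δ)) *
                ((q : ℝ) ^ (-(9 * δ)) * (q : ℝ) ^ δ) := by ring
            _ ≤ _ := by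
              rw [e3]
              refine hall.trans (le_of_eq ?_)
              ring
  · intro s hs
    have b1 := hK q₁ χ₁ h1 s hs
    have b2 := hK q χ hχ s hs
    have b3 := hK (q₁ * q) χ₃ h3 s hs
    push_cast at b3
    rw [norm_mul, norm_mul]
    gcongr
  · have g {r : ℕ} [NeZero r] {ψ : DirichletCharacter ℂ r} (h : ψ ^ 2 = 1) :=
      LFunction_two_of_sq_eq_one h
    have hp' : (0 : ℂ) ≤ ((1 / 3 : ℝ) : ℂ) := by simp
    have h2 := mul_le_mul riemannZeta_two_ge_one
      (mul_le_mul (mul_le_mul (g hs1) (g hs) hp' (hp'.trans (g hs1))) (g hs3) hp'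
        (mul_nonneg (hp'.trans (g hs1)) (hp'.trans (g hs)))) (by positivity)
      (zero_le_one.trans riemannZeta_two_ge_one)
    have h3 := (Complex.le_def.1 h2).1
    rw [one_mul, ← ofReal_mul, ← ofReal_mul, ofReal_re] at h3
    norm_num at h3 ⊢
    linarith

/-- **Siegel's theorem.** -/
theorem siegel (ε : ℝ) (hε : 0 < ε) :
    ∃ c : ℝ, 0 < c ∧ ∀ (q : ℕ) [NeZero q] (χ : DirichletCharacter ℂ q), χ.IsPrimitive →
      χ ^ 2 = 1 → χ ≠ 1 → c * (q : ℝ) ^ (-ε) ≤ ‖DirichletCharacter.LFunction χ 1‖ := by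
  obtain ⟨δ₀, hδ₀, hζ⟩ := exists_riemannZeta_re_neg
  set δ : ℝ := min (min δ₀ (1 / 10)) (ε / 9) with hδdef
  have hδ : 0 < δ := by positivity
  have hδ0 : δ ≤ δ₀ := (min_le_left _ _).trans (min_le_left _ _)
  have hδ1 : δ ≤ 1 / 10 := (min_le_left _ _).trans (min_le_right _ _)
  have hδε : δ ≤ ε / 9 := min_le_right _ _
  have key : ∃ c : ℝ, 0 < c ∧ ∀ (q : ℕ) [NeZero q] (χ : DirichletCharacter ℂ q), χ.IsPrimitive →
      χ ^ 2 = 1 → χ ≠ 1 → c * (q : ℝ) ^ (-(9 * δ)) ≤ ‖DirichletCharacter.LFunction χ 1‖ := by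
    by_cases hno : ∀ (q : ℕ) [NeZero q] (χ : DirichletCharacter ℂ q), χ.IsPrimitive → χ ^ 2 = 1 →
        χ ≠ 1 → ∀ β : ℝ, 1 - δ < β → β < 1 → DirichletCharacter.LFunction χ β ≠ 0
    · obtain ⟨c, hc, h⟩ := siegel_of_no_zero hδ hδ1
        (fun σ h1 h2 => hζ σ (by linarith) h2) hno
      refine ⟨c, hc, fun q _ χ hp hs h1 => le_trans ?_ (h q χ hp hs h1)⟩
      have hq : (1 : ℝ) ≤ q := by exact_mod_cast Nat.one_le_iff_ne_zero.2 (NeZero.ne q)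
      gcongr
      linarith
    · push Not at hno
      obtain ⟨q₁, _, χ₁, hp1, hs1, h1, β, hβ, hβ1, hz⟩ := hno
      exact siegel_of_zero hδ1 hδ hp1 hs1 h1 hβ hβ1 hz
  obtain ⟨c, hc, h⟩ := key
  refine ⟨c, hc, fun q _ χ hp hs h1 => le_trans ?_ (h q χ hp hs h1)⟩
  have hq : (1 : ℝ) ≤ q := by exact_mod_cast Nat.one_le_iff_ne_zero.2 (NeZero.ne q)
  gcongr
  linarith

end

lemma two_mul_rpow_le {T e : ℝ} (hT : 1 ≤ T) (he1 : e ≤ 1) :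
    (2 * T) ^ e ≤ 2 * T ^ e := by
  rw [Real.mul_rpow (by norm_num) (by linarith)]
  gcongr
  calc (2 : ℝ) ^ e ≤ 2 ^ (1 : ℝ) := Real.rpow_le_rpow_of_exponent_le (by norm_num) he1
    _ = 2 := Real.rpow_one 2

lemma one_le_natCast_of_neZero (q : ℕ) [NeZero q] : (1 : ℝ) ≤ q := by
  exact_mod_cast Nat.one_le_iff_ne_zero.2 (NeZero.ne q)

lemma lower_LFunction_of_sq_ne_one (e : ℝ) (he : 0 < e) (he1 : e ≤ 1) :
    ∃ c : ℝ, 0 < c ∧ ∀ (q : ℕ) [NeZero q] (χ : DirichletCharacter ℂ q), χ ≠ 1 → χ ^ 2 ≠ 1 →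
      ∀ x t : ℝ, 0 < x → x ≤ 1 → c / ((q * (|t| + 2)) ^ e) ^ 8 ≤
        ‖DirichletCharacter.LFunction χ (1 + x + I * t)‖ := by
  obtain ⟨C₁, hC₁, h₁⟩ := exists_three_four_one
  obtain ⟨C₂, hC₂, h₂⟩ := norm_LFunction_le e he he1
  obtain ⟨C₃, hC₃, h₃⟩ := norm_deriv_LFunction_le e he he1
  refine ⟨1 / (16 * (C₁ * (C₂ * 2)) * C₃ ^ 3), by positivity, fun q _ χ hχ hχ2 x t hx hx1 => ?_⟩
  have hq := one_le_natCast_of_neZero q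
  have ht : 0 ≤ |t| := abs_nonneg t
  set T : ℝ := q * (|t| + 2) with hT
  have hT1 : 1 ≤ T := one_le_mul_of_one_le_of_one_le hq (by linarith)
  set P : ℝ := T ^ e with hP
  have hP1 : 1 ≤ P := Real.one_le_rpow hT1 he.le
  have hD : 1 ≤ C₁ * (C₂ * (2 * P)) := by
    refine one_le_mul_of_one_le_of_one_le hC₁ (one_le_mul_of_one_le_of_one_le hC₂ (by linarith))
  have hM : 1 ≤ C₃ * P := one_le_mul_of_one_le_of_one_le hC₃ hP1
  have key := one_le_of_three_four_one (f := DirichletCharacter.LFunction χ) (t := t) hD hM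
    (fun y hy hy1 => ?_) (fun w hw1 hw2 hwt => ?_) hx hx1
  · refine le_trans ?_ key
    rw [div_div]
    refine one_div_le_one_div_of_le (by positivity) ?_
    calc 16 * (C₁ * (C₂ * (2 * P))) * (C₃ * P) ^ 3 = 16 * (C₁ * (C₂ * 2)) * C₃ ^ 3 * P ^ 4 := by ring
      _ ≤ _ := by
        gcongr
        norm_num
  · refine (h₁ q χ y t hy hy1).1.trans ?_
    gcongr
    refine (h₂ q (χ ^ 2) hχ2 _ (by simp; linarith)).trans ?_
    gcongr
    refine le_trans ?_ (two_mul_rpow_le hT1 he1)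
    refine Real.rpow_le_rpow (by positivity) ?_ he.le
    simp
    rw [hT]
    nlinarith
  · refine ⟨(DirichletCharacter.differentiable_LFunction hχ) w, ?_⟩
    have := h₃ q χ hχ w (by linarith)
    rwa [hwt] at this

lemma norm_riemannZeta_le (e : ℝ) (he : 0 < e) (he1 : e ≤ 1) :
    ∃ C : ℝ, 1 ≤ C ∧ ∀ (s : ℂ), 1 ≤ s.re → s ≠ 1 →
      ‖riemannZeta s‖ ≤ C * (|s.im| + 2) ^ e + 1 / ‖s - 1‖ := by
  obtain ⟨C, hC, h⟩ := norm_zetaReg_le e he he1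
  refine ⟨C, hC, fun s hs hs1 => ?_⟩
  have h1 := h s (by linarith)
  have h2 : riemannZeta s = zetaReg s + 1 / (s - 1) := by rw [zetaReg_of_ne hs1]; ring
  rw [h2]
  refine (norm_add_le _ _).trans (add_le_add h1 ?_)
  simp

lemma lower_LFunction_of_sq_eq_one (e : ℝ) (he : 0 < e) (he1 : e ≤ 1) :
    ∃ c : ℝ, 0 < c ∧ ∀ (q : ℕ) [NeZero q] (χ : DirichletCharacter ℂ q), χ.IsPrimitive → χ ≠ 1 →
      χ ^ 2 = 1 → ∀ x t : ℝ, 0 < x → x ≤ 1 → c / ((q * (|t| + 2)) ^ e) ^ 8 ≤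
        ‖DirichletCharacter.LFunction χ (1 + x + I * t)‖ := by
  obtain ⟨C₁, hC₁, h₁⟩ := exists_three_four_one
  obtain ⟨C₂, hC₂, h₂⟩ := norm_riemannZeta_le e he he1
  obtain ⟨C₃, hC₃, h₃⟩ := norm_deriv_LFunction_le e he he1
  obtain ⟨c₀, hc₀, hsieg₀⟩ := siegel e he
  obtain ⟨c, hc, hc1, hsieg⟩ : ∃ c : ℝ, 0 < c ∧ c ≤ 1 ∧ ∀ (q : ℕ) [NeZero q]
      (χ : DirichletCharacter ℂ q), χ.IsPrimitive → χ ^ 2 = 1 → χ ≠ 1 →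
      c * (q : ℝ) ^ (-e) ≤ ‖DirichletCharacter.LFunction χ 1‖ :=
    ⟨min c₀ 1, by positivity, min_le_right _ _, fun q _ χ hp hs h1 =>
      le_trans (by gcongr; exact min_le_left _ _) (hsieg₀ q χ hp hs h1)⟩
  set K : ℝ := C₁ * (2 * C₂ + 4 * C₃ / c) with hK
  have hK1 : 1 ≤ K := one_le_mul_of_one_le_of_one_le hC₁ (by
    have : 0 ≤ 4 * C₃ / c := by positivity
    linarith)
  set k : ℝ := min (c / 2) (min (1 / (16 * K * C₃ ^ 3)) (min 1 ((c / (4 * C₃)) ^ 3 / K))) with hk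
  have hk1 : k ≤ c / 2 := min_le_left _ _
  have hk2 : k ≤ 1 / (16 * K * C₃ ^ 3) := (min_le_right _ _).trans (min_le_left _ _)
  have hk3 : k ≤ 1 := (min_le_right _ _).trans ((min_le_right _ _).trans (min_le_left _ _))
  have hk4 : k ≤ (c / (4 * C₃)) ^ 3 / K :=
    (min_le_right _ _).trans ((min_le_right _ _).trans (min_le_right _ _))
  have hk0 : 0 < k := by positivity
  refine ⟨k, hk0, fun q _ χ hprim hχ hχ2 x t hx hx1 => ?_⟩
  have hq := one_le_natCast_of_neZero q
  have ht : 0 ≤ |t| := abs_nonneg t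
  set T : ℝ := q * (|t| + 2) with hT
  have hT1 : 1 ≤ T := one_le_mul_of_one_le_of_one_le hq (by linarith)
  set P : ℝ := T ^ e with hP
  have hP1 : 1 ≤ P := Real.one_le_rpow hT1 he.le
  have hP0 : 0 < P := by linarith
  have hM : 1 ≤ C₃ * P := one_le_mul_of_one_le_of_one_le hC₃ hP1
  have hqT : (q : ℝ) ≤ T := by rw [hT]; nlinarith
  have hL1 : c / P ≤ ‖DirichletCharacter.LFunction χ 1‖ := by
    refine le_trans ?_ (hsieg q χ hprim hχ2 hχ)
    rw [div_eq_mul_inv, hP, ← Real.rpow_neg (by linarith)]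
    gcongr ?_ * ?_
    exact Real.rpow_le_rpow_of_nonpos (by linarith) hqT (by linarith)
  set δ : ℝ := c / P / (2 * (C₃ * P)) with hδ
  have hδ0 : 0 < δ := by positivity
  have hder : ∀ w : ℂ, 1 ≤ w.re → |w.im| ≤ |t| →
      ‖deriv (DirichletCharacter.LFunction χ) w‖ ≤ C₃ * P := fun w hw hwt =>
    (h₃ q χ hχ w (by linarith)).trans (by rw [hP, hT]; gcongr)
  have hζ : ∀ y : ℝ, 0 < y → (δ / 2 ≤ y ∨ δ / 2 ≤ |t|) →
      C₁ * ‖riemannZeta (1 + y + 2 * I * t)‖ ≤ K * P ^ 2 := by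
    intro y hy hyt
    have hn : δ / 2 ≤ ‖(1 + y + 2 * I * t : ℂ) - 1‖ := by
      rcases hyt with h | h
      · refine h.trans (le_trans (le_abs_self y) ?_)
        simpa using abs_re_le_norm ((1 + y + 2 * I * t : ℂ) - 1)
      · refine h.trans (le_trans ?_ (abs_im_le_norm _))
        simp [abs_mul]
        linarith
    have h := h₂ (1 + y + 2 * I * t) (by simp; linarith) (by
      intro h
      rw [h] at hn
      simp at hn
      linarith)
    refine (mul_le_mul_of_nonneg_left (h.trans ?_) (by linarith : (0 : ℝ) ≤ C₁)).trans
      (le_of_eq (show C₁ * ((2 * C₂ + 4 * C₃ / c) * P ^ 2) = K * P ^ 2 by rw [hK]; ring))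
    have b1 : (|(1 + y + 2 * I * t : ℂ).im| + 2) ^ e ≤ 2 * P := by
      refine le_trans ?_ (two_mul_rpow_le hT1 he1)
      gcongr
      simp [abs_mul]
      rw [hT]
      nlinarith
    have b2 : 1 / ‖(1 + y + 2 * I * t : ℂ) - 1‖ ≤ 4 * C₃ / c * P ^ 2 := by
      refine (one_div_le_one_div_of_le (by positivity) hn).trans (le_of_eq ?_)
      rw [hδ]
      field_simp
      norm_num
    calc _ ≤ C₂ * (2 * P) + 4 * C₃ / c * P ^ 2 := by gcongr
      _ ≤ C₂ * (2 * P ^ 2) + 4 * C₃ / c * P ^ 2 := by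
        gcongr
        nlinarith
      _ = _ := by ring
  by_cases hcase : ‖((x : ℂ) + I * t)‖ ≤ δ
  · have hmv : ‖DirichletCharacter.LFunction χ (1 + x + I * t) -
        DirichletCharacter.LFunction χ 1‖ ≤ C₃ * P * ‖(1 + x + I * t : ℂ) - 1‖ := by
      refine Convex.norm_image_sub_le_of_norm_deriv_le (s := {w : ℂ | 1 ≤ w.re} ∩
        {w : ℂ | |w.im| ≤ |t|}) (fun w _ => (DirichletCharacter.differentiable_LFunction hχ) w)
        (fun w hw => hder w hw.1 hw.2) ((convex_halfSpace_re_ge 1).inter ?_) ?_ ?_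
      · have : {w : ℂ | |w.im| ≤ |t|} = {w : ℂ | -|t| ≤ w.im} ∩ {w : ℂ | w.im ≤ |t|} := by
          ext w
          simp [abs_le]
        rw [this]
        exact (convex_halfSpace_im_ge _).inter (convex_halfSpace_im_le _)
      · simp
      · simp [hx.le]
    have e1 : (1 + x + I * t : ℂ) - 1 = x + I * t := by ring
    rw [e1] at hmv
    have h5 : C₃ * P * ‖((x : ℂ) + I * t)‖ ≤ c / P / 2 := by
      calc _ ≤ C₃ * P * δ := by gcongr
        _ = _ := by rw [hδ]; field_simp
    have h6 := norm_sub_norm_le (DirichletCharacter.LFunction χ 1)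
      (DirichletCharacter.LFunction χ (1 + x + I * t))
    rw [norm_sub_rev] at h6
    calc k / P ^ 8 ≤ c / 2 / P := by
          gcongr
          exact le_self_pow₀ hP1 (by norm_num)
      _ = c / P / 2 := by ring
      _ ≤ _ := by linarith
  push Not at hcase
  have hD : 1 ≤ K * P ^ 2 := one_le_mul_of_one_le_of_one_le hK1 (one_le_pow₀ hP1)
  by_cases htδ : δ / 2 ≤ |t|
  · have key := one_le_of_three_four_one (f := DirichletCharacter.LFunction χ) (t := t) hD hM
      (fun y hy hy1 => ?_) (fun w hw1 hw2 hwt => ?_) hx hx1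
    · refine le_trans ?_ key
      calc k / P ^ 8 ≤ 1 / (16 * K * C₃ ^ 3) / P ^ 5 := by
            gcongr
            norm_num
        _ = _ := by
          rw [div_div]
          ring
    · refine ((h₁ q χ y t hy hy1).2 hχ2).trans ?_
      exact mul_le_mul_of_nonneg_right (hζ y hy (Or.inr htδ)) (by positivity)
    · exact ⟨(DirichletCharacter.differentiable_LFunction hχ) w, hder w hw1 (by rw [hwt])⟩
  · push Not at htδ
    have hxδ : δ / 2 ≤ x := by
      have h7 : ‖((x : ℂ) + I * t)‖ ≤ x + |t| := by
        refine (norm_add_le _ _).trans (le_of_eq ?_)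
        simp [abs_of_pos hx]
      linarith
    have h8 := ((h₁ q χ x t hx hx1).2 hχ2).trans
      (mul_le_mul_of_nonneg_right (hζ x hx (Or.inl hxδ)) (by positivity))
    set y : ℝ := ‖DirichletCharacter.LFunction χ (1 + x + I * t)‖ with hy
    rcases le_or_gt 1 y with h9 | h9
    · refine le_trans ?_ h9
      exact (div_le_self hk0.le (one_le_pow₀ hP1)).trans hk3
    · have hy4 : y ^ 4 ≤ y := pow_le_of_le_one (norm_nonneg _) h9.le (by norm_num)
      have h10 : (δ / 2) ^ 3 ≤ K * P ^ 2 * y := by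
        calc _ ≤ x ^ 3 := by gcongr
          _ ≤ _ := h8
          _ ≤ _ := by gcongr
      calc k / P ^ 8 ≤ ((c / (4 * C₃)) ^ 3 / K) / P ^ 8 := by gcongr
        _ = (δ / 2) ^ 3 / (K * P ^ 2) := by
          rw [hδ]
          field_simp
          norm_num
        _ ≤ y := by
          rw [div_le_iff₀ (by positivity)]
          linarith

theorem lower_LFunction (ε : ℝ) (hε : 0 < ε) (hε1 : ε ≤ 1) :
    ∃ c : ℝ, 0 < c ∧ ∀ (q : ℕ) [NeZero q] (χ : DirichletCharacter ℂ q), χ.IsPrimitive → χ ≠ 1 →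
      ∀ x t : ℝ, 0 < x → x ≤ 1 → c / (q * (|t| + 2)) ^ ε ≤
        ‖DirichletCharacter.LFunction χ (1 + x + I * t)‖ := by
  obtain ⟨c₁, hc₁, h₁⟩ := lower_LFunction_of_sq_ne_one (ε / 8) (by linarith) (by linarith)
  obtain ⟨c₂, hc₂, h₂⟩ := lower_LFunction_of_sq_eq_one (ε / 8) (by linarith) (by linarith)
  refine ⟨min c₁ c₂, by positivity, fun q _ χ hp hχ x t hx hx1 => ?_⟩
  have he : (q * (|t| + 2)) ^ ε = ((q * (|t| + 2)) ^ (ε / 8)) ^ 8 := by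
    rw [← Real.rpow_mul_natCast (by positivity)]
    congr 1
    push_cast
    ring
  rw [he]
  by_cases h : χ ^ 2 = 1
  · refine le_trans ?_ (h₂ q χ hp hχ h x t hx hx1)
    gcongr
    exact min_le_right _ _
  · refine le_trans ?_ (h₁ q χ hχ h x t hx hx1)
    gcongr
    exact min_le_left _ _

lemma lower_riemannZeta (e : ℝ) (he : 0 < e) (he1 : e ≤ 1) :
    ∃ c : ℝ, 0 < c ∧ ∀ x t : ℝ, 0 < x → x ≤ 1 → 1 ≤ |t| → c / ((|t| + 2) ^ e) ^ 4 ≤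
        ‖riemannZeta (1 + x + I * t)‖ := by
  obtain ⟨C₁, hC₁, h₁⟩ := exists_three_four_one
  obtain ⟨C₂, hC₂, h₂⟩ := norm_riemannZeta_le e he he1
  obtain ⟨C₃, hC₃, h₃⟩ := norm_deriv_zetaReg_le e he he1
  refine ⟨1 / (16 * (C₁ * (C₂ * 3)) * (C₃ * 2) ^ 3), by positivity, fun x t hx hx1 ht => ?_⟩
  have ht0 : t ≠ 0 := by
    rintro rfl
    simp at ht
    linarith
  set T : ℝ := |t| + 2 with hT
  have hT1 : 1 ≤ T := by linarith
  set P : ℝ := T ^ e with hP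
  have hP1 : 1 ≤ P := Real.one_le_rpow hT1 he.le
  have hD : 1 ≤ C₁ * (C₂ * (3 * P)) := by
    refine one_le_mul_of_one_le_of_one_le hC₁ (one_le_mul_of_one_le_of_one_le hC₂ (by linarith))
  have hM : 1 ≤ C₃ * (2 * P) := one_le_mul_of_one_le_of_one_le hC₃ (by linarith)
  have key := one_le_of_three_four_one (f := riemannZeta) (t := t) hD hM
    (fun y hy hy1 => ?_) (fun w hw1 hw2 hwt => ?_) hx hx1
  · refine le_trans (le_of_eq ?_) key
    rw [div_div]
    ring
  · have h5 := (h₁ 1 1 y t hy hy1).2 (by simp)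
    rw [DirichletCharacter.LFunction_modOne_eq] at h5
    refine h5.trans ?_
    have hn : 1 ≤ ‖(1 + y + 2 * I * t : ℂ) - 1‖ := by
      refine le_trans ?_ (abs_im_le_norm _)
      simp [abs_mul]
      linarith
    gcongr
    refine (h₂ _ (by simp; linarith) (fun h => ?_)).trans ?_
    · rw [h] at hn
      simp at hn
      linarith
    · have b1 : (|(1 + y + 2 * I * t : ℂ).im| + 2) ^ e ≤ 2 * P := by
        refine le_trans ?_ (two_mul_rpow_le hT1 he1)
        refine Real.rpow_le_rpow (by positivity) ?_ he.le
        simp [abs_mul]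
        linarith
      have b2 : 1 / ‖(1 + y + 2 * I * t : ℂ) - 1‖ ≤ 1 := by
        rw [div_le_one (by linarith)]
        exact hn
      calc _ ≤ C₂ * (2 * P) + 1 := by gcongr
        _ ≤ _ := by nlinarith
  · have hw : w ≠ 1 := by
      rintro rfl
      simp at hwt
      exact ht0 hwt.symm
    have hw' : w - 1 ≠ 0 := sub_ne_zero.2 hw
    have heq : riemannZeta =ᶠ[𝓝 w] fun s => zetaReg s + (s - 1)⁻¹ := by
      filter_upwards [isOpen_ne.mem_nhds hw] with s hs
      rw [zetaReg_of_ne hs]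
      simp
    have hd : HasDerivAt riemannZeta (deriv zetaReg w + -1 / (w - 1) ^ 2) w := by
      refine HasDerivAt.congr_of_eventuallyEq ?_ heq
      exact (differentiable_zetaReg w).hasDerivAt.add
        (((hasDerivAt_id w).sub_const 1).fun_inv hw')
    refine ⟨hd.differentiableAt, ?_⟩
    rw [hd.deriv]
    refine (norm_add_le _ _).trans ?_
    have b1 := h₃ w (by linarith)
    rw [hwt] at b1
    have b2 : ‖-1 / (w - 1) ^ 2‖ ≤ 1 := by
      rw [norm_div, norm_neg, norm_one, norm_pow]
      have : 1 ≤ ‖w - 1‖ := by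
        refine le_trans ?_ (abs_im_le_norm _)
        simp [hwt, ht]
      exact div_le_one_of_le₀ (one_le_pow₀ this) (by positivity)
    calc _ ≤ C₃ * P + 1 := by gcongr
      _ ≤ _ := by nlinarith

lemma lower_zetaMulSub (ε : ℝ) (hε : 0 < ε) (hε1 : ε ≤ 1) :
    ∃ c : ℝ, 0 < c ∧ ∀ x t : ℝ, 0 < x → x ≤ 1 →
      c * (|t| + 2) / (|t| + 2) ^ ε ≤ ‖zetaMulSub (1 + x + I * t)‖ := by
  obtain ⟨c₁, hc₁, h₁⟩ := lower_riemannZeta (ε / 4) (by linarith) (by linarith)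
  obtain ⟨z, hz, hmin⟩ := ((isCompact_Icc (a := (0 : ℝ)) (b := 1)).prod
    (isCompact_Icc (a := (-1 : ℝ)) (b := 1))).exists_isMinOn (f := fun p : ℝ × ℝ =>
      ‖zetaMulSub (1 + p.1 + I * p.2)‖) ⟨(0, 0), by simp⟩
      (differentiable_zetaMulSub.continuous.norm.comp (by fun_prop)).continuousOn
  have hpos : 0 < ‖zetaMulSub (1 + z.1 + I * z.2)‖ := by
    rw [norm_pos_iff]
    by_cases h : (1 + z.1 + I * z.2 : ℂ) = 1
    · rw [h, zetaMulSub_one]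
      exact one_ne_zero
    · rw [zetaMulSub_of_ne h]
      refine mul_ne_zero (sub_ne_zero.2 h) (riemannZeta_ne_zero_of_one_le_re ?_)
      simpa using hz.1.1
  refine ⟨min (c₁ / 3) (‖zetaMulSub (1 + z.1 + I * z.2)‖ / 3), by positivity,
    fun x t hx hx1 => ?_⟩
  have ht : 0 ≤ |t| := abs_nonneg t
  rcases le_or_gt 1 |t| with h1 | h1
  · have he : (|t| + 2) ^ ε = ((|t| + 2) ^ (ε / 4)) ^ 4 := by
      rw [← Real.rpow_mul_natCast (by positivity)]
      congr 1
      push_cast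
      ring
    have hne : (1 + x + I * t : ℂ) ≠ 1 := by
      intro h
      have := congrArg re h
      simp at this
      linarith
    rw [zetaMulSub_of_ne hne, norm_mul, he]
    have h5 : (|t| + 2) / 3 ≤ ‖(1 + x + I * t : ℂ) - 1‖ := by
      refine le_trans ?_ (abs_im_le_norm _)
      simp
      linarith
    calc _ ≤ c₁ / 3 * (|t| + 2) / ((|t| + 2) ^ (ε / 4)) ^ 4 := by
          gcongr
          exact min_le_left _ _
      _ = (|t| + 2) / 3 * (c₁ / ((|t| + 2) ^ (ε / 4)) ^ 4) := by ring
      _ ≤ _ := by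
        gcongr
        exact h₁ x t hx hx1 h1
  · have h2 := hmin (show (x, t) ∈ Icc (0 : ℝ) 1 ×ˢ Icc (-1 : ℝ) 1 from
      ⟨⟨hx.le, hx1⟩, abs_le.1 h1.le⟩)
    refine le_trans ?_ h2
    have h3 : 1 ≤ (|t| + 2) ^ ε := Real.one_le_rpow (by linarith) hε.le
    calc _ ≤ ‖zetaMulSub (1 + z.1 + I * z.2)‖ / 3 * 3 / 1 := by
          gcongr
          · exact min_le_right _ _
          · linarith
      _ = _ := by ring

lemma norm_iteratedDeriv_logDeriv_le {f : ℂ → ℂ} (hf : Differentiable ℂ f) {s : ℂ} {R U l : ℝ}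
    (hR : 0 < R) (hl : 0 < l) (hU : ∀ w ∈ Metric.closedBall s R, ‖f w‖ ≤ U) (hfs : l ≤ ‖f s‖)
    (k : ℕ) : ‖iteratedDeriv k (fun w => deriv f w / f w) s‖ ≤
      k.factorial * (8 * U / (R * l)) ^ (k + 1) := by
  have hUl : l ≤ U := hfs.trans (hU s (Metric.mem_closedBall_self hR.le))
  have hU0 : 0 < U := hl.trans_le hUl
  set ρ : ℝ := R * l / (8 * U) with hρ
  have hρ0 : 0 < ρ := by positivity
  have hρR : ρ ≤ R / 2 := by
    rw [hρ, div_le_div_iff₀ (by positivity) (by positivity)]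
    nlinarith
  have hder : ∀ w ∈ Metric.closedBall s ρ, ‖deriv f w‖ ≤ U / (R / 2) := fun w hw =>
    norm_deriv_le_of_forall_re hf (by positivity) fun v hv => hU v (by
      rw [Metric.mem_closedBall] at *
      have := dist_triangle v w s
      linarith)
  have hlow : ∀ w ∈ Metric.closedBall s ρ, l / 2 ≤ ‖f w‖ := by
    intro w hw
    have h1 := (convex_closedBall s ρ).norm_image_sub_le_of_norm_deriv_le
      (fun w _ => hf w) hder (Metric.mem_closedBall_self hρ0.le) hw
    have h2 := norm_sub_norm_le (f s) (f w)
    rw [norm_sub_rev] at h2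
    have h3 : U / (R / 2) * ‖w - s‖ ≤ l / 4 := by
      calc _ ≤ U / (R / 2) * ρ := by
            gcongr
            rwa [mem_closedBall_iff_norm] at hw
        _ = l / 4 := by rw [hρ]; field_simp; norm_num
    linarith
  have hdiff : DiffContOnCl ℂ (fun w => deriv f w / f w) (Metric.ball s ρ) := by
    refine DifferentiableOn.diffContOnCl fun w hw => ?_
    have hw' := Metric.closure_ball_subset_closedBall hw
    have hne : f w ≠ 0 := norm_pos_iff.1 (lt_of_lt_of_le (by positivity) (hlow w hw'))
    exact (((hf.deriv) w).fun_div (hf w) hne).differentiableWithinAt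
  have h := norm_iteratedDeriv_le_of_forall_mem_sphere_norm_le (C := 8 * U / (R * l)) k hρ0 hdiff
    (fun w hw => by
      have hw' := Metric.sphere_subset_closedBall hw
      rw [norm_div]
      calc _ ≤ U / (R / 2) / (l / 2) := by
            gcongr
            · exact hder w hw'
            · exact hlow w hw'
        _ = 4 * U / (R * l) := by field_simp; norm_num
        _ ≤ _ := by
          gcongr
          norm_num)
  refine h.trans (le_of_eq ?_)
  rw [hρ, div_pow (R * l), div_pow (8 * U)]
  field_simp
  ring

theorem norm_iteratedDeriv_logDeriv_LFunction_le (k : ℕ) : ∃ C : ℝ, 1 ≤ C ∧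
    ∀ (q : ℕ) [NeZero q] (χ : DirichletCharacter ℂ q), χ.IsPrimitive → χ ≠ 1 →
      ∀ x t : ℝ, 0 < x → x ≤ 1 → ‖iteratedDeriv k (fun w => deriv (DirichletCharacter.LFunction χ) w
        / DirichletCharacter.LFunction χ w) (1 + x + I * t)‖ ≤ C * (q * (|t| + 2)) ^ (1 / 2 : ℝ) := by
  set e : ℝ := 1 / (4 * (k + 1)) with he
  have he0 : 0 < e := by positivity
  have he1 : e ≤ 1 := by
    rw [he, div_le_one (by positivity)]
    have : (0 : ℝ) ≤ k := Nat.cast_nonneg k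
    linarith
  obtain ⟨C, hC1, hC⟩ := norm_LFunction_le e he0 he1
  obtain ⟨c, hc, hlow⟩ := lower_LFunction e he0 he1
  refine ⟨max 1 (k.factorial * (8 * (C * 2) / (e / 2 * c)) ^ (k + 1)), le_max_left _ _,
    fun q _ χ hp hχ x t hx hx1 => ?_⟩
  have hq := one_le_natCast_of_neZero q
  have ht : 0 ≤ |t| := abs_nonneg t
  set T : ℝ := q * (|t| + 2) with hT
  have hT1 : 1 ≤ T := one_le_mul_of_one_le_of_one_le hq (by linarith)
  have hT0 : 0 < T := by linarith
  have h := norm_iteratedDeriv_logDeriv_le (DirichletCharacter.differentiable_LFunction hχ)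
    (s := 1 + x + I * t) (R := e / 2) (U := C * (2 * T ^ e)) (l := c / T ^ e) (by positivity)
    (by positivity) (fun w hw => ?_) (hlow q χ hp hχ x t hx hx1) k
  · refine h.trans ?_
    have e1 : 8 * (C * (2 * T ^ e)) / (e / 2 * (c / T ^ e)) =
        8 * (C * 2) / (e / 2 * c) * T ^ (2 * e) := by
      rw [two_mul e, Real.rpow_add hT0]
      field_simp
    rw [e1, mul_pow, ← mul_assoc]
    have e2 : (T ^ (2 * e)) ^ (k + 1) = T ^ (1 / 2 : ℝ) := by
      rw [← Real.rpow_mul_natCast hT0.le]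
      congr 1
      rw [he]
      push_cast
      field_simp
      norm_num
    rw [e2]
    gcongr
    exact le_max_right _ _
  · obtain ⟨h1, h2⟩ := abs_re_sub_le_of_mem_closedBall hw
    simp at h1 h2
    refine (hC q χ hχ w (by linarith [(abs_le.1 h1).1])).trans ?_
    gcongr
    refine le_trans ?_ (two_mul_rpow_le hT1 he1)
    refine Real.rpow_le_rpow (by positivity) ?_ he0.le
    have h3 : |w.im| ≤ |t| + 1 := by
      have := abs_sub_abs_le_abs_sub w.im t
      linarith
    rw [hT]
    nlinarith

theorem norm_iteratedDeriv_logDeriv_zetaMulSub_le (k : ℕ) : ∃ C : ℝ, 1 ≤ C ∧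
      ∀ x t : ℝ, 0 < x → x ≤ 1 → ‖iteratedDeriv k (fun w => deriv zetaMulSub w / zetaMulSub w)
        (1 + x + I * t)‖ ≤ C * (|t| + 2) ^ (1 / 2 : ℝ) := by
  set e : ℝ := 1 / (4 * (k + 1)) with he
  have he0 : 0 < e := by positivity
  have he1 : e ≤ 1 := by
    rw [he, div_le_one (by positivity)]
    have : (0 : ℝ) ≤ k := Nat.cast_nonneg k
    linarith
  obtain ⟨C, hC1, hC⟩ := norm_zetaReg_le e he0 he1
  obtain ⟨c, hc, hlow⟩ := lower_zetaMulSub e he0 he1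
  refine ⟨max 1 (k.factorial * (8 * (C * 5) / (e / 2 * c)) ^ (k + 1)), le_max_left _ _,
    fun x t hx hx1 => ?_⟩
  have ht : 0 ≤ |t| := abs_nonneg t
  set T : ℝ := |t| + 2 with hT
  have hT1 : 1 ≤ T := by linarith
  have hT0 : 0 < T := by linarith
  have hTe : 1 ≤ T ^ e := Real.one_le_rpow hT1 he0.le
  have h := norm_iteratedDeriv_logDeriv_le differentiable_zetaMulSub
    (s := 1 + x + I * t) (R := e / 2) (U := C * (5 * T * T ^ e)) (l := c * T / T ^ e) (by positivity)
    (by positivity) (fun w hw => ?_) (hlow x t hx hx1) k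
  · refine h.trans ?_
    have e1 : 8 * (C * (5 * T * T ^ e)) / (e / 2 * (c * T / T ^ e)) =
        8 * (C * 5) / (e / 2 * c) * T ^ (2 * e) := by
      rw [two_mul e, Real.rpow_add hT0]
      field_simp
    rw [e1, mul_pow, ← mul_assoc]
    have e2 : (T ^ (2 * e)) ^ (k + 1) = T ^ (1 / 2 : ℝ) := by
      rw [← Real.rpow_mul_natCast hT0.le]
      congr 1
      rw [he]
      push_cast
      field_simp
      norm_num
    rw [e2]
    gcongr
    exact le_max_right _ _
  · obtain ⟨h1, h2⟩ := abs_re_sub_le_of_mem_closedBall hw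
    simp at h1 h2
    have h3 : |w.im| ≤ |t| + 1 := by
      have := abs_sub_abs_le_abs_sub w.im t
      linarith
    have h4 : ‖zetaReg w‖ ≤ C * (2 * T ^ e) := by
      refine (hC w (by linarith [(abs_le.1 h1).1])).trans ?_
      gcongr
      refine le_trans ?_ (two_mul_rpow_le hT1 he1)
      refine Real.rpow_le_rpow (by positivity) ?_ he0.le
      linarith
    have h5 : ‖w - 1‖ ≤ 2 * T := by
      refine (norm_le_abs_re_add_abs_im _).trans ?_
      have h6 : |(w - 1).re| ≤ 2 := by
        rw [abs_le] at *
        simp only [sub_re, one_re]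
        constructor <;> linarith [h1.1, h1.2]
      simp only [sub_im, one_im, sub_zero]
      linarith
    rw [zetaMulSub_eq]
    calc _ ≤ 1 + 2 * T * (C * (2 * T ^ e)) := by
          refine (norm_add_le _ _).trans ?_
          rw [norm_one, norm_mul]
          gcongr
      _ ≤ _ := by
        have : 1 ≤ C * (T * T ^ e) := one_le_mul_of_one_le_of_one_le hC1
          (one_le_mul_of_one_le_of_one_le hT1 hTe)
        linarith

theorem norm_iteratedDeriv_zetaReg_le (k : ℕ) : ∃ C : ℝ, 1 ≤ C ∧
      ∀ x t : ℝ, 0 < x → x ≤ 1 → ‖iteratedDeriv k zetaReg (1 + x + I * t)‖ ≤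
        C * (|t| + 2) ^ (1 / 2 : ℝ) := by
  obtain ⟨C, hC1, hC⟩ := norm_zetaReg_le (1 / 2) (by norm_num) (by norm_num)
  refine ⟨max 1 (k.factorial * (C * 2) / (1 / 4) ^ k), le_max_left _ _, fun x t hx hx1 => ?_⟩
  have ht : 0 ≤ |t| := abs_nonneg t
  have h := norm_iteratedDeriv_le_of_forall_mem_sphere_norm_le (f := zetaReg)
    (c := 1 + x + I * t) (R := 1 / 4) (C := C * (2 * (|t| + 2) ^ (1 / 2 : ℝ))) k (by norm_num)
    differentiable_zetaReg.diffContOnCl (fun w hw => by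
      obtain ⟨h1, h2⟩ := abs_re_sub_le_of_mem_closedBall (Metric.sphere_subset_closedBall hw)
      simp at h1 h2
      refine (hC w (by linarith [(abs_le.1 h1).1])).trans ?_
      gcongr
      refine le_trans ?_ (two_mul_rpow_le (by linarith) (by norm_num))
      refine Real.rpow_le_rpow (by positivity) ?_ (by norm_num)
      have h3 : |w.im| ≤ |t| + 1 := by
        have := abs_sub_abs_le_abs_sub w.im t
        linarith
      linarith)
  refine h.trans ?_
  calc _ = (k.factorial * (C * 2) / (1 / 4) ^ k) * (|t| + 2) ^ (1 / 2 : ℝ) := by ring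
    _ ≤ _ := by
      gcongr
      exact le_max_right _ _

lemma norm_inv_sub_inv_add_one_le {c : ℝ} (hc : 1 ≤ c) (y : ℝ) :
    ‖1 / (c + y * I : ℂ) - 1 / (c + y * I + 1 : ℂ)‖ ≤ (1 + y ^ 2)⁻¹ := by
  have h1 : (c + y * I : ℂ) ≠ 0 := by
    intro h
    have := congrArg re h
    simp at this
    linarith
  have h2 : (c + y * I + 1 : ℂ) ≠ 0 := by
    intro h
    have := congrArg re h
    simp at this
    linarith
  have h3 : 1 / (c + y * I : ℂ) - 1 / (c + y * I + 1 : ℂ) =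
      1 / ((c + y * I) * (c + y * I + 1)) := by
    field_simp
    ring
  have a1 : √(1 + y ^ 2) ≤ ‖(c + y * I : ℂ)‖ := by
    rw [Complex.norm_def]
    refine Real.sqrt_le_sqrt ?_
    simp [normSq_apply]
    nlinarith
  have a2 : √(1 + y ^ 2) ≤ ‖(c + y * I + 1 : ℂ)‖ := by
    rw [Complex.norm_def]
    refine Real.sqrt_le_sqrt ?_
    simp [normSq_apply]
    nlinarith
  rw [h3, norm_div, norm_one, norm_mul, one_div]
  refine inv_anti₀ (by positivity) ?_
  calc 1 + y ^ 2 = √(1 + y ^ 2) * √(1 + y ^ 2) := (Real.mul_self_sqrt (by positivity)).symm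
    _ ≤ _ := by gcongr

lemma continuous_inv_sub_inv_add_one {c : ℝ} (hc : 1 ≤ c) :
    Continuous fun y : ℝ => 1 / (c + y * I : ℂ) - 1 / (c + y * I + 1 : ℂ) := by
  have h1 : ∀ y : ℝ, (c + y * I : ℂ) ≠ 0 := by
    intro y h
    have := congrArg re h
    simp at this
    linarith
  have h2 : ∀ y : ℝ, (c + y * I + 1 : ℂ) ≠ 0 := by
    intro y h
    have := congrArg re h
    simp at this
    linarith
  exact (continuous_const.div (by fun_prop) h1).sub (continuous_const.div (by fun_prop) h2)

lemma integrable_inv_sub_inv_add_one {c : ℝ} (hc : 1 ≤ c) :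
    Integrable fun y : ℝ => 1 / (c + y * I : ℂ) - 1 / (c + y * I + 1 : ℂ) :=
  integrable_inv_one_add_sq.mono' (continuous_inv_sub_inv_add_one hc).aestronglyMeasurable
    (Eventually.of_forall (norm_inv_sub_inv_add_one_le hc))

lemma integral_cpow_mul_inv_sub_inv_add_one {c v : ℝ} (hc : 1 ≤ c) (hv : 0 < v) :
    (1 / (2 * Real.pi) : ℝ) • ∫ y : ℝ, (v : ℂ) ^ (-(c + y * I : ℂ)) *
      (1 / (c + y * I : ℂ) - 1 / (c + y * I + 1 : ℂ)) = ((max (1 - v) 0 : ℝ) : ℂ) := by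
  set f : ℝ → ℂ := fun u => ((max (1 - u) 0 : ℝ) : ℂ) with hf
  set g : ℝ → ℂ := fun u => (Ioc 0 1).indicator (fun _ => (1 : ℂ)) u -
    (Ioc 0 1).indicator (fun t : ℝ => (t : ℂ) ^ (1 : ℂ)) u with hg
  have hfg : EqOn f g (Ioi 0) := by
    intro u hu
    simp only [hf, hg, indicator]
    split_ifs with h
    · rw [cpow_one, max_eq_left (by linarith [h.2])]
      simp
    · rw [max_eq_right]
      · simp
      · by_contra! h'
        exact h ⟨hu, by linarith⟩
  have hM : ∀ s : ℂ, 0 < s.re → HasMellin f s (1 / s - 1 / (s + 1)) := by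
    intro s hs
    have h1 := hasMellin_one_Ioc hs
    have h2 := hasMellin_cpow_Ioc 1 (s := s) (by simp; linarith)
    have h3 := hasMellin_sub h1.1 h2.1
    rw [h1.2, h2.2] at h3
    have hcongr : EqOn (fun t : ℝ => (t : ℂ) ^ (s - 1) • f t)
        (fun t : ℝ => (t : ℂ) ^ (s - 1) • g t) (Ioi 0) := fun t ht => by
      simp only [hfg ht]
    refine ⟨(integrableOn_congr_fun hcongr measurableSet_Ioi).2 h3.1, ?_⟩
    rw [← h3.2]
    exact setIntegral_congr_fun measurableSet_Ioi hcongr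
  have hmel : ∀ y : ℝ, mellin f (c + y * I) = 1 / (c + y * I : ℂ) - 1 / (c + y * I + 1 : ℂ) :=
    fun y => (hM _ (by simp; linarith)).2
  have hcont : Continuous f := by fun_prop
  have key := mellinInv_mellin_eq c f hv (hM c (by simp; linarith)).1 (by
    unfold VerticalIntegrable
    simp only [hmel]
    exact integrable_inv_sub_inv_add_one hc) hcont.continuousAt
  unfold mellinInv at key
  simp only [hmel, smul_eq_mul] at key
  exact key

lemma hasSum_mul_max_one_sub {b : ℕ → ℂ} (hb0 : b 0 = 0) {c X : ℝ} (hc : 1 ≤ c)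
    (hb : LSeriesSummable b c) (hX : 0 < X) :
    HasSum (fun n : ℕ => b n * ((max (1 - n / X) 0 : ℝ) : ℂ))
      ((1 / (2 * Real.pi) : ℝ) • ∫ y : ℝ, LSeries b (c + y * I) * ((X : ℂ) ^ (c + y * I : ℂ) *
        (1 / (c + y * I : ℂ) - 1 / (c + y * I + 1 : ℂ)))) := by
  set w : ℝ → ℂ := fun y => 1 / (c + y * I : ℂ) - 1 / (c + y * I + 1 : ℂ) with hw
  set F : ℕ → ℝ → ℂ := fun n y => LSeries.term b (c + y * I) n * ((X : ℂ) ^ (c + y * I : ℂ) * w y)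
    with hF
  have hXne : (X : ℂ) ≠ 0 := by exact_mod_cast hX.ne'
  have hXcont : Continuous fun y : ℝ => (X : ℂ) ^ (c + y * I : ℂ) :=
    Continuous.const_cpow (by fun_prop) (Or.inl hXne)
  have hnorm : ∀ n y, ‖F n y‖ = ‖LSeries.term b c n‖ * X ^ c * ‖w y‖ := by
    intro n y
    rw [hF]
    simp only [norm_mul, norm_cpow_eq_rpow_re_of_pos hX]
    rw [LSeries.norm_term_eq, LSeries.norm_term_eq]
    simp
    ring_nf
  have htc : ∀ n, Continuous fun y : ℝ => LSeries.term b (c + y * I) n := by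
    intro n
    simp only [LSeries.term_def]
    split_ifs with hn
    · exact continuous_const
    · have hn' : (n : ℂ) ≠ 0 := by exact_mod_cast hn
      refine continuous_const.div (Continuous.const_cpow (by fun_prop) (Or.inl hn')) ?_
      intro y
      rw [Ne, cpow_eq_zero_iff]
      tauto
  have hint : ∀ n, Integrable (F n) := by
    intro n
    refine ((integrable_inv_sub_inv_add_one hc).norm.const_mul (‖LSeries.term b c n‖ * X ^ c)).mono'
      ((htc n).mul (hXcont.mul (continuous_inv_sub_inv_add_one hc))).aestronglyMeasurable ?_
    exact Eventually.of_forall fun y => (hnorm n y).le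
  have hsum : Summable fun n => ∫ y, ‖F n y‖ := by
    simp only [hnorm, integral_const_mul]
    exact (hb.norm.mul_right _).mul_right _
  have h := (hasSum_integral_of_summable_integral_norm hint hsum).const_smul
    (1 / (2 * Real.pi) : ℝ)
  have hfun : (fun n : ℕ => b n * ((max (1 - n / X) 0 : ℝ) : ℂ)) =
      fun n => (1 / (2 * Real.pi) : ℝ) • ∫ y, F n y := by
    ext n
    rcases Nat.eq_zero_or_pos n with rfl | hn
    · simp [hF, hb0]
    · have hnX : (0 : ℝ) < n / X := by positivity
      rw [← integral_cpow_mul_inv_sub_inv_add_one hc hnX, mul_smul_comm, ← integral_const_mul]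
      congr 2
      ext y
      simp only [hF, LSeries.term_def, hn.ne', if_false, hw]
      rw [ofReal_div, cpow_neg, div_cpow_ofReal_nonneg (by positivity) hX.le, ofReal_natCast]
      have : (X : ℂ) ^ (c + y * I : ℂ) ≠ 0 := by
        rw [Ne, cpow_eq_zero_iff]
        tauto
      have : (n : ℂ) ^ (c + y * I : ℂ) ≠ 0 := by
        rw [Ne, cpow_eq_zero_iff]
        have : (n : ℂ) ≠ 0 := by exact_mod_cast hn.ne'
        tauto
      field_simp
  have hval : (fun y : ℝ => LSeries b (c + y * I) * ((X : ℂ) ^ (c + y * I : ℂ) *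
      (1 / (c + y * I : ℂ) - 1 / (c + y * I + 1 : ℂ)))) = fun y => ∑' n, F n y := by
    ext y
    simp only [hF, LSeries, tsum_mul_right, hw]
  rw [hfun, hval]
  exact h

lemma integrable_rpow_mul_inv_one_add_sq :
    Integrable fun y : ℝ => (|y| + 2) ^ (1 / 2 : ℝ) * (1 + y ^ 2)⁻¹ := by
  have h := (integrable_rpow_neg_one_add_norm_sq (E := ℝ) (μ := volume) (r := 3 / 2)
    (by simp; norm_num)).const_mul 2
  refine h.mono' ?_ ?_
  · refine Continuous.aestronglyMeasurable ?_
    refine Continuous.mul ?_ ?_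
    · exact (continuous_abs.add continuous_const).rpow_const fun y => Or.inr (by norm_num)
    · exact Continuous.inv₀ (by fun_prop) fun y => by positivity
  · refine Eventually.of_forall fun y => ?_
    have hp : 0 < 1 + y ^ 2 := by positivity
    rw [Real.norm_of_nonneg (by positivity), Real.norm_eq_abs, sq_abs]
    have h1 : (|y| + 2) ^ (1 / 2 : ℝ) ≤ 2 * (1 + y ^ 2) ^ (1 / 4 : ℝ) := by
      have h2 : |y| + 2 ≤ 4 * (1 + y ^ 2) ^ (1 / 2 : ℝ) := by
        rw [← Real.sqrt_eq_rpow]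
        have h3 : |y| ≤ √(1 + y ^ 2) := by
          rw [← Real.sqrt_sq_eq_abs]
          exact Real.sqrt_le_sqrt (by linarith)
        have h4 : 1 ≤ √(1 + y ^ 2) := by
          rw [Real.one_le_sqrt]
          nlinarith
        linarith
      calc (|y| + 2) ^ (1 / 2 : ℝ) ≤ (4 * (1 + y ^ 2) ^ (1 / 2 : ℝ)) ^ (1 / 2 : ℝ) := by gcongr
        _ = _ := by
          rw [Real.mul_rpow (by norm_num) (by positivity), ← Real.rpow_mul hp.le,
            show (4 : ℝ) = 2 ^ (2 : ℝ) by norm_num, ← Real.rpow_mul (by norm_num)]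
          norm_num
    calc _ ≤ 2 * (1 + y ^ 2) ^ (1 / 4 : ℝ) * (1 + y ^ 2)⁻¹ := by gcongr
      _ = _ := by
        rw [mul_assoc, ← Real.rpow_neg_one, ← Real.rpow_add hp]
        norm_num

theorem norm_sum_mul_one_sub_le : ∃ K : ℝ, 1 ≤ K ∧ ∀ (b : ℕ → ℂ) (M : ℝ), b 0 = 0 → 0 ≤ M →
    (∀ s : ℂ, 1 < s.re → LSeriesSummable b s) →
    (∀ x t : ℝ, 0 < x → x ≤ 1 → ‖LSeries b (1 + x + I * t)‖ ≤ M * (|t| + 2) ^ (1 / 2 : ℝ)) →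
    ∀ N : ℕ, 3 ≤ N → ‖∑ n ∈ Finset.range N, b n * (N - n)‖ ≤ K * M * N ^ 2 := by
  set J : ℝ := ∫ y : ℝ, (|y| + 2) ^ (1 / 2 : ℝ) * (1 + y ^ 2)⁻¹ with hJ
  have hJ0 : 0 ≤ J := integral_nonneg fun y => by positivity
  refine ⟨max 1 (Real.exp 1 * J), le_max_left _ _, fun b M hb0 hM hsum hbd N hN => ?_⟩
  have hN0 : (0 : ℝ) < N := by positivity
  have hlog : 1 ≤ Real.log N := by
    rw [Real.le_log_iff_exp_le hN0]
    have : (3 : ℝ) ≤ N := by exact_mod_cast hN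
    linarith [Real.exp_one_lt_d9]
  set x : ℝ := 1 / Real.log N with hx
  have hx0 : 0 < x := by positivity
  have hx1 : x ≤ 1 := by rw [hx, div_le_one (by linarith)]; exact hlog
  have hc : 1 ≤ 1 + x := by linarith
  have h := hasSum_mul_max_one_sub hb0 hc (hsum _ (by simp; linarith)) hN0
  have h2 : HasSum (fun n : ℕ => b n * ((max (1 - n / (N : ℝ)) 0 : ℝ) : ℂ))
      (∑ n ∈ Finset.range N, b n * ((max (1 - n / (N : ℝ)) 0 : ℝ) : ℂ)) := by
    refine hasSum_sum_of_ne_finset_zero fun n hn => ?_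
    rw [Finset.mem_range, not_lt] at hn
    have : 1 ≤ (n : ℝ) / N := by
      rw [one_le_div hN0]
      exact_mod_cast hn
    rw [max_eq_right (by linarith)]
    simp
  have h3 := h2.unique h
  have h4 : ∑ n ∈ Finset.range N, b n * (N - n) =
      N * ∑ n ∈ Finset.range N, b n * ((max (1 - n / (N : ℝ)) 0 : ℝ) : ℂ) := by
    rw [Finset.mul_sum]
    refine Finset.sum_congr rfl fun n hn => ?_
    have hn' : (n : ℝ) / N ≤ 1 := by
      rw [div_le_one hN0]
      exact_mod_cast (Finset.mem_range.1 hn).le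
    rw [max_eq_left (by linarith)]
    push_cast
    have : (N : ℂ) ≠ 0 := by exact_mod_cast hN0.ne'
    field_simp
  have hXc : (N : ℝ) ^ (1 + x) = Real.exp 1 * N := by
    rw [Real.rpow_add hN0, Real.rpow_one, mul_comm, Real.rpow_def_of_pos hN0, hx,
      mul_one_div_cancel (by linarith)]
  have h5 : ‖∫ y : ℝ, LSeries b ((1 + x : ℝ) + y * I) * (((N : ℝ) : ℂ) ^ ((1 + x : ℝ) + y * I : ℂ) *
        (1 / ((1 + x : ℝ) + y * I : ℂ) - 1 / ((1 + x : ℝ) + y * I + 1 : ℂ)))‖ ≤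
      M * (Real.exp 1 * N) * J := by
    rw [hJ, ← integral_const_mul]
    refine norm_integral_le_of_norm_le (integrable_rpow_mul_inv_one_add_sq.const_mul _)
      (Eventually.of_forall fun y => ?_)
    rw [norm_mul, norm_mul, norm_cpow_eq_rpow_re_of_pos hN0]
    have e1 : ‖LSeries b ((1 + x : ℝ) + y * I)‖ ≤ M * (|y| + 2) ^ (1 / 2 : ℝ) := by
      have := hbd x y hx0 hx1
      rw [mul_comm I] at this
      simpa using this
    have e2 : (((1 + x : ℝ) : ℂ) + y * I).re = 1 + x := by simp
    rw [e2, hXc]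
    calc _ ≤ M * (|y| + 2) ^ (1 / 2 : ℝ) * (Real.exp 1 * N * (1 + y ^ 2)⁻¹) := by
          gcongr
          exact norm_inv_sub_inv_add_one_le hc y
      _ = _ := by ring
  rw [h4, h3, norm_mul, norm_smul, norm_natCast]
  have hpi : ‖(1 / (2 * Real.pi) : ℝ)‖ ≤ 1 := by
    rw [Real.norm_of_nonneg (by positivity), div_le_one (by positivity)]
    linarith [Real.pi_gt_three]
  calc _ ≤ N * (1 * (M * (Real.exp 1 * N) * J)) := by gcongr
    _ = Real.exp 1 * J * M * N ^ 2 := by ring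
    _ ≤ _ := by
      gcongr
      exact le_max_right _ _

lemma log_pow_le_mul_sqrt (m : ℕ) : ∃ C : ℝ, 1 ≤ C ∧ ∀ x : ℝ, 1 ≤ x →
    Real.log x ^ m ≤ C * √x := by
  rcases Nat.eq_zero_or_pos m with rfl | hm
  · exact ⟨1, le_rfl, fun x hx => by simpa using hx⟩
  refine ⟨max 1 ((2 * m : ℝ) ^ m), le_max_left _ _, fun x hx => ?_⟩
  have hm0 : (0 : ℝ) < m := by exact_mod_cast hm
  have h1 := Real.log_le_rpow_div (x := x) (by linarith) (show (0 : ℝ) < 1 / (2 * m) by positivity)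
  have h2 : Real.log x ≤ 2 * m * x ^ (1 / (2 * m) : ℝ) := by
    refine h1.trans (le_of_eq ?_)
    field_simp
  calc Real.log x ^ m ≤ (2 * m * x ^ (1 / (2 * m) : ℝ)) ^ m := by
        gcongr
        exact Real.log_nonneg hx
    _ = (2 * m : ℝ) ^ m * √x := by
        rw [mul_pow, ← Real.rpow_mul_natCast (by linarith), Real.sqrt_eq_rpow]
        congr 2
        field_simp
    _ ≤ _ := by
        gcongr
        exact le_max_right _ _

lemma norm_sum_range_le_of_smooth {b : ℕ → ℂ} {A G : ℝ} {N h : ℕ} (hh : 1 ≤ h) (hhN : h ≤ N)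
    (hA : 0 ≤ A) (hW : ∀ n : ℕ, N ≤ n → ‖∑ i ∈ Finset.range n, b i * (n - i)‖ ≤ A * n ^ 2)
    (hG : ∀ n < 2 * N, ‖b n‖ ≤ G) :
    ‖∑ n ∈ Finset.range N, b n‖ ≤ 5 * A * N ^ 2 / h + h * G := by
  have hh0 : (0 : ℝ) < h := by exact_mod_cast hh
  have e1 : (h : ℂ) * ∑ n ∈ Finset.range N, b n =
      ∑ i ∈ Finset.range (N + h), b i * ((N + h : ℕ) - i) - ∑ i ∈ Finset.range N, b i * (N - i) -
        ∑ j ∈ Finset.range h, b (N + j) * (h - j) := by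
    rw [Finset.sum_range_add, Finset.mul_sum]
    have e2 : ∑ j ∈ Finset.range h, b (N + j) * (((N + h : ℕ) : ℂ) - (N + j : ℕ)) =
        ∑ j ∈ Finset.range h, b (N + j) * (h - j) :=
      Finset.sum_congr rfl fun j _ => by push_cast; ring
    rw [e2, add_sub_right_comm, add_sub_cancel_right, ← Finset.sum_sub_distrib]
    exact Finset.sum_congr rfl fun j _ => by push_cast; ring
  have b1 := hW (N + h) (by omega)
  have b2 := hW N le_rfl
  have b3 : ‖∑ j ∈ Finset.range h, b (N + j) * ((h : ℂ) - j)‖ ≤ h * (G * h) := by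
    refine (norm_sum_le _ _).trans ((Finset.sum_le_card_nsmul _ _ (G * h) fun j hj => ?_).trans ?_)
    · rw [Finset.mem_range] at hj
      have h3 : ‖((h : ℂ) - j)‖ ≤ h := by
        have : ((h : ℂ) - j) = ((h - j : ℕ) : ℂ) := by push_cast [hj.le]; ring
        rw [this, norm_natCast]
        exact_mod_cast Nat.sub_le _ _
      have h4 := hG (N + j) (by omega)
      rw [norm_mul]
      exact mul_le_mul h4 h3 (norm_nonneg _) ((norm_nonneg _).trans h4)
    · simp
  have hhN' : (h : ℝ) ≤ N := by exact_mod_cast hhN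
  have b4 : A * ((N + h : ℕ) : ℝ) ^ 2 ≤ A * (2 * N) ^ 2 := by
    push_cast
    gcongr
    linarith
  have b5 : h * ‖∑ n ∈ Finset.range N, b n‖ ≤ 5 * A * N ^ 2 + h * (G * h) := by
    rw [← Complex.norm_natCast h, ← norm_mul, e1, Complex.norm_natCast]
    refine (norm_sub_le _ _).trans ?_
    have := norm_sub_le (∑ i ∈ Finset.range (N + h), b i * (((N + h : ℕ) : ℂ) - i))
      (∑ i ∈ Finset.range N, b i * ((N : ℂ) - i))
    linarith
  rw [← mul_le_mul_iff_right₀ hh0]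
  refine b5.trans (le_of_eq ?_)
  field_simp

lemma norm_sum_Ico_mul_le_of_antitone {b : ℕ → ℂ} {w : ℕ → ℝ} {m N : ℕ} {T : ℝ} (hmN : m ≤ N)
    (hw : ∀ n, m ≤ n → w (n + 1) ≤ w n) (hw0 : ∀ n, m ≤ n → 0 ≤ w n)
    (hT : ∀ n ≤ N, ‖∑ i ∈ Finset.range n, b i‖ ≤ T) :
    ‖∑ n ∈ Finset.Ico m N, w n * b n‖ ≤ 2 * T * w m := by
  have key : ∀ n, m ≤ n → n ≤ N → ‖∑ i ∈ Finset.Ico m n, w i * b i -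
      w n * ∑ i ∈ Finset.range n, b i‖ ≤ T * (2 * w m - w n) := by
    intro n hmn
    induction n, hmn using Nat.le_induction with
    | base =>
      intro hn
      have : ‖(w m : ℂ)‖ = w m := by rw [norm_real, Real.norm_of_nonneg (hw0 m le_rfl)]
      simp only [Finset.Ico_self, Finset.sum_empty, zero_sub, norm_neg, norm_mul, this]
      nlinarith [hT m hn, hw0 m le_rfl]
    | succ n hmn ih =>
      intro hn
      have h1 := ih (by omega)
      have h2 := hT (n + 1) hn
      have e1 : ∑ i ∈ Finset.Ico m (n + 1), w i * b i - w (n + 1) * ∑ i ∈ Finset.range (n + 1), b i =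
          (∑ i ∈ Finset.Ico m n, w i * b i - w n * ∑ i ∈ Finset.range n, b i) +
            ((w n - w (n + 1) : ℝ) : ℂ) * ∑ i ∈ Finset.range (n + 1), b i := by
        rw [Finset.sum_Ico_succ_top hmn, Finset.sum_range_succ]
        push_cast
        ring
      have h3 : ‖((w n - w (n + 1) : ℝ) : ℂ)‖ = w n - w (n + 1) := by
        rw [norm_real, Real.norm_of_nonneg (by linarith [hw n hmn])]
      rw [e1]
      refine (norm_add_le _ _).trans ?_
      rw [norm_mul, h3]
      nlinarith [hw n hmn]
  have h1 := key N hmN le_rfl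
  have h2 : ‖(w N : ℂ) * ∑ i ∈ Finset.range N, b i‖ ≤ T * w N := by
    rw [norm_mul, norm_real, Real.norm_of_nonneg (hw0 N hmN)]
    nlinarith [hT N le_rfl, hw0 N hmN]
  have h3 := norm_add_le (∑ i ∈ Finset.Ico m N, w i * b i - w N * ∑ i ∈ Finset.range N, b i)
    (w N * ∑ i ∈ Finset.range N, b i)
  rw [sub_add_cancel] at h3
  linarith

lemma logMul_iterate_apply (a : ℕ → ℂ) (m n : ℕ) :
    LSeries.logMul^[m] a n = ((Real.log n ^ m : ℝ) : ℂ) * a n := by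
  induction m with
  | zero => simp
  | succ m ih =>
    rw [Function.iterate_succ_apply', LSeries.logMul, ih, Complex.natCast_log.symm]
    push_cast
    ring

lemma one_le_log_of_three_le {N : ℕ} (hN : 3 ≤ N) : 1 ≤ Real.log N := by
  have h3 : (3 : ℝ) ≤ N := by exact_mod_cast hN
  rw [Real.le_log_iff_exp_le (by linarith)]
  linarith [Real.exp_one_lt_d9]

lemma norm_sum_log_pow_mul_le (k : ℕ) : ∃ C : ℝ, 1 ≤ C ∧ ∀ (a : ℕ → ℂ) (M : ℝ), a 0 = 0 → 1 ≤ M →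
    (∀ n : ℕ, 1 ≤ n → ‖a n‖ ≤ 1 + Real.log n) → (∀ s : ℂ, 1 < s.re → LSeriesSummable a s) →
    (∀ x t : ℝ, 0 < x → x ≤ 1 → ‖iteratedDeriv (2 * k + 1) (LSeries a) (1 + x + I * t)‖ ≤
      M * (|t| + 2) ^ (1 / 2 : ℝ)) →
    ∀ N : ℕ, 3 ≤ N → ‖∑ n ∈ Finset.range N, ((Real.log n ^ (2 * k + 1) : ℝ) : ℂ) * a n‖ ≤
      C * M * (N * Real.log N ^ (k + 1)) := by
  obtain ⟨K, hK1, hK⟩ := norm_sum_mul_one_sub_le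
  obtain ⟨Ca, hCa1, hCa⟩ := log_pow_le_mul_sqrt (k + 1)
  refine ⟨5 * K + (1 + Ca) * (3 * 2 ^ (2 * k + 1)), ?_, fun a M ha0 hM ha hsum hder N hN => ?_⟩
  · have : 0 ≤ (1 + Ca) * (3 * 2 ^ (2 * k + 1)) := by positivity
    linarith
  have hN0 : (0 : ℝ) < N := by positivity
  have hN3 : (3 : ℝ) ≤ N := by exact_mod_cast hN
  set L := Real.log N with hL
  have hL1 : 1 ≤ L := one_le_log_of_three_le hN
  set b : ℕ → ℂ := fun n => ((Real.log n ^ (2 * k + 1) : ℝ) : ℂ) * a n with hb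
  have hbl : LSeries.logMul^[2 * k + 1] a = b := by
    ext n
    exact logMul_iterate_apply a _ n
  have hab : LSeries.abscissaOfAbsConv a ≤ 1 :=
    LSeries.abscissaOfAbsConv_le_of_forall_lt_LSeriesSummable (x := 1)
      fun y hy => hsum y (by simpa using hy)
  have hlt : ∀ s : ℂ, 1 < s.re → LSeries.abscissaOfAbsConv a < s.re := fun s hs =>
    lt_of_le_of_lt hab (by exact_mod_cast hs)
  have hW : ∀ n : ℕ, N ≤ n → ‖∑ i ∈ Finset.range n, b i * (n - i)‖ ≤ K * M * n ^ 2 := by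
    intro n hn
    refine hK b M (by simp [hb, ha0]) (by linarith) (fun s hs => ?_) (fun x t hx hx1 => ?_) n
      (by omega)
    · refine LSeriesSummable_of_abscissaOfAbsConv_lt_re ?_
      rw [← hbl, LSeries.absicssaOfAbsConv_logPowMul]
      exact hlt s hs
    · have h1 := LSeries_iteratedDeriv (f := a) (2 * k + 1) (s := 1 + x + I * t)
        (hlt _ (by simpa using hx))
      have h2 := hder x t hx hx1
      rw [h1, hbl, norm_mul, norm_pow, norm_neg, norm_one, one_pow, one_mul] at h2
      exact h2
  have hlog2 : ∀ n : ℕ, 1 ≤ n → n < 2 * N → Real.log n ≤ 2 * L := by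
    intro n hn1 hn
    have : (n : ℝ) ≤ N ^ 2 := by
      have : (n : ℝ) ≤ 2 * N := by exact_mod_cast hn.le
      nlinarith
    calc Real.log n ≤ Real.log ((N : ℝ) ^ 2) :=
          Real.log_le_log (by exact_mod_cast hn1) this
      _ = 2 * L := by rw [Real.log_pow]; push_cast; rfl
  have hG : ∀ n < 2 * N, ‖b n‖ ≤ (2 * L) ^ (2 * k + 1) * (3 * L) := by
    intro n hn
    rcases Nat.eq_zero_or_pos n with rfl | hn1
    · simp only [hb, ha0, mul_zero, norm_zero]
      positivity
    · have hl := hlog2 n hn1 hn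
      have hl0 : 0 ≤ Real.log n := Real.log_natCast_nonneg n
      rw [hb]
      simp only [norm_mul, norm_real]
      rw [Real.norm_of_nonneg (by positivity)]
      gcongr
      linarith [ha n hn1]
  set P : ℝ := L ^ (k + 1) with hP
  have hP1 : 1 ≤ P := one_le_pow₀ hL1
  have hPN : P ≤ Ca * N := by
    refine (hCa N (by linarith)).trans ?_
    gcongr
    exact Real.sqrt_le_iff.2 ⟨hN0.le, by nlinarith⟩
  have hNP : 0 < N / P := by positivity
  set h : ℕ := ⌈N / P⌉₊ with hh
  have hh1 : 1 ≤ h := Nat.one_le_ceil_iff.2 hNP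
  have hhN : h ≤ N := by
    refine Nat.ceil_le.2 (div_le_self hN0.le hP1)
  have hhl : N / P ≤ h := Nat.le_ceil _
  have hhu : h ≤ (1 + Ca) * (N / P) := by
    have h1 := (Nat.ceil_lt_add_one hNP.le).le
    have h2 : 1 ≤ Ca * (N / P) := by
      rw [← mul_div_assoc, le_div_iff₀ (by positivity), one_mul]
      exact hPN
    linarith
  have main := norm_sum_range_le_of_smooth hh1 hhN (by positivity) hW hG
  refine main.trans ?_
  have b1 : 5 * (K * M) * N ^ 2 / h ≤ 5 * K * M * (N * P) := by
    calc _ ≤ 5 * (K * M) * N ^ 2 / (N / P) := by gcongr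
      _ = _ := by field_simp
  have b2 : h * ((2 * L) ^ (2 * k + 1) * (3 * L)) ≤ (1 + Ca) * (3 * 2 ^ (2 * k + 1)) * 1 * (N * P) := by
    calc _ ≤ (1 + Ca) * (N / P) * ((2 * L) ^ (2 * k + 1) * (3 * L)) := by gcongr
      _ = (1 + Ca) * (N / P) * (3 * 2 ^ (2 * k + 1) * (P * P)) := by
        rw [hP, mul_pow]
        ring
      _ = _ := by field_simp
  calc _ ≤ 5 * K * M * (N * P) + (1 + Ca) * (3 * 2 ^ (2 * k + 1)) * 1 * (N * P) := add_le_add b1 b2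
    _ ≤ 5 * K * M * (N * P) + (1 + Ca) * (3 * 2 ^ (2 * k + 1)) * M * (N * P) := by gcongr
    _ = _ := by ring

theorem norm_sum_le_of_iteratedDeriv_le (k : ℕ) : ∃ C : ℝ, 1 ≤ C ∧ ∀ (a : ℕ → ℂ) (M : ℝ),
    a 0 = 0 → 1 ≤ M →
    (∀ n : ℕ, 1 ≤ n → ‖a n‖ ≤ 1 + Real.log n) → (∀ s : ℂ, 1 < s.re → LSeriesSummable a s) →
    (∀ x t : ℝ, 0 < x → x ≤ 1 → ‖iteratedDeriv (2 * k + 1) (LSeries a) (1 + x + I * t)‖ ≤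
      M * (|t| + 2) ^ (1 / 2 : ℝ)) →
    ∀ N : ℕ, 3 ≤ N → ‖∑ n ∈ Finset.range N, a n‖ ≤ C * M * (N / Real.log N ^ k) := by
  obtain ⟨C₁, hC1, hC⟩ := norm_sum_log_pow_mul_le k
  obtain ⟨Ca, hCa1, hCa⟩ := log_pow_le_mul_sqrt (k + 1)
  refine ⟨4 * Ca + 2 * C₁ * 2 ^ (2 * k + 1), ?_, fun a M ha0 hM ha hsum hder N hN => ?_⟩
  · have : 0 ≤ 2 * C₁ * 2 ^ (2 * k + 1) := by positivity
    linarith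
  have hN0 : (0 : ℝ) < N := by positivity
  have hN3 : (3 : ℝ) ≤ N := by exact_mod_cast hN
  set L := Real.log N with hL
  have hL1 : 1 ≤ L := one_le_log_of_three_le hN
  set b : ℕ → ℂ := fun n => ((Real.log n ^ (2 * k + 1) : ℝ) : ℂ) * a n with hb
  have hsq1 : 1 < √(N : ℝ) := by
    rw [Real.lt_sqrt (by norm_num)]
    linarith
  set m : ℕ := ⌈√(N : ℝ)⌉₊ with hm
  have hm2 : 2 ≤ m := by
    have : 1 < m := Nat.lt_ceil.2 (by simpa using hsq1)
    omega
  have hsqN : √(N : ℝ) * √(N : ℝ) = N := Real.mul_self_sqrt hN0.le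
  have hmN : m ≤ N := Nat.ceil_le.2 (by nlinarith)
  have hmu : (m : ℝ) ≤ 2 * √(N : ℝ) := by
    have := (Nat.ceil_lt_add_one (Real.sqrt_nonneg (N : ℝ))).le
    linarith
  have hlogm : L / 2 ≤ Real.log m := by
    rw [hL, ← Real.log_sqrt hN0.le]
    exact Real.log_le_log (by linarith) (Nat.le_ceil _)
  have hlogpos : ∀ n, m ≤ n → 0 < Real.log n := fun n hn =>
    Real.log_pos (by exact_mod_cast (show 1 < n by omega))
  set w : ℕ → ℝ := fun n => 1 / Real.log n ^ (2 * k + 1) with hw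
  have hT : ∀ n ≤ N, ‖∑ i ∈ Finset.range n, b i‖ ≤ C₁ * M * (N * L ^ (k + 1)) := by
    intro n hn
    rcases Nat.lt_or_ge n 3 with h3 | h3
    · have : ∑ i ∈ Finset.range n, b i = 0 := by
        refine Finset.sum_eq_zero fun i hi => ?_
        rw [Finset.mem_range] at hi
        have : i = 0 ∨ i = 1 := by omega
        rcases this with rfl | rfl <;> simp [hb]
      rw [this, norm_zero]
      positivity
    · refine (hC a M ha0 hM ha hsum hder n h3).trans ?_
      have hn0 : (0 : ℝ) < n := by positivity
      have hlogn : Real.log n ≤ L := Real.log_le_log hn0 (by exact_mod_cast hn)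
      have hlogn0 : 0 ≤ Real.log n := Real.log_nonneg (by exact_mod_cast (by omega : 1 ≤ n))
      gcongr
  have h1 := norm_sum_Ico_mul_le_of_antitone (b := b) (w := w) hmN
    (fun n hn => by
      have := hlogpos n hn
      have hn0 : (0 : ℝ) < n := by
        have : 0 < n := by omega
        exact_mod_cast this
      simp only [hw]
      push_cast
      gcongr
      linarith)
    (fun n hn => by
      have := hlogpos n hn
      positivity) hT
  have h2 : ∑ n ∈ Finset.Ico m N, (w n : ℂ) * b n = ∑ n ∈ Finset.Ico m N, a n := by
    refine Finset.sum_congr rfl fun n hn => ?_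
    rw [Finset.mem_Ico] at hn
    have h3 : Real.log n ^ (2 * k + 1) ≠ 0 := (pow_pos (hlogpos n hn.1) _).ne'
    rw [hw, hb]
    simp only
    rw [← mul_assoc, ← ofReal_mul, one_div_mul_cancel h3]
    simp
  rw [h2] at h1
  have h4 : ‖∑ n ∈ Finset.range m, a n‖ ≤ m * (2 * L) := by
    refine (norm_sum_le _ _).trans ((Finset.sum_le_card_nsmul _ _ (2 * L) fun j hj => ?_).trans ?_)
    · rw [Finset.mem_range] at hj
      rcases Nat.eq_zero_or_pos j with rfl | hj0
      · rw [ha0, norm_zero]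
        positivity
      · have : Real.log j ≤ L := by
          have : (0 : ℝ) < j := by exact_mod_cast hj0
          rw [hL]
          gcongr
          exact_mod_cast (by omega : j ≤ N)
        linarith [ha j hj0]
    · simp
  have h5 : 2 * (C₁ * M * (N * L ^ (k + 1))) * w m ≤
      2 * C₁ * 2 ^ (2 * k + 1) * M * (N / L ^ k) := by
    have : w m ≤ 1 / (L / 2) ^ (2 * k + 1) := by
      simp only [hw]
      gcongr
    calc _ ≤ 2 * (C₁ * M * (N * L ^ (k + 1))) * (1 / (L / 2) ^ (2 * k + 1)) := by gcongr
      _ = _ := by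
        rw [div_pow]
        field_simp
        ring
  have h6 : m * (2 * L) ≤ 4 * Ca * M * (N / L ^ k) := by
    have h7 := hCa N (by linarith)
    have h8 : L ≤ Ca * √(N : ℝ) / L ^ k := by
      rw [le_div_iff₀ (by positivity), ← pow_succ']
      exact h7
    calc m * (2 * L) ≤ 2 * √(N : ℝ) * (2 * (Ca * √(N : ℝ) / L ^ k)) := by gcongr
      _ = 4 * Ca * 1 * ((√(N : ℝ) * √(N : ℝ)) / L ^ k) := by ring
      _ ≤ _ := by
        rw [hsqN]
        gcongr
  rw [← Finset.sum_range_add_sum_Ico _ hmN]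
  refine (norm_add_le _ _).trans ?_
  calc _ ≤ 4 * Ca * M * (N / L ^ k) + 2 * C₁ * 2 ^ (2 * k + 1) * M * (N / L ^ k) :=
        add_le_add (h4.trans h6) (h1.trans h5)
    _ = _ := by ring

lemma vonMangoldt_le_one_add_log (n : ℕ) :
    ArithmeticFunction.vonMangoldt n ≤ 1 + Real.log n := by
  linarith [ArithmeticFunction.vonMangoldt_le_log (n := n)]

lemma iteratedDeriv_eq_of_forall_re {f g : ℂ → ℂ} (h : ∀ s : ℂ, 1 < s.re → f s = g s) (k : ℕ)
    {s : ℂ} (hs : 1 < s.re) : iteratedDeriv k f s = iteratedDeriv k g s := by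
  refine Filter.EventuallyEq.iteratedDeriv_eq k ?_
  filter_upwards [(isOpen_lt continuous_const continuous_re).mem_nhds hs] with w hw using h w hw

theorem siegel_walfisz_primitive (k : ℕ) : ∃ C : ℝ, 1 ≤ C ∧
    ∀ (q : ℕ) [NeZero q] (χ : DirichletCharacter ℂ q), χ.IsPrimitive → χ ≠ 1 → ∀ N : ℕ, 3 ≤ N →
      ‖∑ n ∈ Finset.range N, (ArithmeticFunction.vonMangoldt n : ℂ) * χ n‖ ≤
        C * q * (N / Real.log N ^ k) := by
  obtain ⟨C, hC1, hC⟩ := norm_sum_le_of_iteratedDeriv_le k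
  obtain ⟨D, hD1, hD⟩ := norm_iteratedDeriv_logDeriv_LFunction_le (2 * k + 1)
  refine ⟨C * D, one_le_mul_of_one_le_of_one_le hC1 hD1, fun q _ χ hp hχ N hN => ?_⟩
  have hq := one_le_natCast_of_neZero q
  have hfun : ((fun n : ℕ => (χ n : ℂ)) * fun n : ℕ => (ArithmeticFunction.vonMangoldt n : ℂ)) =
      fun n : ℕ => (ArithmeticFunction.vonMangoldt n : ℂ) * χ n := by
    ext n
    simp [mul_comm]
  have h := hC (fun n => (ArithmeticFunction.vonMangoldt n : ℂ) * χ n) (D * q) (by simp)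
    (one_le_mul_of_one_le_of_one_le hD1 hq) (fun n hn => ?_) (fun s hs => ?_)
    (fun x t hx hx1 => ?_) N hN
  · refine h.trans (le_of_eq ?_)
    ring
  · rw [norm_mul, norm_real, Real.norm_of_nonneg ArithmeticFunction.vonMangoldt_nonneg]
    refine (mul_le_of_le_one_right ArithmeticFunction.vonMangoldt_nonneg (χ.norm_le_one _)).trans ?_
    exact vonMangoldt_le_one_add_log n
  · rw [← hfun]
    exact DirichletCharacter.LSeriesSummable_twist_vonMangoldt χ hs
  · have hre : 1 < (1 + x + I * t : ℂ).re := by simp [hx]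
    rw [iteratedDeriv_eq_of_forall_re (g := fun w => -(deriv (DirichletCharacter.LFunction χ) w
        / DirichletCharacter.LFunction χ w)) (fun s hs => ?_) _ hre]
    · rw [iteratedDeriv_fun_neg, norm_neg]
      refine (hD q χ hp hχ x t hx hx1).trans ?_
      rw [Real.mul_rpow (by positivity) (by positivity), ← mul_assoc]
      gcongr
      calc (q : ℝ) ^ (1 / 2 : ℝ) ≤ (q : ℝ) ^ (1 : ℝ) :=
            Real.rpow_le_rpow_of_exponent_le hq (by norm_num)
        _ = q := Real.rpow_one _
    · have hne : DirichletCharacter.LFunction χ s ≠ 0 :=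
        DirichletCharacter.LFunction_ne_zero_of_one_le_re χ (Or.inl hχ) hs.le
      rw [deriv_LFunction_eq_neg χ hs, hfun, neg_div, neg_neg, mul_div_cancel_right₀ _ hne]

theorem prime_number_theorem_log_pow (k : ℕ) : ∃ C : ℝ, 1 ≤ C ∧ ∀ N : ℕ, 3 ≤ N →
    |∑ n ∈ Finset.range N, ArithmeticFunction.vonMangoldt n - N| ≤
        C * (N / Real.log N ^ k) := by
  obtain ⟨C, hC1, hC⟩ := norm_sum_le_of_iteratedDeriv_le k
  obtain ⟨D, hD1, hD⟩ := norm_iteratedDeriv_logDeriv_zetaMulSub_le (2 * k + 1)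
  obtain ⟨E, hE1, hE⟩ := norm_iteratedDeriv_zetaReg_le (2 * k + 1)
  obtain ⟨F, hF1, hF⟩ := log_pow_le_mul_sqrt k
  refine ⟨C * (D + E) + F, by nlinarith [mul_nonneg (zero_le_one.trans hC1) (by linarith : 0 ≤ D + E)], fun N hN => ?_⟩
  set a : ℕ → ℂ := fun n => (ArithmeticFunction.vonMangoldt n : ℂ) - if n = 0 then 0 else 1 with ha
  have hs1 : ∀ s : ℂ, 1 < s.re → LSeriesSummable (fun n : ℕ => if n = 0 then (0 : ℂ) else 1) s := by
    intro s hs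
    refine (LSeriesSummable_congr s fun {n} hn => ?_).2 (LSeriesSummable_one_iff.2 hs)
    simp [hn]
  have hs2 : ∀ s : ℂ, 1 < s.re →
      LSeriesSummable (fun n : ℕ => (ArithmeticFunction.vonMangoldt n : ℂ)) s :=
    fun s hs => ArithmeticFunction.LSeriesSummable_vonMangoldt hs
  have h := hC a (D + E) (by simp [ha]) (by linarith) (fun n hn => ?_)
    (fun s hs => (hs2 s hs).sub (hs1 s hs)) (fun x t hx hx1 => ?_) N hN
  · have hsum : ∑ n ∈ Finset.range N, a n =
        ((∑ n ∈ Finset.range N, ArithmeticFunction.vonMangoldt n - N + 1 : ℝ) : ℂ) := by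
      simp only [ha, Finset.sum_sub_distrib]
      obtain ⟨m, rfl⟩ : ∃ m, N = m + 1 := ⟨N - 1, by omega⟩
      rw [Finset.sum_range_succ' (fun i => if i = 0 then (0 : ℂ) else 1)]
      push_cast
      simp
      ring
    rw [hsum, norm_real, Real.norm_eq_abs] at h
    have hN1 : (1 : ℝ) ≤ N := by exact_mod_cast (by omega : 1 ≤ N)
    have hlog : 0 < Real.log N := Real.log_pos (by exact_mod_cast (by omega : 1 < N))
    have h1 : 1 ≤ F * (N / Real.log N ^ k) := by
      rw [← mul_div_assoc, le_div_iff₀ (by positivity), one_mul]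
      refine (hF N hN1).trans ?_
      gcongr
      exact Real.sqrt_le_iff.2 ⟨by linarith, by nlinarith⟩
    rw [abs_le] at h ⊢
    constructor <;> linarith [h.1, h.2]
  · have h0 : n ≠ 0 := by omega
    simp only [ha, h0, if_false]
    rw [← ofReal_one, ← ofReal_sub, norm_real, Real.norm_eq_abs, abs_le]
    have h1 := vonMangoldt_le_one_add_log n
    have h2 := ArithmeticFunction.vonMangoldt_nonneg (n := n)
    have h3 : 0 ≤ Real.log n := Real.log_natCast_nonneg n
    constructor <;> linarith
  · have hre : 1 < (1 + x + I * t : ℂ).re := by simp [hx]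
    set s₀ : ℂ := 1 + x + I * t with hs₀
    rw [iteratedDeriv_eq_of_forall_re (g := fun w => -(deriv zetaMulSub w
        / zetaMulSub w) - zetaReg w) (fun s hs => ?_) _ hre]
    · have hne : zetaMulSub s₀ ≠ 0 := by
        have : s₀ ≠ 1 := fun h => by rw [h] at hre; simp at hre
        rw [zetaMulSub_of_ne this]
        exact mul_ne_zero (sub_ne_zero.2 this) (riemannZeta_ne_zero_of_one_le_re hre.le)
      rw [iteratedDeriv_fun_sub, iteratedDeriv_fun_neg]
      · refine (norm_sub_le _ _).trans ?_
        rw [norm_neg, add_mul]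
        refine add_le_add (hD x t hx hx1) (hE x t hx hx1)
      · refine ContDiffAt.neg (ContDiffAt.div ?_ ?_ hne)
        · exact (differentiable_zetaMulSub.contDiff.deriv' ).contDiffAt
        · exact differentiable_zetaMulSub.contDiff.contDiffAt
      · exact differentiable_zetaReg.contDiff.contDiffAt
    · have hs1' : s ≠ 1 := fun h => by rw [h] at hs; simp at hs
      have hz : riemannZeta s ≠ 0 := riemannZeta_ne_zero_of_one_le_re hs.le
      have hd : deriv zetaMulSub s = riemannZeta s + (s - 1) * deriv riemannZeta s := by
        have : zetaMulSub =ᶠ[𝓝 s] fun w => (w - 1) * riemannZeta w := by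
          filter_upwards [isOpen_ne.mem_nhds hs1'] with w hw using zetaMulSub_of_ne hw
        rw [this.deriv_eq]
        have h1 := ((hasDerivAt_id s).sub_const 1).mul
          (differentiableAt_riemannZeta hs1').hasDerivAt
        simpa [Pi.mul_def] using h1.deriv
      have hL : LSeries a s = LSeries (fun n : ℕ => (ArithmeticFunction.vonMangoldt n : ℂ)) s -
          riemannZeta s := by
        have := LSeries_sub (hs2 s hs) (hs1 s hs)
        rwa [LSeries_congr (f := fun n : ℕ => if n = 0 then (0 : ℂ) else 1) (g := 1)
          (fun {n} hn => by simp [hn]) s, LSeries_one_eq_riemannZeta hs] at this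
      rw [hL, hd, zetaMulSub_of_ne hs1', zetaReg_of_ne hs1', deriv_riemannZeta_eq_neg hs]
      have := sub_ne_zero.2 hs1'
      field_simp
      ring

theorem sum_norm_sq_le_of_row_sum_le {ι κ : Type*} (s : Finset ι) (t : Finset κ) (φ : κ → ι → ℂ)
    (a : ι → ℂ) {D : ℝ}
    (hD0 : 0 ≤ D) (hD : ∀ i ∈ t, ∑ j ∈ t, ‖∑ n ∈ s, φ j n * (starRingEnd ℂ) (φ i n)‖ ≤ D) :
    ∑ i ∈ t, ‖∑ n ∈ s, a n * φ i n‖ ^ 2 ≤ D * ∑ n ∈ s, ‖a n‖ ^ 2 := by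
  set S : κ → ℂ := fun i => ∑ n ∈ s, a n * φ i n with hS
  set X : ℝ := ∑ i ∈ t, ‖S i‖ ^ 2 with hX
  set A : ℝ := ∑ n ∈ s, ‖a n‖ ^ 2 with hA
  set u : ι → ℂ := fun n => ∑ i ∈ t, (starRingEnd ℂ) (S i) * φ i n with hu
  have hX0 : 0 ≤ X := Finset.sum_nonneg fun i _ => by positivity
  have hA0 : 0 ≤ A := Finset.sum_nonneg fun i _ => by positivity
  have h1 : (X : ℂ) = ∑ n ∈ s, a n * u n := by
    simp only [hu, Finset.mul_sum]
    rw [Finset.sum_comm, hX]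
    push_cast
    refine Finset.sum_congr rfl fun i _ => ?_
    rw [← Complex.conj_mul' (S i)]
    nth_rewrite 2 [hS]
    simp only [Finset.mul_sum]
    exact Finset.sum_congr rfl fun n _ => by ring
  have h2 : X ^ 2 ≤ A * ∑ n ∈ s, ‖u n‖ ^ 2 := by
    have : X ≤ ∑ n ∈ s, ‖a n‖ * ‖u n‖ := by
      have h3 : ‖(X : ℂ)‖ = X := by rw [norm_real, Real.norm_of_nonneg hX0]
      rw [← h3, h1]
      refine (norm_sum_le _ _).trans (le_of_eq ?_)
      simp
    exact (pow_le_pow_left₀ hX0 this 2).trans (Finset.sum_mul_sq_le_sq_mul_sq _ _ _)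
  have h3 : ∑ n ∈ s, ‖u n‖ ^ 2 ≤ D * X := by
    set K : κ → κ → ℂ := fun i j => ∑ n ∈ s, φ j n * (starRingEnd ℂ) (φ i n) with hK
    have hKs : ∀ i j, ‖K i j‖ = ‖K j i‖ := by
      intro i j
      rw [← Complex.norm_conj (K i j)]
      simp only [hK, map_sum, map_mul, Complex.conj_conj]
      congr 1
      exact Finset.sum_congr rfl fun n _ => by ring
    have h4 : ((∑ n ∈ s, ‖u n‖ ^ 2 : ℝ) : ℂ) =
        ∑ i ∈ t, ∑ j ∈ t, S i * (starRingEnd ℂ) (S j) * K i j := by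
      simp only [hK, Finset.mul_sum]
      push_cast
      have : ∀ i ∈ t, ∑ j ∈ t, ∑ n ∈ s, S i * (starRingEnd ℂ) (S j) *
          (φ j n * (starRingEnd ℂ) (φ i n)) = ∑ n ∈ s, ∑ j ∈ t, S i * (starRingEnd ℂ) (S j) *
          (φ j n * (starRingEnd ℂ) (φ i n)) := fun i _ => Finset.sum_comm
      rw [Finset.sum_congr rfl this, Finset.sum_comm]
      refine Finset.sum_congr rfl fun n _ => ?_
      rw [← Complex.conj_mul' (u n)]
      simp only [hu, map_sum, map_mul, Complex.conj_conj]
      rw [Finset.sum_mul_sum]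
      refine Finset.sum_congr rfl fun i _ => Finset.sum_congr rfl fun j _ => by ring
    have h5 : ∑ n ∈ s, ‖u n‖ ^ 2 ≤ ∑ i ∈ t, ∑ j ∈ t, ‖S i‖ * ‖S j‖ * ‖K i j‖ := by
      have h6 : ‖((∑ n ∈ s, ‖u n‖ ^ 2 : ℝ) : ℂ)‖ = ∑ n ∈ s, ‖u n‖ ^ 2 := by
        rw [norm_real, Real.norm_of_nonneg (Finset.sum_nonneg fun i _ => by positivity)]
      rw [← h6, h4]
      refine (norm_sum_le _ _).trans (Finset.sum_le_sum fun i _ => (norm_sum_le _ _).trans ?_)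
      simp
    have h7 : ∑ i ∈ t, ∑ j ∈ t, ‖S i‖ * ‖S j‖ * ‖K i j‖ ≤
        ∑ i ∈ t, ∑ j ∈ t, (‖S i‖ ^ 2 / 2 * ‖K i j‖ + ‖S j‖ ^ 2 / 2 * ‖K j i‖) := by
      refine Finset.sum_le_sum fun i _ => Finset.sum_le_sum fun j _ => ?_
      rw [← hKs i j, ← add_mul]
      gcongr
      nlinarith [sq_nonneg (‖S i‖ - ‖S j‖)]
    have h8 : ∑ i ∈ t, ∑ j ∈ t, ‖S i‖ ^ 2 / 2 * ‖K i j‖ ≤ D * X / 2 := by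
      have : D * X / 2 = ∑ i ∈ t, ‖S i‖ ^ 2 / 2 * D := by
        rw [← Finset.sum_mul, ← Finset.sum_div, ← hX]
        ring
      rw [this]
      refine Finset.sum_le_sum fun i hi => ?_
      rw [← Finset.mul_sum]
      gcongr
      exact hD i hi
    simp only [Finset.sum_add_distrib] at h7
    rw [Finset.sum_comm (f := fun i j => ‖S j‖ ^ 2 / 2 * ‖K j i‖)] at h7
    linarith
  have h4 : X ^ 2 ≤ A * (D * X) := h2.trans (by gcongr)
  rcases hX0.eq_or_lt with h | h
  · rw [← h]
    positivity
  · nlinarith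

lemma norm_geom_sum_exp_le (N : ℕ) {f : ℝ} (hf0 : 0 < f) (hf1 : f < 1) :
    ‖∑ n ∈ Finset.range N, cexp (2 * Real.pi * I * f) ^ n‖ ≤ 1 / (2 * f) + 1 / (2 * (1 - f)) := by
  set z := cexp (2 * Real.pi * I * f) with hz
  have hz1 : ‖z‖ = 1 := by
    rw [hz, Complex.norm_exp]
    simp
  have hsub : ‖z - 1‖ = 2 * Real.sin (Real.pi * f) := by
    have := Complex.norm_exp_I_mul_ofReal_sub_one (2 * Real.pi * f)
    rw [show I * ((2 * Real.pi * f : ℝ) : ℂ) = 2 * Real.pi * I * f by push_cast; ring] at this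
    rw [hz, this, Real.norm_of_nonneg]
    · congr 2
      ring
    · have := Real.sin_nonneg_of_nonneg_of_le_pi (x := 2 * Real.pi * f / 2)
        (by positivity) (by nlinarith [Real.pi_pos])
      positivity
  have hpi := Real.pi_pos
  have key : ∀ g : ℝ, 0 < g → g ≤ 1 / 2 → Real.sin (Real.pi * f) = Real.sin (Real.pi * g) →
      ‖∑ n ∈ Finset.range N, z ^ n‖ ≤ 1 / (2 * g) := by
    intro g hg hg1 hfg
    have h1 : 2 * g ≤ Real.sin (Real.pi * g) := by
      have := Real.mul_le_sin (x := Real.pi * g) (by positivity) (by nlinarith)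
      rwa [show 2 / Real.pi * (Real.pi * g) = 2 * g by field_simp] at this
    have hne : z ≠ 1 := by
      intro h
      rw [h, sub_self, norm_zero, hfg] at hsub
      linarith
    rw [geom_sum_eq hne, norm_div, hsub, hfg, div_le_div_iff₀ (by linarith) (by positivity)]
    have h2 : ‖z ^ N - 1‖ ≤ 2 := by
      refine (norm_sub_le _ _).trans ?_
      rw [norm_pow, hz1]
      norm_num
    nlinarith
  rcases le_total f (1 / 2) with h | h
  · refine (key f hf0 h rfl).trans ?_
    have : 0 ≤ 1 / (2 * (1 - f)) := by
      have : 0 < 1 - f := by linarith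
      positivity
    linarith
  · refine (key (1 - f) (by linarith) (by linarith) ?_).trans ?_
    · rw [mul_sub, mul_one, Real.sin_pi_sub]
    · have : 0 ≤ 1 / (2 * f) := by positivity
      linarith

lemma norm_geom_sum_exp_le_natCast (N : ℕ) (f : ℝ) :
    ‖∑ n ∈ Finset.range N, cexp (2 * Real.pi * I * f) ^ n‖ ≤ N := by
  refine (norm_sum_le _ _).trans (le_of_eq ?_)
  have hz1 : ‖cexp (2 * Real.pi * I * f)‖ = 1 := by
    rw [Complex.norm_exp]
    simp
  simp [hz1]

lemma sum_range_div_le (D : ℕ) (hD : 1 ≤ D) :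
    ∑ j ∈ Finset.range D, (D : ℝ) / (2 * j) ≤ D * (1 + Real.log D) / 2 := by
  have h1 : ∑ j ∈ Finset.range D, (D : ℝ) / (2 * j) = D / 2 * ∑ j ∈ Finset.range D, (j : ℝ)⁻¹ := by
    rw [Finset.mul_sum]
    refine Finset.sum_congr rfl fun j _ => ?_
    rw [div_mul_eq_div_div, div_eq_mul_inv]
  have h2 : ∑ j ∈ Finset.range D, (j : ℝ)⁻¹ ≤ 1 + Real.log D := by
    obtain ⟨m, rfl⟩ : ∃ m, D = m + 1 := ⟨D - 1, by omega⟩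
    rw [Finset.sum_range_succ']
    have h3 := harmonic_le_one_add_log m
    rw [harmonic] at h3
    push_cast at h3 ⊢
    simp only [inv_zero, add_zero]
    refine h3.trans ?_
    rcases Nat.eq_zero_or_pos m with rfl | hm
    · simp
    · have hm' : (0 : ℝ) < m := by exact_mod_cast hm
      have := Real.log_le_log hm' (by linarith : (m : ℝ) ≤ m + 1)
      linarith
  rw [h1]
  have : (0 : ℝ) ≤ D / 2 := by positivity
  nlinarith

lemma sum_norm_geom_sum_le {κ : Type*} (t : Finset κ) (x : κ → ℝ) (D : ℕ) (hD : 1 ≤ D)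
    (hx : ∀ i ∈ t, ∀ j ∈ t, i ≠ j → ∀ k : ℤ, 1 / (D : ℝ) ≤ |x i - x j - k|) (N : ℕ) (y : ℝ) :
    ∑ j ∈ t, ‖∑ n ∈ Finset.range N, cexp (2 * Real.pi * I * (x j - y : ℝ)) ^ n‖ ≤
      2 * N + D * (1 + Real.log D) := by
  classical
  have hD0 : (0 : ℝ) < D := by exact_mod_cast hD
  set f : κ → ℝ := fun j => Int.fract (x j - y) with hf
  set m : κ → ℕ := fun j => ⌊D * f j⌋₊ with hm
  set g : ℕ → ℝ := fun j => (if j = 0 then (N : ℝ) else 0) + (if j = D - 1 then (N : ℝ) else 0) +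
    (D : ℝ) / (2 * j) + (D : ℝ) / (2 * (D - 1 - j : ℕ)) with hg
  have hg0 : ∀ j, 0 ≤ g j := fun j => by positivity
  have hm1 : ∀ j, m j < D := fun j => by
    rw [hm]
    refine (Nat.floor_lt (by have := Int.fract_nonneg (x j - y); positivity)).2 ?_
    have := Int.fract_lt_one (x j - y)
    simp only [hf]
    nlinarith
  have hl : ∀ j, (m j : ℝ) ≤ D * f j := fun j =>
    Nat.floor_le (by have := Int.fract_nonneg (x j - y); positivity)
  have hu : ∀ j, D * f j < m j + 1 := fun j => Nat.lt_floor_add_one _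
  have hinj : Set.InjOn m t := by
    intro i hi j hj hij
    by_contra hne
    have h1 := hx i hi j hj hne (⌊x i - y⌋ - ⌊x j - y⌋)
    have h2 : x i - x j - ((⌊x i - y⌋ - ⌊x j - y⌋ : ℤ) : ℝ) = f i - f j := by
      simp only [hf, Int.fract]
      push_cast
      ring
    rw [h2, div_le_iff₀ hD0] at h1
    have h3 : |(f i - f j) * D| < 1 := by
      rw [abs_lt]
      have := hl i
      have := hl j
      have := hu i
      have := hu j
      rw [hij] at *
      constructor <;> nlinarith
    rw [abs_mul, abs_of_pos hD0] at h3
    linarith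
  have hK : ∀ j ∈ t, ‖∑ n ∈ Finset.range N, cexp (2 * Real.pi * I * (x j - y : ℝ)) ^ n‖ ≤
      g (m j) := by
    intro j _
    have he : cexp (2 * Real.pi * I * (x j - y : ℝ)) = cexp (2 * Real.pi * I * (f j : ℝ)) := by
      have h1 : x j - y = f j + ⌊x j - y⌋ := (Int.fract_add_floor _).symm
      rw [Complex.exp_eq_exp_iff_exists_int]
      refine ⟨⌊x j - y⌋, ?_⟩
      nth_rewrite 1 [h1]
      push_cast
      ring
    rw [he]
    have hN := norm_geom_sum_exp_le_natCast N (f j)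
    have p1 : 0 ≤ (D : ℝ) / (2 * m j) := by positivity
    have p2 : 0 ≤ (D : ℝ) / (2 * (D - 1 - m j : ℕ)) := by positivity
    by_cases h0 : m j = 0
    · refine hN.trans ?_
      have : 0 ≤ (if m j = D - 1 then (N : ℝ) else 0) := by positivity
      simp only [hg]
      rw [if_pos h0]
      linarith
    by_cases h1 : m j = D - 1
    · refine hN.trans ?_
      have : 0 ≤ (if m j = 0 then (N : ℝ) else 0) := by positivity
      simp only [hg]
      rw [if_pos h1]
      linarith
    have hmj : m j < D - 1 := by have := hm1 j; omega
    have hc : ((D - 1 - m j : ℕ) : ℝ) = D - 1 - m j := by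
      rw [Nat.cast_sub (by omega), Nat.cast_sub hD, Nat.cast_one]
    have hm0 : (0 : ℝ) < m j := by exact_mod_cast Nat.pos_of_ne_zero h0
    have hc0 : (0 : ℝ) < D - 1 - m j := by
      rw [← hc]; exact_mod_cast (by omega : 0 < D - 1 - m j)
    have hf0 : 0 < f j := by
      have := hl j
      by_contra! h
      nlinarith
    have hf1 : f j < 1 := Int.fract_lt_one _
    refine (norm_geom_sum_exp_le N hf0 hf1).trans ?_
    simp only [hg, h0, h1, if_false, zero_add]
    rw [hc]
    refine add_le_add ?_ ?_
    · rw [div_le_div_iff₀ (by linarith) (by linarith)]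
      linarith [hl j]
    · rw [div_le_div_iff₀ (by linarith) (by linarith)]
      linarith [hu j]
  refine (Finset.sum_le_sum hK).trans ?_
  rw [← Finset.sum_image (f := g) hinj]
  refine (Finset.sum_le_sum_of_subset_of_nonneg (t := Finset.range D) (fun n hn => ?_)
    fun n _ _ => hg0 n).trans ?_
  · obtain ⟨j, _, rfl⟩ := Finset.mem_image.1 hn
    exact Finset.mem_range.2 (hm1 j)
  simp only [hg, Finset.sum_add_distrib]
  have h1 := sum_range_div_le D hD
  have h2 := Finset.sum_range_reflect (fun j : ℕ => (D : ℝ) / (2 * j)) D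
  rw [h2]
  have h3 : ∑ j ∈ Finset.range D, (if j = 0 then (N : ℝ) else 0) ≤ N := by
    rw [Finset.sum_ite_eq' (Finset.range D) 0]
    split_ifs <;> simp
  have h4 : ∑ j ∈ Finset.range D, (if j = D - 1 then (N : ℝ) else 0) ≤ N := by
    rw [Finset.sum_ite_eq' (Finset.range D) (D - 1)]
    split_ifs <;> simp
  linarith

theorem additive_large_sieve {κ : Type*} (t : Finset κ) (x : κ → ℝ) (D : ℕ) (hD : 1 ≤ D)
    (hx : ∀ i ∈ t, ∀ j ∈ t, i ≠ j → ∀ k : ℤ, 1 / (D : ℝ) ≤ |x i - x j - k|) (N : ℕ) (a : ℕ → ℂ) :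
    ∑ i ∈ t, ‖∑ n ∈ Finset.range N, a n * cexp (2 * Real.pi * I * x i) ^ n‖ ^ 2 ≤
      (2 * N + D * (1 + Real.log D)) * ∑ n ∈ Finset.range N, ‖a n‖ ^ 2 := by
  refine sum_norm_sq_le_of_row_sum_le _ t (fun i n => cexp (2 * Real.pi * I * x i) ^ n) a ?_
    fun i _ => ?_
  · have := Real.log_natCast_nonneg D
    positivity
  refine le_trans (le_of_eq ?_) (sum_norm_geom_sum_le t x D hD hx N (x i))
  refine Finset.sum_congr rfl fun j _ => ?_
  congr 1
  refine Finset.sum_congr rfl fun n _ => ?_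
  rw [map_pow, ← mul_pow, ← Complex.exp_conj, ← Complex.exp_add]
  congr 2
  simp [map_ofNat]
  ring

open Classical in
noncomputable def primitiveCharacters (q : ℕ) : Finset (DirichletCharacter ℂ q) :=
  Finset.univ.filter fun χ => χ.IsPrimitive

lemma mem_primitiveCharacters {q : ℕ} {χ : DirichletCharacter ℂ q} :
    χ ∈ primitiveCharacters q ↔ χ.IsPrimitive := by
  simp [primitiveCharacters]

lemma DirichletCharacter.conj_apply {q : ℕ} (χ : DirichletCharacter ℂ q) (a : ZMod q) :
    (starRingEnd ℂ) (χ a) = χ⁻¹ a := by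
  exact MulChar.star_apply' χ a

lemma sum_norm_sq_sum_mul_char {q : ℕ} [NeZero q] (f : ZMod q → ℂ) :
    ∑ χ : DirichletCharacter ℂ q, ‖∑ b : ZMod q, f b * χ b‖ ^ 2 =
      q.totient * ∑ b : (ZMod q)ˣ, ‖f b‖ ^ 2 := by
  have hsum : ∀ χ : DirichletCharacter ℂ q, ∑ b : ZMod q, f b * χ b =
      ∑ b : (ZMod q)ˣ, f b * χ b := by
    intro χ
    refine (Finset.sum_of_injOn (fun u : (ZMod q)ˣ => (u : ZMod q)) (fun u _ v _ h => Units.ext h)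
      (fun _ _ => Finset.mem_univ _) (fun b _ hb => ?_) fun _ _ => rfl).symm
    rw [χ.map_nonunit, mul_zero]
    rintro ⟨u, rfl⟩
    exact hb ⟨u, by simp⟩
  have key : ((∑ χ : DirichletCharacter ℂ q, ‖∑ b : ZMod q, f b * χ b‖ ^ 2 : ℝ) : ℂ) =
      ((q.totient * ∑ b : (ZMod q)ˣ, ‖f b‖ ^ 2 : ℝ) : ℂ) := by
    push_cast
    have h1 : ∀ χ : DirichletCharacter ℂ q, (‖∑ b : ZMod q, f b * χ b‖ : ℂ) ^ 2 =
        ∑ c : (ZMod q)ˣ, ∑ b : (ZMod q)ˣ, (starRingEnd ℂ) (f c) * f b * (χ (c : ZMod q)⁻¹ * χ b) := by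
      intro χ
      rw [hsum, ← Complex.conj_mul', map_sum, Finset.sum_mul_sum]
      refine Finset.sum_congr rfl fun c _ => Finset.sum_congr rfl fun b _ => ?_
      rw [map_mul, DirichletCharacter.conj_apply, MulChar.inv_apply, Ring.inverse_unit,
        ZMod.inv_coe_unit]
      ring
    simp only [h1]
    rw [Finset.sum_comm, Finset.mul_sum]
    refine Finset.sum_congr rfl fun c _ => ?_
    rw [Finset.sum_comm]
    simp only [← Finset.mul_sum, DirichletCharacter.sum_char_inv_mul_char_eq ℂ c.isUnit]
    rw [Finset.sum_eq_single c]
    · rw [if_pos rfl, ← Complex.conj_mul']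
      ring
    · intro b _ hb
      rw [if_neg, mul_zero]
      exact fun h => hb (Units.ext h.symm)
    · simp
  exact_mod_cast key

lemma norm_stdAddChar {q : ℕ} [NeZero q] (b : ZMod q) : ‖(ZMod.stdAddChar b : ℂ)‖ = 1 := by
  rw [ZMod.stdAddChar_apply, Circle.norm_coe]

lemma sum_norm_sq_sum_mul_stdAddChar {q : ℕ} [NeZero q] (f : ZMod q → ℂ) :
    ∑ a : ZMod q, ‖∑ b : ZMod q, f b * ZMod.stdAddChar (a * b)‖ ^ 2 = q * ∑ b : ZMod q, ‖f b‖ ^ 2 := by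
  have key : ((∑ a : ZMod q, ‖∑ b : ZMod q, f b * ZMod.stdAddChar (a * b)‖ ^ 2 : ℝ) : ℂ) =
      ((q * ∑ b : ZMod q, ‖f b‖ ^ 2 : ℝ) : ℂ) := by
    push_cast
    have h1 : ∀ a : ZMod q, (‖∑ b : ZMod q, f b * ZMod.stdAddChar (a * b)‖ : ℂ) ^ 2 =
        ∑ c : ZMod q, ∑ b : ZMod q, (starRingEnd ℂ) (f c) * f b * ZMod.stdAddChar (a * (b - c)) := by
      intro a
      rw [← Complex.conj_mul', map_sum, Finset.sum_mul_sum]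
      refine Finset.sum_congr rfl fun c _ => Finset.sum_congr rfl fun b _ => ?_
      rw [map_mul, ← AddChar.map_neg_eq_conj, mul_sub, sub_eq_neg_add, AddChar.map_add_eq_mul]
      ring
    simp only [h1]
    rw [Finset.sum_comm, Finset.mul_sum]
    refine Finset.sum_congr rfl fun c _ => ?_
    rw [Finset.sum_comm]
    simp only [← Finset.mul_sum, AddChar.sum_mulShift _ (ZMod.isPrimitive_stdAddChar q)]
    rw [Finset.sum_eq_single c]
    · rw [sub_self, if_pos rfl, ← Complex.conj_mul', ZMod.card]
      ring
    · intro b _ hb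
      rw [if_neg (sub_ne_zero.2 hb)]
      simp
    · simp
  exact_mod_cast key

lemma sum_norm_sq_char {q : ℕ} [NeZero q] (χ : DirichletCharacter ℂ q) :
    ∑ b : ZMod q, ‖χ b‖ ^ 2 = q.totient := by
  have h : ∑ b : ZMod q, ‖χ b‖ ^ 2 = ∑ b : (ZMod q)ˣ, (1 : ℝ) := by
    refine (Finset.sum_of_injOn (fun u : (ZMod q)ˣ => (u : ZMod q)) (fun u _ v _ h => Units.ext h)
      (fun _ _ => Finset.mem_univ _) (fun b _ hb => ?_) fun u _ => ?_).symm
    · rw [χ.map_nonunit]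
      · simp
      · rintro ⟨u, rfl⟩
        exact hb ⟨u, by simp⟩
    · simp [χ.unit_norm_eq_one u]
  rw [h]
  simp [ZMod.card_units_eq_totient]

lemma norm_gaussSum_sq {q : ℕ} [NeZero q] {χ : DirichletCharacter ℂ q} (hχ : χ.IsPrimitive) :
    ‖gaussSum χ ZMod.stdAddChar‖ ^ 2 = q := by
  have h1 := sum_norm_sq_sum_mul_stdAddChar (q := q) fun b => χ b
  have h2 : ∀ a : ZMod q, ∑ b : ZMod q, χ b * ZMod.stdAddChar (a * b) =
      χ⁻¹ a * gaussSum χ ZMod.stdAddChar := by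
    intro a
    rw [← gaussSum_mulShift_of_isPrimitive _ hχ, gaussSum]
    rfl
  simp only [h2, norm_mul, mul_pow] at h1
  rw [← Finset.sum_mul, sum_norm_sq_char, sum_norm_sq_char, mul_comm] at h1
  have : (0 : ℝ) < q.totient := by exact_mod_cast Nat.totient_pos.2 (NeZero.pos q)
  exact mul_right_cancel₀ this.ne' h1

lemma mul_sum_primitive_le {q : ℕ} [NeZero q] (s : Finset ℕ) (a : ℕ → ℂ) :
    (q : ℝ) * ∑ χ ∈ primitiveCharacters q, ‖∑ n ∈ s, a n * χ n‖ ^ 2 ≤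
      q.totient * ∑ b : (ZMod q)ˣ,
        ‖∑ n ∈ s, (starRingEnd ℂ) (a n) * ZMod.stdAddChar (b * n : ZMod q)‖ ^ 2 := by
  rw [← sum_norm_sq_sum_mul_char fun b : ZMod q =>
    ∑ n ∈ s, (starRingEnd ℂ) (a n) * ZMod.stdAddChar (b * n : ZMod q), Finset.mul_sum]
  refine le_trans (Finset.sum_le_sum fun χ hχ => ?_)
    (Finset.sum_le_univ_sum_of_nonneg (s := primitiveCharacters q) fun χ => by positivity)
  have hp := mem_primitiveCharacters.1 hχ
  rw [← norm_gaussSum_sq hp, ← mul_pow, ← Complex.norm_conj (∑ n ∈ s, a n * χ n), ← norm_mul]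
  refine le_of_eq ?_
  congr 2
  simp only [map_sum, map_mul, DirichletCharacter.conj_apply, Finset.mul_sum, Finset.sum_mul]
  rw [Finset.sum_comm]
  refine Finset.sum_congr rfl fun n _ => ?_
  have h2 := gaussSum_mulShift_of_isPrimitive (ZMod.stdAddChar (N := q)) hp (n : ZMod q)
  rw [mul_left_comm, mul_comm (gaussSum _ _), ← h2, gaussSum, Finset.mul_sum]
  refine Finset.sum_congr rfl fun b _ => ?_
  rw [AddChar.mulShift_apply, mul_comm (n : ZMod q)]
  ring

lemma sum_units_eq_sum_coprime {q : ℕ} [NeZero q] (F : ℕ → ℝ) :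
    ∑ b : (ZMod q)ˣ, F (b : ZMod q).val = ∑ b ∈ (Finset.range q).filter (Nat.Coprime · q), F b := by
  refine Finset.sum_bij (fun b _ => (b : ZMod q).val) (fun b _ => ?_) (fun b _ c _ h => ?_)
    (fun b hb => ?_) fun _ _ => rfl
  · rw [Finset.mem_filter, Finset.mem_range]
    exact ⟨ZMod.val_lt _, ZMod.val_coe_unit_coprime b⟩
  · exact Units.ext (ZMod.val_injective q h)
  · rw [Finset.mem_filter, Finset.mem_range] at hb
    exact ⟨ZMod.unitOfCoprime b hb.2, Finset.mem_univ _, by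
      simp [ZMod.val_natCast_of_lt hb.1]⟩

lemma stdAddChar_mul_natCast {q : ℕ} [NeZero q] (b : ZMod q) (n : ℕ) :
    (ZMod.stdAddChar (b * n : ZMod q) : ℂ) = cexp (2 * Real.pi * I * ((b.val / q : ℝ) : ℂ)) ^ n := by
  have h1 : b * n = n • b := by simp [mul_comm]
  rw [h1, AddChar.map_nsmul_eq_pow]
  congr 1
  have h2 : b = ((b.val : ℤ) : ZMod q) := by simp
  nth_rewrite 1 [h2]
  rw [ZMod.stdAddChar_coe]
  congr 1
  push_cast
  ring

lemma one_div_le_abs_farey {Q q r b c : ℕ} (hq : 1 ≤ q) (hr : 1 ≤ r) (hqQ : q ≤ Q) (hrQ : r ≤ Q)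
    (hb : b < q) (hc : c < r) (hbq : b.Coprime q) (hcr : c.Coprime r) (hne : ¬ (q = r ∧ b = c))
    (k : ℤ) : 1 / ((Q ^ 2 : ℕ) : ℝ) ≤ |(b / q : ℝ) - c / r - k| := by
  have hq0 : (0 : ℝ) < q := by exact_mod_cast hq
  have hr0 : (0 : ℝ) < r := by exact_mod_cast hr
  have hQ0 : (0 : ℝ) < Q := by exact_mod_cast hq.trans hqQ
  have e : (b / q : ℝ) - c / r - k = ((b * r - c * q - k * (q * r) : ℤ) : ℝ) / (q * r) := by
    push_cast
    field_simp
  have hint : (b * r - c * q - k * (q * r) : ℤ) ≠ 0 := by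
    intro h
    have hx : (b / q : ℝ) - c / r - k = 0 := by rw [e, h]; simp
    have h1 : (b / q : ℝ) < 1 := (div_lt_one hq0).2 (by exact_mod_cast hb)
    have h2 : (c / r : ℝ) < 1 := (div_lt_one hr0).2 (by exact_mod_cast hc)
    have h3 : (0 : ℝ) ≤ b / q := by positivity
    have h4 : (0 : ℝ) ≤ c / r := by positivity
    have k1 : (k : ℝ) < 1 := by linarith
    have k2 : (-1 : ℝ) < k := by linarith
    have k1' : k < 1 := by exact_mod_cast k1
    have k2' : -1 < k := by exact_mod_cast k2
    have k0 : k = 0 := by omega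
    subst k0
    have h5 : b * r = c * q := by
      have : (b * r : ℤ) = c * q := by linarith
      exact_mod_cast this
    have d1 : q ∣ r := hbq.symm.dvd_of_dvd_mul_left (h5 ▸ Dvd.intro_left c rfl)
    have d2 : r ∣ q := hcr.symm.dvd_of_dvd_mul_left (h5 ▸ Dvd.intro_left b rfl)
    have hqr := Nat.dvd_antisymm d1 d2
    subst hqr
    exact hne ⟨rfl, Nat.eq_of_mul_eq_mul_right (by omega) h5⟩
  have h1 : (1 : ℝ) ≤ |((b * r - c * q - k * (q * r) : ℤ) : ℝ)| := by
    exact_mod_cast Int.one_le_abs hint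
  rw [e, abs_div, abs_of_pos (mul_pos hq0 hr0)]
  have h2 : (q * r : ℝ) ≤ (Q ^ 2 : ℕ) := by
    rw [pow_two]
    exact_mod_cast Nat.mul_le_mul hqQ hrQ
  exact div_le_div₀ (abs_nonneg _) h1 (by positivity) h2

theorem large_sieve (Q N : ℕ) (hQ : 1 ≤ Q) (a : ℕ → ℂ) :
    ∑ q ∈ Finset.Icc 1 Q, (q / q.totient : ℝ) * ∑ χ ∈ primitiveCharacters q,
        ‖∑ n ∈ Finset.range N, a n * χ n‖ ^ 2 ≤
      (2 * N + Q ^ 2 * (1 + 2 * Real.log Q)) * ∑ n ∈ Finset.range N, ‖a n‖ ^ 2 := by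
  set G : ℝ → ℝ := fun x =>
    ‖∑ n ∈ Finset.range N, (starRingEnd ℂ) (a n) * cexp (2 * Real.pi * I * x) ^ n‖ ^ 2 with hG
  have h1 : ∀ q ∈ Finset.Icc 1 Q, (q / q.totient : ℝ) * ∑ χ ∈ primitiveCharacters q,
      ‖∑ n ∈ Finset.range N, a n * χ n‖ ^ 2 ≤
        ∑ b ∈ (Finset.range q).filter (Nat.Coprime · q), G (b / q) := by
    intro q hq
    rw [Finset.mem_Icc] at hq
    have : NeZero q := ⟨by omega⟩
    have ht : (0 : ℝ) < q.totient := by exact_mod_cast Nat.totient_pos.2 (NeZero.pos q)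
    have h2 := mul_sum_primitive_le (q := q) (Finset.range N) a
    rw [div_mul_eq_mul_div, div_le_iff₀ ht, mul_comm _ (q.totient : ℝ)]
    refine h2.trans (le_of_eq ?_)
    rw [← sum_units_eq_sum_coprime fun b => G (b / q)]
    congr 1
    refine Finset.sum_congr rfl fun b _ => ?_
    simp only [hG, stdAddChar_mul_natCast]
  refine (Finset.sum_le_sum h1).trans ?_
  rw [Finset.sum_sigma' (Finset.Icc 1 Q) (fun q => (Finset.range q).filter (Nat.Coprime · q))
    fun q b => G (b / q)]
  have h3 := additive_large_sieve ((Finset.Icc 1 Q).sigma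
    fun q => (Finset.range q).filter (Nat.Coprime · q)) (fun p => (p.2 / p.1 : ℝ)) (Q ^ 2)
    (Nat.one_le_pow _ _ hQ) (fun p hp r hr hne k => ?_) N fun n => (starRingEnd ℂ) (a n)
  · simp only [Complex.norm_conj] at h3
    push_cast [Real.log_pow] at h3
    refine le_trans (le_of_eq ?_) h3
    simp [hG]
  · simp only [Finset.mem_sigma, Finset.mem_Icc, Finset.mem_filter, Finset.mem_range] at hp hr
    refine one_div_le_abs_farey hp.1.1 hr.1.1 hp.1.2 hr.1.2 hp.2.1 hr.2.1 hp.2.2 hr.2.2 ?_ k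
    rintro ⟨h4, h5⟩
    exact hne (Sigma.ext h4 (heq_of_eq h5))

lemma sum_zmod_val_eq_sum_range {q : ℕ} [NeZero q] (F : ℕ → ℝ) :
    ∑ b : ZMod q, F b.val = ∑ b ∈ Finset.range q, F b :=
  Finset.sum_bij (fun b _ => b.val) (fun b _ => Finset.mem_range.2 (ZMod.val_lt b))
    (fun _ _ _ _ h => ZMod.val_injective q h) (fun b hb => ⟨b, Finset.mem_univ _,
      ZMod.val_natCast_of_lt (Finset.mem_range.1 hb)⟩) fun _ _ => rfl

theorem polya_vinogradov {q : ℕ} (hq : 2 ≤ q) {χ : DirichletCharacter ℂ q} (hχ : χ.IsPrimitive)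
    (M : ℕ) : ‖∑ n ∈ Finset.range M, χ n‖ ≤ √q * (1 + Real.log q) := by
  have : NeZero q := ⟨by omega⟩
  have hq0 : (0 : ℝ) < q := by exact_mod_cast (by omega : 0 < q)
  have h1 : (∑ n ∈ Finset.range M, (starRingEnd ℂ) (χ n)) * gaussSum χ ZMod.stdAddChar =
      ∑ b : (ZMod q), χ b * ∑ n ∈ Finset.range M, cexp (2 * Real.pi * I * ((b.val / q : ℝ) : ℂ)) ^ n := by
    simp only [DirichletCharacter.conj_apply, Finset.mul_sum, Finset.sum_mul]
    rw [Finset.sum_comm]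
    refine Finset.sum_congr rfl fun n _ => ?_
    rw [← gaussSum_mulShift_of_isPrimitive _ hχ, gaussSum]
    refine Finset.sum_congr rfl fun b _ => ?_
    rw [← stdAddChar_mul_natCast, AddChar.mulShift_apply, mul_comm b]
  have h2 : ‖∑ b : (ZMod q), χ b * ∑ n ∈ Finset.range M,
      cexp (2 * Real.pi * I * ((b.val / q : ℝ) : ℂ)) ^ n‖ ≤ q * (1 + Real.log q) := by
    refine (norm_sum_le _ _).trans ?_
    have h3 : ∀ b : ZMod q, ‖χ b * ∑ n ∈ Finset.range M,
        cexp (2 * Real.pi * I * ((b.val / q : ℝ) : ℂ)) ^ n‖ ≤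
          (q : ℝ) / (2 * b.val) + (q : ℝ) / (2 * (q - b.val : ℕ)) := by
      intro b
      rcases eq_or_ne b 0 with rfl | hb
      · have : Nontrivial (ZMod q) := ZMod.nontrivial_iff.2 (by omega)
        rw [χ.map_zero]
        simp
        positivity
      · rw [norm_mul]
        refine (mul_le_of_le_one_left (norm_nonneg _) (χ.norm_le_one _)).trans ?_
        have hb0 : 0 < b.val := Nat.pos_of_ne_zero fun h => hb ((ZMod.val_eq_zero b).1 h)
        have hb1 : b.val < q := ZMod.val_lt b
        have hb0' : (0 : ℝ) < b.val := by exact_mod_cast hb0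
        have hb1' : (b.val : ℝ) < q := by exact_mod_cast hb1
        refine (norm_geom_sum_exp_le M (f := b.val / q) (by positivity)
          ((div_lt_one hq0).2 hb1')).trans (le_of_eq ?_)
        rw [Nat.cast_sub hb1.le]
        have : (q : ℝ) - b.val ≠ 0 := by linarith
        have h5 : (1 : ℝ) - b.val / q ≠ 0 := by
          rw [sub_ne_zero, ne_eq, eq_div_iff hq0.ne']
          intro h
          linarith
        field_simp
    refine (Finset.sum_le_sum fun b _ => h3 b).trans ?_
    rw [sum_zmod_val_eq_sum_range fun b => ((q : ℝ) / (2 * b) + (q : ℝ) / (2 * (q - b : ℕ))),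
      Finset.sum_add_distrib]
    have h5 := sum_range_div_le q (by omega)
    have h6 : ∑ b ∈ Finset.range q, (q : ℝ) / (2 * (q - b : ℕ)) ≤ q * (1 + Real.log q) / 2 := by
      have h7 : ∑ b ∈ Finset.range q, (q : ℝ) / (2 * (q - b : ℕ)) =
          q / 2 * ∑ b ∈ Finset.range q, ((b + 1 : ℕ) : ℝ)⁻¹ := by
        rw [← Finset.sum_range_reflect, Finset.mul_sum]
        refine Finset.sum_congr rfl fun b hb => ?_
        rw [Finset.mem_range] at hb
        rw [show q - (q - 1 - b) = b + 1 by omega, div_mul_eq_div_div, div_eq_mul_inv]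
      have h8 := harmonic_le_one_add_log q
      rw [harmonic] at h8
      push_cast at h8
      rw [h7]
      push_cast
      nlinarith
    linarith
  rw [← h1, norm_mul, ← map_sum, Complex.norm_conj] at h2
  have hg : ‖gaussSum χ ZMod.stdAddChar‖ = √q := by
    rw [← norm_gaussSum_sq hχ, Real.sqrt_sq (norm_nonneg _)]
  rw [hg] at h2
  have hs : 0 < √(q : ℝ) := Real.sqrt_pos.2 hq0
  refine le_of_mul_le_mul_right (h2.trans (le_of_eq ?_)) hs
  nth_rewrite 1 [← Real.mul_self_sqrt hq0.le]
  ring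

lemma exists_fourier_truncation (P : ℕ) [NeZero P] :
    ∃ (w : ZMod P → ℝ) (c : ZMod P → ℕ → ℂ) (e : ZMod P → ℕ → ℂ),
      (∀ h, ∀ u ≤ P, ‖c h u‖ ≤ w h) ∧ (∀ h n, ‖e h n‖ = 1) ∧ (∑ h, w h ≤ 2 + Real.log P) ∧
      ∀ u ≤ P, ∀ n < P, (if n < u then (1 : ℂ) else 0) = ∑ h, c h u * e h n := by
  have hP : 1 ≤ P := NeZero.one_le
  have hP0 : (0 : ℝ) < P := by exact_mod_cast hP
  set S : ZMod P → ℕ → ℂ := fun h u => ∑ l ∈ Finset.range u, ZMod.stdAddChar (h * l : ZMod P) with hS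
  refine ⟨fun h => (if h.val = 0 then 1 else 0) + (1 / (2 * h.val) + 1 / (2 * (P - h.val : ℕ))),
    fun h u => (starRingEnd ℂ) (S h u) / P, fun h n => ZMod.stdAddChar (h * n : ZMod P),
    fun h u hu => ?_, fun h n => norm_stdAddChar _, ?_, fun u hu n hn => ?_⟩
  · rw [norm_div, Complex.norm_conj, Complex.norm_natCast, div_le_iff₀ hP0]
    have hp : (0 : ℝ) ≤ 1 / (2 * h.val) + 1 / (2 * (P - h.val : ℕ)) := by positivity
    simp only [hS, stdAddChar_mul_natCast]
    by_cases h0 : h.val = 0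
    · refine (norm_geom_sum_exp_le_natCast u _).trans ?_
      rw [if_pos h0]
      have : (u : ℝ) ≤ P := by exact_mod_cast hu
      nlinarith
    · rw [if_neg h0]
      have hb0' : (0 : ℝ) < h.val := by exact_mod_cast Nat.pos_of_ne_zero h0
      have hb1 := ZMod.val_lt h
      have hb1' : (h.val : ℝ) < P := by exact_mod_cast hb1
      refine (norm_geom_sum_exp_le u (f := h.val / P) (by positivity)
        ((div_lt_one hP0).2 hb1')).trans (le_of_eq ?_)
      rw [Nat.cast_sub hb1.le]
      have : (P : ℝ) - h.val ≠ 0 := by linarith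
      have h5 : (1 : ℝ) - h.val / P ≠ 0 := by
        rw [sub_ne_zero, ne_eq, eq_div_iff hP0.ne']
        intro h
        linarith
      field_simp
      ring
  · rw [sum_zmod_val_eq_sum_range fun n => (if n = 0 then (1 : ℝ) else 0) +
      (1 / (2 * n) + 1 / (2 * (P - n : ℕ))), Finset.sum_add_distrib, Finset.sum_add_distrib,
      Finset.sum_ite_eq', if_pos (Finset.mem_range.2 hP)]
    have h5 := sum_range_div_le P hP
    have h5' : ∑ j ∈ Finset.range P, (P : ℝ) / (2 * j) =
        P * ∑ j ∈ Finset.range P, (1 : ℝ) / (2 * j) := by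
      rw [Finset.mul_sum]
      exact Finset.sum_congr rfl fun b _ => by rw [mul_one_div]
    rw [h5', mul_div_assoc] at h5
    have h6 := le_of_mul_le_mul_left h5 hP0
    have h7 : ∑ b ∈ Finset.range P, (1 : ℝ) / (2 * (P - b : ℕ)) =
        1 / 2 * ∑ b ∈ Finset.range P, ((b + 1 : ℕ) : ℝ)⁻¹ := by
      rw [← Finset.sum_range_reflect, Finset.mul_sum]
      refine Finset.sum_congr rfl fun b hb => ?_
      rw [Finset.mem_range] at hb
      rw [show P - (P - 1 - b) = b + 1 by omega, div_mul_eq_div_div, div_eq_mul_inv]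
    have h8 := harmonic_le_one_add_log P
    rw [harmonic] at h8
    push_cast at h8 h7
    rw [h7]
    linarith
  · have h1 : ∀ h : ZMod P, (starRingEnd ℂ) (S h u) / P * ZMod.stdAddChar (h * n : ZMod P) =
        ∑ l ∈ Finset.range u, (1 / P : ℂ) * ZMod.stdAddChar (h * (n - l) : ZMod P) := by
      intro h
      rw [hS, map_sum, Finset.sum_div, Finset.sum_mul]
      refine Finset.sum_congr rfl fun l _ => ?_
      rw [← AddChar.map_neg_eq_conj, mul_sub, sub_eq_neg_add, AddChar.map_add_eq_mul]
      ring
    simp only [h1]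
    rw [Finset.sum_comm]
    simp only [← Finset.mul_sum, AddChar.sum_mulShift _ (ZMod.isPrimitive_stdAddChar P), sub_eq_zero]
    have h2 : ∀ l ∈ Finset.range u, (1 / P : ℂ) * ((if (n : ZMod P) = (l : ZMod P) then
        Fintype.card (ZMod P) else 0 : ℕ) : ℂ) = if n = l then 1 else 0 := by
      intro l hl
      rw [Finset.mem_range] at hl
      have h3 : ((n : ZMod P) = (l : ZMod P)) ↔ n = l := by
        rw [ZMod.natCast_eq_natCast_iff', Nat.mod_eq_of_lt hn, Nat.mod_eq_of_lt (by omega)]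
      simp only [h3, ZMod.card]
      split_ifs
      · have : (P : ℂ) ≠ 0 := by exact_mod_cast hP0.ne'
        field_simp
      · simp
    rw [Finset.mul_sum, Finset.sum_congr rfl h2, Finset.sum_ite_eq]
    simp

lemma sum_primitive_mul_le_sqrt_mul_sqrt (s : Finset ℕ) (v : ℕ → ℝ) (hv : ∀ q, 0 ≤ v q)
    (A B : ∀ q : ℕ, DirichletCharacter ℂ q → ℝ) :
    ∑ q ∈ s, v q * ∑ χ ∈ primitiveCharacters q, A q χ * B q χ ≤
      √(∑ q ∈ s, v q * ∑ χ ∈ primitiveCharacters q, A q χ ^ 2) *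
        √(∑ q ∈ s, v q * ∑ χ ∈ primitiveCharacters q, B q χ ^ 2) := by
  simp only [Finset.mul_sum, Finset.sum_sigma']
  refine le_trans (le_of_eq ?_) ((Real.sum_mul_le_sqrt_mul_sqrt (s.sigma fun q => primitiveCharacters q)
    (fun p => √(v p.1) * A p.1 p.2) (fun p => √(v p.1) * B p.1 p.2)).trans (le_of_eq ?_))
  · refine Finset.sum_congr rfl fun p _ => ?_
    nth_rewrite 1 [← Real.mul_self_sqrt (hv p.1)]
    ring
  · simp only [mul_pow, Real.sq_sqrt (hv _)]

theorem bilinear_large_sieve (Q M N : ℕ) (hQ : 1 ≤ Q) (hN : 1 ≤ N) (a b : ℕ → ℂ) (u : ℕ → ℕ)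
    (hu : ∀ m, u m ≤ N) :
    ∑ q ∈ Finset.Icc 1 Q, (q / q.totient : ℝ) * ∑ χ ∈ primitiveCharacters q,
        ‖∑ m ∈ Finset.range M, ∑ n ∈ Finset.range N,
          if n < u m then a m * b n * (χ m * χ n) else 0‖ ≤
      (2 + Real.log N) *
        (√((2 * M + Q ^ 2 * (1 + 2 * Real.log Q)) * ∑ m ∈ Finset.range M, ‖a m‖ ^ 2) *
          √((2 * N + Q ^ 2 * (1 + 2 * Real.log Q)) * ∑ n ∈ Finset.range N, ‖b n‖ ^ 2)) := by
  have : NeZero N := ⟨by omega⟩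
  obtain ⟨w, c, e, hc, he, hw, hce⟩ := exists_fourier_truncation N
  have hw0 : ∀ h, 0 ≤ w h := fun h => (norm_nonneg _).trans (hc h 0 (Nat.zero_le _))
  set T : ℝ := Q ^ 2 * (1 + 2 * Real.log Q) with hT
  have hT0 : 0 ≤ T := by
    have := Real.log_natCast_nonneg Q
    positivity
  set A : ZMod N → ∀ q : ℕ, DirichletCharacter ℂ q → ℝ := fun h q χ =>
    ‖∑ m ∈ Finset.range M, a m * c h (u m) * χ m‖ with hA
  set B : ZMod N → ∀ q : ℕ, DirichletCharacter ℂ q → ℝ := fun h q χ =>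
    ‖∑ n ∈ Finset.range N, b n * e h n * χ n‖ with hB
  have h1 : ∀ q : ℕ, ∀ χ : DirichletCharacter ℂ q, ‖∑ m ∈ Finset.range M, ∑ n ∈ Finset.range N,
      if n < u m then a m * b n * (χ m * χ n) else 0‖ ≤ ∑ h, A h q χ * B h q χ := by
    intro q χ
    have h2 : ∑ m ∈ Finset.range M, ∑ n ∈ Finset.range N,
        (if n < u m then a m * b n * (χ m * χ n) else 0) =
        ∑ h, (∑ m ∈ Finset.range M, a m * c h (u m) * χ m) *
          ∑ n ∈ Finset.range N, b n * e h n * χ n := by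
      simp only [Finset.sum_mul_sum]
      symm
      rw [Finset.sum_comm]
      refine Finset.sum_congr rfl fun m _ => ?_
      rw [Finset.sum_comm]
      refine Finset.sum_congr rfl fun n hn => ?_
      symm
      have h3 : (if n < u m then a m * b n * (χ m * χ n) else 0) =
          a m * b n * (χ m * χ n) * if n < u m then 1 else 0 := by
        split_ifs <;> simp
      rw [h3, hce (u m) (hu m) n (Finset.mem_range.1 hn), Finset.mul_sum]
      exact Finset.sum_congr rfl fun h _ => by ring
    rw [h2]
    refine (norm_sum_le _ _).trans (le_of_eq ?_)
    simp [hA, hB]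
  calc ∑ q ∈ Finset.Icc 1 Q, (q / q.totient : ℝ) * ∑ χ ∈ primitiveCharacters q,
        ‖∑ m ∈ Finset.range M, ∑ n ∈ Finset.range N,
          if n < u m then a m * b n * (χ m * χ n) else 0‖
      ≤ ∑ q ∈ Finset.Icc 1 Q, (q / q.totient : ℝ) * ∑ χ ∈ primitiveCharacters q,
        ∑ h, A h q χ * B h q χ := by
        gcongr with q _ χ _
        exact h1 q χ
    _ = ∑ h, ∑ q ∈ Finset.Icc 1 Q, (q / q.totient : ℝ) * ∑ χ ∈ primitiveCharacters q,
        A h q χ * B h q χ := by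
        rw [Finset.sum_comm]
        refine Finset.sum_congr rfl fun q _ => ?_
        rw [← Finset.mul_sum]
        congr 1
        exact Finset.sum_comm
    _ ≤ ∑ h, w h * (√((2 * M + T) * ∑ m ∈ Finset.range M, ‖a m‖ ^ 2) *
          √((2 * N + T) * ∑ n ∈ Finset.range N, ‖b n‖ ^ 2)) := by
        refine Finset.sum_le_sum fun h _ => ?_
        refine (sum_primitive_mul_le_sqrt_mul_sqrt _ _ (fun q => by positivity) (A h) (B h)).trans ?_
        have k1 := large_sieve Q M hQ fun m => a m * c h (u m)
        have k2 := large_sieve Q N hQ fun n => b n * e h n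
        rw [← mul_assoc]
        refine mul_le_mul ?_ (Real.sqrt_le_sqrt (k2.trans (le_of_eq ?_))) (Real.sqrt_nonneg _)
          (mul_nonneg (hw0 h) (Real.sqrt_nonneg _))
        · rw [Real.sqrt_le_left (mul_nonneg (hw0 h) (Real.sqrt_nonneg _)), mul_pow,
            Real.sq_sqrt (by positivity)]
          refine k1.trans ?_
          rw [mul_left_comm]
          refine mul_le_mul_of_nonneg_left ?_ (by positivity)
          rw [Finset.mul_sum]
          gcongr with m _
          rw [norm_mul, mul_pow, mul_comm]
          gcongr
          exact hc h _ (hu m)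
        · simp [he, hT]
    _ ≤ _ := by
        rw [← Finset.sum_mul]
        gcongr

lemma norm_sum_log_mul_le {b : ℕ → ℂ} {p : ℝ} (hb : ∀ n, ‖∑ i ∈ Finset.range n, b i‖ ≤ p) (n : ℕ) :
    ‖∑ i ∈ Finset.range (n + 1), (Real.log i : ℂ) * b i‖ ≤ 2 * Real.log n * p := by
  have key : ∀ n : ℕ, ‖∑ i ∈ Finset.range (n + 1), (Real.log i : ℂ) * b i -
      Real.log n * ∑ i ∈ Finset.range (n + 1), b i‖ ≤ Real.log n * p := by
    intro n
    induction n with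
    | zero => simp
    | succ n ih =>
      have h1 : Real.log n ≤ Real.log (n + 1 : ℕ) := by
        rcases Nat.eq_zero_or_pos n with rfl | hn
        · simp
        · exact Real.log_le_log (by exact_mod_cast hn) (by push_cast; linarith)
      have h2 : ∑ i ∈ Finset.range (n + 1 + 1), (Real.log i : ℂ) * b i -
          Real.log (n + 1 : ℕ) * ∑ i ∈ Finset.range (n + 1 + 1), b i =
          (∑ i ∈ Finset.range (n + 1), (Real.log i : ℂ) * b i -
          Real.log n * ∑ i ∈ Finset.range (n + 1), b i) -
          ((Real.log (n + 1 : ℕ) - Real.log n : ℝ) : ℂ) * ∑ i ∈ Finset.range (n + 1), b i := by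
        rw [Finset.sum_range_succ _ (n + 1), Finset.sum_range_succ b (n + 1)]
        push_cast
        ring
      rw [h2]
      refine (norm_sub_le _ _).trans ?_
      rw [norm_mul, norm_real, Real.norm_of_nonneg (sub_nonneg.2 h1)]
      have := mul_le_mul_of_nonneg_left (hb (n + 1)) (sub_nonneg.2 h1)
      linarith
  have h1 := key n
  have h2 : ‖(Real.log n : ℂ) * ∑ i ∈ Finset.range (n + 1), b i‖ ≤ Real.log n * p := by
    rw [norm_mul, norm_real, Real.norm_of_nonneg (Real.log_natCast_nonneg n)]
    exact mul_le_mul_of_nonneg_left (hb _) (Real.log_natCast_nonneg n)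
  have h3 := norm_add_le_of_le h1 h2
  rw [sub_add_cancel] at h3
  linarith

lemma norm_sum_Ioc_le_of_support {F : ℕ → ℂ} {U : ℕ} {B : ℝ} (hB : 0 ≤ B) (N : ℕ)
    (h0 : ∀ n, U < n → F n = 0) (h1 : ∀ n, 0 < n → n ≤ N → ‖F n‖ ≤ B) :
    ‖∑ n ∈ Finset.Ioc 0 N, F n‖ ≤ U * B := by
  have h2 : ∀ n ∈ Finset.Ioc 0 N, ‖F n‖ ≤ if n ∈ Finset.Ioc 0 U then B else 0 := by
    intro n hn
    rw [Finset.mem_Ioc] at hn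
    split_ifs with h
    · exact h1 n hn.1 hn.2
    · rw [h0 n (by rw [Finset.mem_Ioc] at h; omega), norm_zero]
  refine (norm_sum_le_of_le _ h2).trans ?_
  rw [Finset.sum_ite_mem]
  simp only [Finset.sum_const, nsmul_eq_mul]
  gcongr
  refine (Finset.card_le_card Finset.inter_subset_right).trans ?_
  simp

namespace ArithmeticFunction

noncomputable def truncate (U : ℕ) (f : ArithmeticFunction ℝ) : ArithmeticFunction ℝ :=
  ⟨fun n => if n ≤ U then f n else 0, by simp⟩

lemma truncate_apply (U : ℕ) (f : ArithmeticFunction ℝ) (n : ℕ) :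
    truncate U f n = if n ≤ U then f n else 0 := rfl

noncomputable def twist {q : ℕ} (χ : DirichletCharacter ℂ q) (f : ArithmeticFunction ℝ) :
    ArithmeticFunction ℂ :=
  ⟨fun n => (f n : ℂ) * χ n, by simp⟩

lemma twist_apply {q : ℕ} (χ : DirichletCharacter ℂ q) (f : ArithmeticFunction ℝ) (n : ℕ) :
    twist χ f n = (f n : ℂ) * χ n := rfl

lemma twist_mul {q : ℕ} (χ : DirichletCharacter ℂ q) (f g : ArithmeticFunction ℝ) :
    twist χ (f * g) = twist χ f * twist χ g := by
  ext n
  simp only [twist_apply, mul_apply]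
  push_cast
  rw [Finset.sum_mul]
  refine Finset.sum_congr rfl fun x hx => ?_
  rw [← (Nat.mem_divisorsAntidiagonal.1 hx).1]
  push_cast
  rw [map_mul]
  ring

lemma twist_add {q : ℕ} (χ : DirichletCharacter ℂ q) (f g : ArithmeticFunction ℝ) :
    twist χ (f + g) = twist χ f + twist χ g := by
  ext n
  simp only [twist_apply, add_apply]
  push_cast
  ring

lemma sub_apply_real (f g : ArithmeticFunction ℝ) (n : ℕ) : (f - g) n = f n - g n := by
  rw [sub_eq_add_neg, add_apply, neg_apply, sub_eq_add_neg]

lemma twist_sub {q : ℕ} (χ : DirichletCharacter ℂ q) (f g : ArithmeticFunction ℝ) (n : ℕ) :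
    twist χ (f - g) n = twist χ f n - twist χ g n := by
  rw [sub_eq_add_neg, twist_add, add_apply, twist_apply _ (-g), twist_apply _ g, neg_apply]
  push_cast
  ring

lemma vaughan_identity (U : ℕ) : vonMangoldt = truncate U vonMangoldt +
    truncate U (moebius : ArithmeticFunction ℝ) * log -
    truncate U (moebius : ArithmeticFunction ℝ) * truncate U vonMangoldt * (zeta : ArithmeticFunction ℝ) +
    ((moebius : ArithmeticFunction ℝ) - truncate U (moebius : ArithmeticFunction ℝ)) *
      ((vonMangoldt - truncate U vonMangoldt) * (zeta : ArithmeticFunction ℝ)) := by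
  have h1 : (moebius : ArithmeticFunction ℝ) * (zeta : ArithmeticFunction ℝ) = 1 :=
    coe_moebius_mul_coe_zeta
  rw [← vonMangoldt_mul_zeta]
  set μ₁ := truncate U (moebius : ArithmeticFunction ℝ)
  set Λ₁ := truncate U vonMangoldt
  have h2 : ((moebius : ArithmeticFunction ℝ) - μ₁) * ((vonMangoldt - Λ₁) *
      (zeta : ArithmeticFunction ℝ)) = ((moebius : ArithmeticFunction ℝ) *
        (zeta : ArithmeticFunction ℝ)) * (vonMangoldt - Λ₁) -
      μ₁ * (vonMangoldt * (zeta : ArithmeticFunction ℝ)) + μ₁ * Λ₁ * (zeta : ArithmeticFunction ℝ) := by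
    ring
  rw [h2, h1]
  ring

lemma truncate_vonMangoldt_nonneg (U n : ℕ) : 0 ≤ truncate U vonMangoldt n := by
  rw [truncate_apply]
  split_ifs
  · exact vonMangoldt_nonneg
  · rfl

lemma truncate_vonMangoldt_le (U n : ℕ) : truncate U vonMangoldt n ≤ vonMangoldt n := by
  rw [truncate_apply]
  split_ifs
  · rfl
  · exact vonMangoldt_nonneg

lemma abs_moebius_real_le_one (n : ℕ) : |(moebius : ArithmeticFunction ℝ) n| ≤ 1 := by
  rw [intCoe_apply]
  exact_mod_cast abs_moebius_le_one

lemma abs_truncate_moebius_le_one (U n : ℕ) : |truncate U (moebius : ArithmeticFunction ℝ) n| ≤ 1 := by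
  rw [truncate_apply]
  split_ifs
  · exact abs_moebius_real_le_one n
  · simp

lemma abs_truncate_mul_truncate_le (U n : ℕ) :
    |(truncate U (moebius : ArithmeticFunction ℝ) * truncate U vonMangoldt) n| ≤ Real.log n := by
  rw [mul_apply, ← vonMangoldt_sum, ← Nat.sum_divisorsAntidiagonal' fun _ x => vonMangoldt x]
  refine (Finset.abs_sum_le_sum_abs _ _).trans (Finset.sum_le_sum fun x _ => ?_)
  rw [abs_mul, abs_of_nonneg (truncate_vonMangoldt_nonneg U x.2)]
  exact (mul_le_of_le_one_left (truncate_vonMangoldt_nonneg U x.2)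
    (abs_truncate_moebius_le_one U x.1)).trans (truncate_vonMangoldt_le U x.2)

lemma truncate_mul_truncate_eq_zero {U n : ℕ} (f g : ArithmeticFunction ℝ) (hn : U ^ 2 < n) :
    (truncate U f * truncate U g) n = 0 := by
  rw [mul_apply]
  refine Finset.sum_eq_zero fun x hx => ?_
  have h := (Nat.mem_divisorsAntidiagonal.1 hx).1
  rw [truncate_apply, truncate_apply]
  split_ifs with h1 h2
  · have := Nat.mul_le_mul h1 h2
    nlinarith
  all_goals simp

lemma sub_truncate_mul_zeta_nonneg (U n : ℕ) :
    0 ≤ ((vonMangoldt - truncate U vonMangoldt) * (zeta : ArithmeticFunction ℝ)) n := by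
  rw [coe_mul_zeta_apply]
  refine Finset.sum_nonneg fun x _ => ?_
  rw [sub_apply_real]
  exact sub_nonneg.2 (truncate_vonMangoldt_le U x)

lemma sub_truncate_mul_zeta_le (U n : ℕ) :
    ((vonMangoldt - truncate U vonMangoldt) * (zeta : ArithmeticFunction ℝ)) n ≤ Real.log n := by
  rw [coe_mul_zeta_apply, ← vonMangoldt_sum]
  refine Finset.sum_le_sum fun x _ => ?_
  rw [sub_apply_real]
  exact sub_le_self _ (truncate_vonMangoldt_nonneg U x)

lemma sub_truncate_mul_zeta_eq_zero {U n : ℕ} (hn : n ≤ U) :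
    ((vonMangoldt - truncate U vonMangoldt) * (zeta : ArithmeticFunction ℝ)) n = 0 := by
  rw [coe_mul_zeta_apply]
  refine Finset.sum_eq_zero fun x hx => ?_
  rw [sub_apply_real, truncate_apply, if_pos ((Nat.divisor_le hx).trans hn), sub_self]

lemma sum_Ioc_twist_eq_sum_range {q : ℕ} (χ : DirichletCharacter ℂ q) (f : ArithmeticFunction ℝ)
    (N : ℕ) : ∑ n ∈ Finset.Ioc 0 N, twist χ f n = ∑ n ∈ Finset.range (N + 1), (f n : ℂ) * χ n := by
  rw [Finset.range_eq_Ico, Finset.sum_eq_sum_Ico_succ_bot (by omega)]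
  simp only [map_zero, ofReal_zero, zero_mul, zero_add]
  rfl

theorem vaughan_type_one {q : ℕ} (χ : DirichletCharacter ℂ q) {p l : ℝ} {N U : ℕ}
    (hp : ∀ n, ‖∑ i ∈ Finset.range n, χ i‖ ≤ p) (hl : Real.log N ≤ l) (hχ0 : χ 0 = 0) :
    ‖∑ n ∈ Finset.Ioc 0 N, twist χ vonMangoldt n -
      ∑ m ∈ Finset.Ioc 0 N, twist χ ((moebius : ArithmeticFunction ℝ) -
        truncate U (moebius : ArithmeticFunction ℝ)) m * ∑ k ∈ Finset.Ioc 0 (N / m),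
        twist χ ((vonMangoldt - truncate U vonMangoldt) * (zeta : ArithmeticFunction ℝ)) k‖ ≤
      U * l + U * (2 * l * p) + (U ^ 2 : ℕ) * (l * p) := by
  have hp0 : 0 ≤ p := (norm_nonneg _).trans (hp 0)
  have hl0 : 0 ≤ l := (Real.log_natCast_nonneg N).trans hl
  have hln : ∀ n, 0 < n → n ≤ N → Real.log n ≤ l := fun n h0 hn =>
    (Real.log_le_log (by exact_mod_cast h0) (by exact_mod_cast hn)).trans hl
  have h1 : ‖∑ n ∈ Finset.Ioc 0 N, twist χ (truncate U vonMangoldt) n‖ ≤ U * l := by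
    refine norm_sum_Ioc_le_of_support hl0 N (fun n hn => ?_) fun n h0 hn => ?_
    · rw [twist_apply, truncate_apply, if_neg (by omega)]
      simp
    · rw [twist_apply, norm_mul, norm_real, Real.norm_of_nonneg (truncate_vonMangoldt_nonneg U n)]
      exact (mul_le_of_le_one_right (truncate_vonMangoldt_nonneg U n) (χ.norm_le_one _)).trans
        (((truncate_vonMangoldt_le U n).trans vonMangoldt_le_log).trans (hln n h0 hn))
  have h2 : ‖∑ m ∈ Finset.Ioc 0 N, twist χ (truncate U (moebius : ArithmeticFunction ℝ)) m *
      ∑ k ∈ Finset.Ioc 0 (N / m), twist χ log k‖ ≤ U * (2 * l * p) := by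
    refine norm_sum_Ioc_le_of_support (by positivity) N (fun n hn => ?_) fun n h0 hn => ?_
    · rw [twist_apply, truncate_apply, if_neg (by omega)]
      simp
    · rw [norm_mul]
      have e1 : ‖twist χ (truncate U (moebius : ArithmeticFunction ℝ)) n‖ ≤ 1 := by
        rw [twist_apply, norm_mul, norm_real, Real.norm_eq_abs]
        exact mul_le_one₀ (abs_truncate_moebius_le_one U n) (norm_nonneg _) (χ.norm_le_one _)
      refine (mul_le_of_le_one_left (norm_nonneg _) e1).trans ?_
      rw [sum_Ioc_twist_eq_sum_range]
      refine (norm_sum_log_mul_le hp (N / n)).trans ?_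
      have : Real.log (N / n : ℕ) ≤ l := by
        rcases Nat.eq_zero_or_pos (N / n) with h | h
        · rw [h]; simpa using hl0
        · exact hln _ h (Nat.div_le_self _ _)
      gcongr
  have h3 : ‖∑ m ∈ Finset.Ioc 0 N, twist χ (truncate U (moebius : ArithmeticFunction ℝ) *
      truncate U vonMangoldt) m * ∑ k ∈ Finset.Ioc 0 (N / m),
        twist χ (zeta : ArithmeticFunction ℝ) k‖ ≤ (U ^ 2 : ℕ) * (l * p) := by
    refine norm_sum_Ioc_le_of_support (by positivity) N (fun n hn => ?_) fun n h0 hn => ?_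
    · rw [twist_apply, truncate_mul_truncate_eq_zero _ _ hn]
      simp
    · rw [norm_mul]
      have e1 : ‖twist χ (truncate U (moebius : ArithmeticFunction ℝ) *
          truncate U vonMangoldt) n‖ ≤ l := by
        rw [twist_apply, norm_mul, norm_real, Real.norm_eq_abs]
        refine (mul_le_of_le_one_right (abs_nonneg _) (χ.norm_le_one _)).trans ?_
        exact (abs_truncate_mul_truncate_le U n).trans (hln n h0 hn)
      have e2 : ∑ k ∈ Finset.Ioc 0 (N / n), twist χ (zeta : ArithmeticFunction ℝ) k =
          ∑ i ∈ Finset.range (N / n + 1), χ i := by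
        rw [sum_Ioc_twist_eq_sum_range]
        refine Finset.sum_congr rfl fun i _ => ?_
        rcases eq_or_ne i 0 with rfl | hi
        · simp [hχ0]
        · simp [natCoe_apply, hi]
      rw [e2]
      exact mul_le_mul e1 (hp _) (norm_nonneg _) hl0
  have h4 : ∑ n ∈ Finset.Ioc 0 N, twist χ vonMangoldt n -
      ∑ m ∈ Finset.Ioc 0 N, twist χ ((moebius : ArithmeticFunction ℝ) -
        truncate U (moebius : ArithmeticFunction ℝ)) m * ∑ k ∈ Finset.Ioc 0 (N / m),
        twist χ ((vonMangoldt - truncate U vonMangoldt) * (zeta : ArithmeticFunction ℝ)) k =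
      ∑ n ∈ Finset.Ioc 0 N, twist χ (truncate U vonMangoldt) n +
      ∑ m ∈ Finset.Ioc 0 N, twist χ (truncate U (moebius : ArithmeticFunction ℝ)) m *
        ∑ k ∈ Finset.Ioc 0 (N / m), twist χ log k -
      ∑ m ∈ Finset.Ioc 0 N, twist χ (truncate U (moebius : ArithmeticFunction ℝ) *
        truncate U vonMangoldt) m * ∑ k ∈ Finset.Ioc 0 (N / m),
        twist χ (zeta : ArithmeticFunction ℝ) k := by
    simp only [← sum_Ioc_mul_eq_sum_sum, ← twist_mul]
    rw [← Finset.sum_add_distrib, ← Finset.sum_sub_distrib, ← Finset.sum_sub_distrib]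
    refine Finset.sum_congr rfl fun n _ => ?_
    have h5 := congrArg (fun f => twist χ f n) (vaughan_identity U)
    simp only [twist_add, add_apply, twist_sub] at h5
    rw [h5, add_sub_cancel_right]
  rw [h4]
  refine (norm_sub_le _ _).trans (add_le_add ((norm_add_le _ _).trans (add_le_add h1 h2)) h3)

end ArithmeticFunction

lemma card_primitiveCharacters_le (q : ℕ) (hq : q ≠ 0) :
    ((primitiveCharacters q).card : ℝ) ≤ q.totient := by
  have : NeZero q := ⟨hq⟩
  have h := DirichletCharacter.card_eq_totient_of_hasEnoughRootsOfUnity ℂ q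
  rw [Nat.card_eq_fintype_card] at h
  rw [← h]
  exact_mod_cast Finset.card_le_univ _

lemma sum_primitiveCharacters_const_le (Q : ℕ) {c : ℝ} (hc : 0 ≤ c) :
    ∑ q ∈ Finset.Icc 1 Q, (q / q.totient : ℝ) * ∑ _χ ∈ primitiveCharacters q, c ≤ Q ^ 2 * c := by
  have h : ∀ q ∈ Finset.Icc 1 Q, (q / q.totient : ℝ) * ∑ _χ ∈ primitiveCharacters q, c ≤ Q * c := by
    intro q hq
    rw [Finset.mem_Icc] at hq
    rw [Finset.sum_const, nsmul_eq_mul, ← mul_assoc]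
    refine mul_le_mul_of_nonneg_right ?_ hc
    have h1 : (0 : ℝ) < q.totient := by exact_mod_cast Nat.totient_pos.2 hq.1
    have h2 := card_primitiveCharacters_le q (by omega)
    have h3 : (q : ℝ) ≤ Q := by exact_mod_cast hq.2
    rw [div_mul_eq_mul_div, div_le_iff₀ h1]
    gcongr
  refine (Finset.sum_le_sum h).trans ?_
  rw [Finset.sum_const, nsmul_eq_mul, Nat.card_Icc, Nat.add_sub_cancel]
  exact le_of_eq (by ring)

lemma sum_Ioc_eq_sum_dyadic (F : ℕ → ℂ) {N J : ℕ} (hJ : N < 2 ^ J) (hF : ∀ n, N < n → F n = 0) :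
    ∑ m ∈ Finset.Ioc 0 N, F m =
      ∑ j ∈ Finset.range J, ∑ m ∈ Finset.range (2 ^ (j + 1)), if 2 ^ j ≤ m then F m else 0 := by
  have h1 : ∀ J : ℕ, ∑ j ∈ Finset.range J, ∑ m ∈ Finset.range (2 ^ (j + 1)),
      (if 2 ^ j ≤ m then F m else 0) = ∑ m ∈ Finset.Ico 1 (2 ^ J), F m := by
    intro J
    induction J with
    | zero => simp
    | succ J ih =>
      rw [Finset.sum_range_succ, ih, ← Finset.sum_filter]
      have : Finset.filter (fun m => 2 ^ J ≤ m) (Finset.range (2 ^ (J + 1))) =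
          Finset.Ico (2 ^ J) (2 ^ (J + 1)) := by
        ext m
        simp [and_comm]
      rw [this, Finset.sum_Ico_consecutive _ Nat.one_le_two_pow
        (Nat.pow_le_pow_right (by norm_num) (by omega))]
  rw [h1]
  refine Finset.sum_subset (fun m hm => ?_) fun m hm hm' => ?_
  · rw [Finset.mem_Ioc] at hm
    rw [Finset.mem_Ico]
    omega
  · rw [Finset.mem_Ioc] at hm'
    rw [Finset.mem_Ico] at hm
    exact hF m (by omega)

lemma sqrt_mul_sqrt_dyadic_le {X K D L E : ℝ} (hX : 0 < X) (hK : 0 < K) (hL : 1 ≤ L)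
    (hD : 1 ≤ D) (hE : 1 ≤ E) (hXK : X * K ≤ E ^ 16) (hX' : E ^ 2 ≤ 2 * X) (hK' : E ^ 2 ≤ K) :
    √((4 * X + D ^ 2 * (2 * L)) * (2 * X)) * √((2 * (K + 1) + D ^ 2 * (2 * L)) * (2 * K * L ^ 2)) ≤
      8 * L ^ 2 * (E ^ 8 * (E ^ 8 + 2 * (D * E ^ 7) + D ^ 2)) := by
  rw [← Real.sqrt_mul (by positivity)]
  refine Real.sqrt_le_iff.2 ⟨by positivity, ?_⟩
  have h1 : 4 * X + D ^ 2 * (2 * L) ≤ 4 * L * (X + D ^ 2) := by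
    nlinarith [mul_nonneg hX.le (sub_nonneg.2 hL), mul_nonneg (sq_nonneg D) (zero_le_one.trans hL)]
  have hD2 : 1 ≤ D ^ 2 := one_le_pow₀ hD
  have h2 : 2 * (K + 1) + D ^ 2 * (2 * L) ≤ 4 * L * (K + D ^ 2) := by
    have := mul_nonneg hK.le (sub_nonneg.2 hL)
    have := one_le_mul_of_one_le_of_one_le hD2 hL
    nlinarith
  have h3 : X * E ^ 2 ≤ E ^ 16 := (mul_le_mul_of_nonneg_left hK' hX.le).trans hXK
  have h4 : K * E ^ 2 ≤ 2 * E ^ 16 := by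
    have := mul_le_mul_of_nonneg_left hX' hK.le
    linarith
  have h5 : X + K ≤ 3 * E ^ 14 := by
    have : (X + K) * E ^ 2 ≤ 3 * E ^ 14 * E ^ 2 := by linarith
    exact le_of_mul_le_mul_right this (by positivity)
  have h6 : (X + D ^ 2) * (K + D ^ 2) ≤ (E ^ 8 + 2 * (D * E ^ 7) + D ^ 2) ^ 2 := by
    have h7 := mul_le_mul_of_nonneg_left h5 (sq_nonneg D)
    have h8 : 0 ≤ E ^ 8 * (D * E ^ 7) := by positivity
    have h9 : 0 ≤ E ^ 8 * D ^ 2 := by positivity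
    have h10 : 0 ≤ D * E ^ 7 * D ^ 2 := by positivity
    have h11 : 0 ≤ D ^ 2 * E ^ 14 := by positivity
    nlinarith
  calc (4 * X + D ^ 2 * (2 * L)) * (2 * X) * ((2 * (K + 1) + D ^ 2 * (2 * L)) * (2 * K * L ^ 2))
      ≤ (4 * L * (X + D ^ 2)) * (2 * X) * ((4 * L * (K + D ^ 2)) * (2 * K * L ^ 2)) := by gcongr
    _ = 64 * L ^ 4 * ((X * K) * ((X + D ^ 2) * (K + D ^ 2))) := by ring
    _ ≤ 64 * L ^ 4 * (E ^ 16 * (E ^ 8 + 2 * (D * E ^ 7) + D ^ 2) ^ 2) := by gcongr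
    _ = _ := by ring

lemma dyadic_type_two {f g : ℕ → ℂ} {N Q U j : ℕ} {L E : ℝ} (hQ : 1 ≤ Q) (hL : 1 ≤ L)
    (hE : 1 ≤ E) (hf0 : ∀ n, n ≤ U → f n = 0) (hf : ∀ n, ‖f n‖ ≤ 1) (hg0 : ∀ n, n ≤ U → g n = 0)
    (hg : ∀ n, n ≤ N → ‖g n‖ ≤ L) (hN : N ≤ E ^ 16) (hNL : Real.log (N + 1) ≤ 2 * L)
    (hQL : 1 + 2 * Real.log Q ≤ 2 * L) (hU : E ^ 2 ≤ U + 1) :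
    ∑ q ∈ Finset.Icc 1 Q, (q / q.totient : ℝ) * ∑ χ ∈ primitiveCharacters q,
      ‖∑ m ∈ Finset.range (2 ^ (j + 1)), if 2 ^ j ≤ m then
        f m * χ m * ∑ k ∈ Finset.Ioc 0 (N / m), g k * χ k else 0‖ ≤
      4 * L * (8 * L ^ 2 * (E ^ 8 * (E ^ 8 + 2 * (Q * E ^ 7) + Q ^ 2))) := by
  set K := N / 2 ^ j with hKdef
  have hkey : ∀ (q : ℕ) (χ : DirichletCharacter ℂ q), (∑ m ∈ Finset.range (2 ^ (j + 1)),
      if 2 ^ j ≤ m then f m * χ m * ∑ k ∈ Finset.Ioc 0 (N / m), g k * χ k else 0) =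
      ∑ m ∈ Finset.range (2 ^ (j + 1)), ∑ n ∈ Finset.range (K + 1),
        if n < (if 2 ^ j ≤ m then N / m + 1 else 0) then f m * g n * (χ m * χ n) else 0 := by
    intro q χ
    refine Finset.sum_congr rfl fun m hm => ?_
    split_ifs with h
    · rw [← Finset.sum_filter]
      have h1 : Finset.filter (fun n => n < N / m + 1) (Finset.range (K + 1)) =
          Finset.range (N / m + 1) := by
        ext n
        simp only [Finset.mem_filter, Finset.mem_range]
        have : N / m ≤ K := Nat.div_le_div_left h (by positivity)
        omega
      rw [h1, Finset.range_eq_Ico, Finset.sum_eq_sum_Ico_succ_bot (Nat.succ_pos _), hg0 0 (Nat.zero_le _),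
        Finset.mul_sum]
      simp only [mul_zero, zero_mul, zero_add]
      refine Finset.sum_congr rfl fun n _ => ?_
      ring
    · simp
  simp only [hkey]
  have hbound : 0 ≤ 4 * L * (8 * L ^ 2 * (E ^ 8 * (E ^ 8 + 2 * (Q * E ^ 7) + (Q : ℝ) ^ 2))) := by
    positivity
  by_cases hz : 2 ^ (j + 1) ≤ U + 1 ∨ K ≤ U
  · refine le_trans (le_of_eq ?_) hbound
    refine Finset.sum_eq_zero fun q _ => ?_
    rw [Finset.sum_eq_zero, mul_zero]
    intro χ _
    rw [norm_eq_zero]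
    refine Finset.sum_eq_zero fun m hm => Finset.sum_eq_zero fun n hn => ?_
    rw [Finset.mem_range] at hm hn
    rcases hz with hz | hz
    · rw [hf0 m (by omega)]
      simp
    · rw [hg0 n (by omega)]
      simp
  push Not at hz
  have hu : ∀ m, (if 2 ^ j ≤ m then N / m + 1 else 0) ≤ K + 1 := by
    intro m
    split_ifs with h
    · exact Nat.succ_le_succ (Nat.div_le_div_left h (by positivity))
    · omega
  refine (bilinear_large_sieve Q (2 ^ (j + 1)) (K + 1) hQ (by omega) f
    g _ hu).trans ?_
  have hX : (0 : ℝ) < 2 ^ j := by positivity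
  have hK : (0 : ℝ) < K := by exact_mod_cast (Nat.zero_le U).trans_lt hz.2
  have hKN : K ≤ N := Nat.div_le_self _ _
  have s1 : ∑ m ∈ Finset.range (2 ^ (j + 1)), ‖f m‖ ^ 2 ≤ 2 * (2 : ℝ) ^ j := by
    refine (Finset.sum_le_sum fun m _ => pow_le_one₀ (norm_nonneg _) (hf m) (n := 2)).trans ?_
    simp [pow_succ, mul_comm]
  have s2 : ∑ n ∈ Finset.range (K + 1), ‖g n‖ ^ 2 ≤ 2 * K * L ^ 2 := by
    have : ∀ n ∈ Finset.range (K + 1), ‖g n‖ ^ 2 ≤ L ^ 2 := fun n hn =>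
      pow_le_pow_left₀ (norm_nonneg _) (hg n (by rw [Finset.mem_range] at hn; omega)) 2
    refine (Finset.sum_le_sum this).trans ?_
    rw [Finset.sum_const, Finset.card_range, nsmul_eq_mul]
    have h1 : (1 : ℝ) ≤ K := by exact_mod_cast (Nat.zero_le U).trans_lt hz.2
    refine mul_le_mul_of_nonneg_right ?_ (sq_nonneg L)
    push_cast
    linarith
  have s3 : 2 + Real.log (K + 1 : ℕ) ≤ 4 * L := by
    have : Real.log (K + 1 : ℕ) ≤ Real.log (N + 1) :=
      Real.log_le_log (by positivity) (by push_cast; gcongr)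
    linarith
  have s4 := sqrt_mul_sqrt_dyadic_le (D := (Q : ℝ)) (E := E) hX hK hL (by exact_mod_cast hQ) hE
    (le_trans (by exact_mod_cast Nat.mul_div_le N (2 ^ j)) hN)
    (hU.trans (by
      have : ((U + 1 : ℕ) : ℝ) ≤ (2 ^ (j + 1) : ℕ) := by exact_mod_cast hz.1.le
      push_cast at this
      rw [pow_succ] at this
      linarith))
    (hU.trans (by exact_mod_cast hz.2))
  have hlog : 0 ≤ Real.log (K + 1 : ℕ) := Real.log_natCast_nonneg _
  refine mul_le_mul s3 (le_trans ?_ s4) (by positivity) (by positivity)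
  have hlQ : 0 ≤ Real.log Q := Real.log_natCast_nonneg _
  have e1 : 2 * ((2 ^ (j + 1) : ℕ) : ℝ) = 4 * 2 ^ j := by
    push_cast
    ring
  rw [e1]
  push_cast
  gcongr

lemma type_two_large_sieve {f g : ℕ → ℂ} {N Q U : ℕ} {L E : ℝ} (hQ : 1 ≤ Q) (hL : 1 ≤ L)
    (hE : 1 ≤ E) (hf0 : ∀ n, n ≤ U → f n = 0) (hf : ∀ n, ‖f n‖ ≤ 1) (hg0 : ∀ n, n ≤ U → g n = 0)
    (hg : ∀ n, n ≤ N → ‖g n‖ ≤ L) (hN : N ≤ E ^ 16) (hNL : Real.log (N + 1) ≤ 2 * L)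
    (hQL : 1 + 2 * Real.log Q ≤ 2 * L) (hU : E ^ 2 ≤ U + 1) :
    ∑ q ∈ Finset.Icc 1 Q, (q / q.totient : ℝ) * ∑ χ ∈ primitiveCharacters q,
      ‖∑ m ∈ Finset.Ioc 0 N, f m * χ m * ∑ k ∈ Finset.Ioc 0 (N / m), g k * χ k‖ ≤
      192 * L ^ 4 * (E ^ 8 * (E ^ 8 + 2 * (Q * E ^ 7) + Q ^ 2)) := by
  set J := Nat.log 2 (N + 1) + 1 with hJ
  have hNJ : N < 2 ^ J := (Nat.lt_succ_self N).trans (Nat.lt_pow_succ_log_self (by norm_num) _)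
  have hJL : (J : ℝ) ≤ 6 * L := by
    have h1 : (2 : ℝ) ^ Nat.log 2 (N + 1) ≤ N + 1 := by
      exact_mod_cast Nat.pow_log_le_self 2 (Nat.succ_ne_zero N)
    have h2 := Real.log_le_log (by positivity) h1
    rw [Real.log_pow] at h2
    have h3 := Real.log_two_gt_d9
    have h4 : (Nat.log 2 (N + 1) : ℝ) * 0.5 ≤ Nat.log 2 (N + 1) * Real.log 2 := by
      gcongr
      linarith
    rw [hJ]
    push_cast
    linarith
  have key : ∀ (q : ℕ) (χ : DirichletCharacter ℂ q),
      ‖∑ m ∈ Finset.Ioc 0 N, f m * χ m * ∑ k ∈ Finset.Ioc 0 (N / m), g k * χ k‖ ≤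
      ∑ j ∈ Finset.range J, ‖∑ m ∈ Finset.range (2 ^ (j + 1)), if 2 ^ j ≤ m then
        f m * χ m * ∑ k ∈ Finset.Ioc 0 (N / m), g k * χ k else 0‖ := by
    intro q χ
    rw [sum_Ioc_eq_sum_dyadic _ hNJ fun n hn => by simp [Nat.div_eq_of_lt hn]]
    exact norm_sum_le _ _
  calc _ ≤ ∑ q ∈ Finset.Icc 1 Q, (q / q.totient : ℝ) * ∑ χ ∈ primitiveCharacters q,
      ∑ j ∈ Finset.range J, ‖∑ m ∈ Finset.range (2 ^ (j + 1)), if 2 ^ j ≤ m then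
        f m * χ m * ∑ k ∈ Finset.Ioc 0 (N / m), g k * χ k else 0‖ := by
        refine Finset.sum_le_sum fun q _ => mul_le_mul_of_nonneg_left ?_ (by positivity)
        exact Finset.sum_le_sum fun χ _ => key q χ
    _ = ∑ j ∈ Finset.range J, ∑ q ∈ Finset.Icc 1 Q, (q / q.totient : ℝ) *
        ∑ χ ∈ primitiveCharacters q, ‖∑ m ∈ Finset.range (2 ^ (j + 1)), if 2 ^ j ≤ m then
        f m * χ m * ∑ k ∈ Finset.Ioc 0 (N / m), g k * χ k else 0‖ := by
        rw [Finset.sum_comm]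
        refine Finset.sum_congr rfl fun q _ => ?_
        rw [Finset.sum_comm, Finset.mul_sum]
    _ ≤ ∑ j ∈ Finset.range J, 4 * L * (8 * L ^ 2 * (E ^ 8 * (E ^ 8 + 2 * (Q * E ^ 7) + Q ^ 2))) :=
        Finset.sum_le_sum fun j _ => dyadic_type_two hQ hL hE hf0 hf hg0 hg hN hNL hQL hU
    _ = J * (4 * L * (8 * L ^ 2 * (E ^ 8 * (E ^ 8 + 2 * (Q * E ^ 7) + Q ^ 2)))) := by
        rw [Finset.sum_const, Finset.card_range, nsmul_eq_mul]
    _ ≤ 6 * L * (4 * L * (8 * L ^ 2 * (E ^ 8 * (E ^ 8 + 2 * (Q * E ^ 7) + Q ^ 2)))) := by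
        gcongr
    _ = _ := by ring

open ArithmeticFunction in
/-- The basic mean value theorem for primes twisted by primitive characters. -/
theorem basic_mean_value {Z N Q : ℕ} {E L : ℝ} (hE : E = (Z : ℝ) ^ (1 / 16 : ℝ))
    (hLZ : L = Real.log Z) (hZ : 3 ≤ Z) (hNZ : N ≤ Z) (hQ : 1 ≤ Q) (hQZ : Q ≤ E ^ 8) :
    ∑ q ∈ Finset.Icc 2 Q, (q / q.totient : ℝ) * ∑ χ ∈ primitiveCharacters q,
      ‖∑ n ∈ Finset.range (N + 1), (Λ n : ℂ) * χ n‖ ≤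
      400 * L ^ 4 * (E ^ 8 * (E ^ 8 + Q * E ^ 7 + Q ^ 2)) := by
  have hZ1 : (1 : ℝ) ≤ Z := by exact_mod_cast (by omega : 1 ≤ Z)
  have hE1 : 1 ≤ E := hE ▸ Real.one_le_rpow hZ1 (by norm_num)
  have hE16 : E ^ 16 = Z := by
    rw [hE, ← Real.rpow_natCast, ← Real.rpow_mul (by positivity)]
    norm_num
  have hL1 : 1 ≤ L := hLZ ▸ one_le_log_of_three_le hZ
  have hNL : Real.log (N + 1) ≤ 2 * L := by
    have h1 : (N + 1 : ℝ) ≤ (Z : ℝ) ^ 2 := by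
      have : (N : ℝ) ≤ Z := by exact_mod_cast hNZ
      have : (3 : ℝ) ≤ Z := by exact_mod_cast hZ
      nlinarith
    have := Real.log_le_log (by positivity) h1
    rw [Real.log_pow] at this
    rw [hLZ]
    exact_mod_cast this
  have hQ0 : (1 : ℝ) ≤ Q := by exact_mod_cast hQ
  have hlogQ : 2 * Real.log Q ≤ L := by
    have h1 : (Q : ℝ) ^ 2 ≤ Z := by
      rw [← hE16]
      calc (Q : ℝ) ^ 2 ≤ (E ^ 8) ^ 2 := by gcongr
        _ = _ := by ring
    have := Real.log_le_log (by positivity) h1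
    rw [Real.log_pow] at this
    rw [hLZ]
    exact_mod_cast this
  have hlQ : 0 ≤ Real.log Q := Real.log_natCast_nonneg _
  set U := ⌊E ^ 2⌋₊ with hU
  have hU1 : (U : ℝ) ≤ E ^ 2 := Nat.floor_le (by positivity)
  have hU2 : E ^ 2 ≤ U + 1 := (Nat.lt_floor_add_one _).le
  set f : ℕ → ℂ := fun n => ((((moebius : ArithmeticFunction ℝ) -
        truncate U (moebius : ArithmeticFunction ℝ)) n : ℝ) : ℂ) with hf
  set g : ℕ → ℂ := fun n => ((((vonMangoldt - truncate U vonMangoldt) *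
    (zeta : ArithmeticFunction ℝ)) n : ℝ) : ℂ) with hg
  have h2 := type_two_large_sieve (f := f) (g := g) (N := N) (Q := Q) (U := U) (L := L) (E := E)
    hQ hL1 hE1
    (fun n hn => by simp only [hf, sub_apply_real, truncate_apply, if_pos hn, sub_self, ofReal_zero])
    (fun n => by
      simp only [hf, sub_apply_real, truncate_apply, norm_real, Real.norm_eq_abs]
      split_ifs
      · simp
      · simpa using abs_moebius_real_le_one n)
    (fun n hn => by simp only [hg, sub_truncate_mul_zeta_eq_zero hn, ofReal_zero])
    (fun n hn => by
      simp only [hg, norm_real, Real.norm_of_nonneg (sub_truncate_mul_zeta_nonneg U n)]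
      refine (sub_truncate_mul_zeta_le U n).trans ?_
      rcases Nat.eq_zero_or_pos n with rfl | h0
      · simp only [CharP.cast_eq_zero, Real.log_zero]
        linarith
      · rw [hLZ]
        exact Real.log_le_log (by exact_mod_cast h0) (by exact_mod_cast hn.trans hNZ))
    (by rw [hE16]; exact_mod_cast hNZ) hNL (by linarith) hU2
  have h1 : ∀ q ∈ Finset.Icc 2 Q, ∀ χ ∈ primitiveCharacters q,
      ‖∑ n ∈ Finset.range (N + 1), (Λ n : ℂ) * χ n‖ ≤ 7 * L ^ 2 * E ^ 8 +
      ‖∑ m ∈ Finset.Ioc 0 N, f m * χ m * ∑ k ∈ Finset.Ioc 0 (N / m), g k * χ k‖ := by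
    intro q hq χ hχ
    rw [Finset.mem_Icc] at hq
    rw [mem_primitiveCharacters] at hχ
    have hqQ : (q : ℝ) ≤ Q := by exact_mod_cast hq.2
    have hq0 : (0 : ℝ) < q := by exact_mod_cast (by omega : 0 < q)
    have : Fact (1 < q) := ⟨hq.1⟩
    have hp : ∀ n, ‖∑ i ∈ Finset.range n, χ i‖ ≤ E ^ 4 * (2 * L) := by
      intro n
      refine (polya_vinogradov hq.1 hχ n).trans ?_
      have hs : √(q : ℝ) ≤ E ^ 4 := by
        refine Real.sqrt_le_iff.2 ⟨by positivity, hqQ.trans (hQZ.trans (le_of_eq (by ring)))⟩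
      have hlq : Real.log q ≤ Real.log Q := Real.log_le_log hq0 hqQ
      have : 0 ≤ Real.log q := Real.log_natCast_nonneg _
      refine mul_le_mul hs (by linarith) (by linarith) (by positivity)
    have hlN : Real.log N ≤ L := by
      rcases Nat.eq_zero_or_pos N with rfl | h0
      · simp only [CharP.cast_eq_zero, Real.log_zero]
        linarith
      · rw [hLZ]
        exact Real.log_le_log (by exact_mod_cast h0) (by exact_mod_cast hNZ)
    have h3 := vaughan_type_one χ (U := U) hp hlN (χ.map_nonunit not_isUnit_zero)
    rw [sum_Ioc_twist_eq_sum_range] at h3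
    have h4 : (U : ℝ) * L + U * (2 * L * (E ^ 4 * (2 * L))) +
        ((U ^ 2 : ℕ) : ℝ) * (L * (E ^ 4 * (2 * L))) ≤ 7 * L ^ 2 * E ^ 8 := by
      push_cast
      calc (U : ℝ) * L + U * (2 * L * (E ^ 4 * (2 * L))) + (U : ℝ) ^ 2 * (L * (E ^ 4 * (2 * L)))
          ≤ E ^ 2 * L + E ^ 2 * (2 * L * (E ^ 4 * (2 * L))) +
            (E ^ 2) ^ 2 * (L * (E ^ 4 * (2 * L))) := by gcongr
        _ = L * E ^ 2 + 4 * (L ^ 2 * E ^ 6) + 2 * (L ^ 2 * E ^ 8) := by ring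
        _ ≤ L ^ 2 * E ^ 8 + 4 * (L ^ 2 * E ^ 8) + 2 * (L ^ 2 * E ^ 8) := by
          have : L ≤ L ^ 2 := le_self_pow₀ hL1 (by norm_num)
          gcongr <;> first | exact hE1 | norm_num
        _ = _ := by ring
    have h5 := (norm_sub_norm_le _ _).trans (h3.trans h4)
    have h6 : ∀ m, twist χ ((moebius : ArithmeticFunction ℝ) -
        truncate U (moebius : ArithmeticFunction ℝ)) m = f m * χ m := fun m => rfl
    have h7 : ∀ m, twist χ ((vonMangoldt - truncate U vonMangoldt) *
      (zeta : ArithmeticFunction ℝ)) m = g m * χ m := fun m => rfl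
    simp only [h6, h7] at h5
    linarith
  calc _ ≤ ∑ q ∈ Finset.Icc 2 Q, (q / q.totient : ℝ) * ∑ χ ∈ primitiveCharacters q,
        (7 * L ^ 2 * E ^ 8 +
      ‖∑ m ∈ Finset.Ioc 0 N, f m * χ m * ∑ k ∈ Finset.Ioc 0 (N / m), g k * χ k‖) := by
        refine Finset.sum_le_sum fun q hq => mul_le_mul_of_nonneg_left ?_ (by positivity)
        exact Finset.sum_le_sum fun χ hχ => h1 q hq χ hχ
    _ ≤ ∑ q ∈ Finset.Icc 1 Q, (q / q.totient : ℝ) * ∑ χ ∈ primitiveCharacters q,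
        (7 * L ^ 2 * E ^ 8 +
      ‖∑ m ∈ Finset.Ioc 0 N, f m * χ m * ∑ k ∈ Finset.Ioc 0 (N / m), g k * χ k‖) := by
        refine Finset.sum_le_sum_of_subset_of_nonneg
          (Finset.Icc_subset_Icc (by norm_num) le_rfl) fun q _ _ => ?_
        exact mul_nonneg (by positivity) (Finset.sum_nonneg fun χ _ => by positivity)
    _ ≤ Q ^ 2 * (7 * L ^ 2 * E ^ 8) +
        192 * L ^ 4 * (E ^ 8 * (E ^ 8 + 2 * (Q * E ^ 7) + Q ^ 2)) := by
        simp only [Finset.sum_add_distrib, mul_add] at h2 ⊢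
        refine add_le_add ?_ h2
        exact sum_primitiveCharacters_const_le Q (by positivity)
    _ ≤ 400 * L ^ 4 * (E ^ 8 * (E ^ 8 + Q * E ^ 7 + Q ^ 2)) := by
        have h5 : L ^ 2 ≤ L ^ 4 := pow_le_pow_right₀ hL1 (by norm_num)
        have h6 := mul_le_mul_of_nonneg_right h5 (by positivity : 0 ≤ (Q : ℝ) ^ 2 * E ^ 8)
        have h7 : 0 ≤ L ^ 4 * (E ^ 8 * E ^ 8) := by positivity
        have h8 : 0 ≤ L ^ 4 * (E ^ 8 * (Q * E ^ 7)) := by positivity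
        have h9 : 0 ≤ L ^ 4 * ((Q : ℝ) ^ 2 * E ^ 8) := by positivity
        nlinarith

lemma prod_div_sub_one_le_card_add_one (s : Finset ℕ) (hs : ∀ i ∈ s, 2 ≤ i) :
    ∏ i ∈ s, ((i : ℝ) / (i - 1)) ≤ s.card + 1 := by
  induction s using Finset.induction_on_max with
  | empty => simp
  | insert a s ha ih =>
    have hna : a ∉ s := fun h => lt_irrefl a (ha a h)
    rw [Finset.prod_insert hna, Finset.card_insert_of_notMem hna]
    have h1 := ih fun i hi => hs i (Finset.mem_insert_of_mem hi)
    have h2 : s.card + 2 ≤ a := by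
      have h3 : s ⊆ Finset.Ico 2 a := fun i hi =>
        Finset.mem_Ico.2 ⟨hs i (Finset.mem_insert_of_mem hi), ha i hi⟩
      have h4 := Finset.card_le_card h3
      rw [Nat.card_Ico] at h4
      have := hs a (Finset.mem_insert_self a s)
      omega
    have h3 : (s.card : ℝ) + 2 ≤ a := by exact_mod_cast h2
    have h4 : (0 : ℝ) < a - 1 := by
      have : (0 : ℝ) ≤ s.card := by positivity
      linarith
    push_cast
    calc (a : ℝ) / (a - 1) * ∏ i ∈ s, ((i : ℝ) / (i - 1)) ≤ a / (a - 1) * (s.card + 1) := by gcongr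
      _ ≤ s.card + 1 + 1 := by
        rw [div_mul_eq_mul_div, div_le_iff₀ h4]
        nlinarith

lemma natCast_div_totient_le {n : ℕ} (hn : 1 ≤ n) : (n : ℝ) / n.totient ≤ 1 + Real.log n / Real.log 2 := by
  have h1 := Nat.totient_eq_mul_prod_factors n
  have h2 : (n.totient : ℝ) = n * ∏ p ∈ n.primeFactors, (1 - (p : ℝ)⁻¹) := by
    have := congrArg (fun x : ℚ => (x : ℝ)) h1
    push_cast at this
    exact this
  have hn0 : (n : ℝ) ≠ 0 := by positivity
  have h3 : (n : ℝ) / n.totient = ∏ p ∈ n.primeFactors, ((p : ℝ) / (p - 1)) := by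
    rw [h2, div_mul_cancel_left₀ hn0, ← Finset.prod_inv_distrib]
    refine Finset.prod_congr rfl fun p hp => ?_
    have hp2 : (2 : ℝ) ≤ p := by exact_mod_cast (Nat.prime_of_mem_primeFactors hp).two_le
    have : (p : ℝ) - 1 ≠ 0 := by linarith
    field_simp
  rw [h3]
  refine (prod_div_sub_one_le_card_add_one _ fun p hp =>
    (Nat.prime_of_mem_primeFactors hp).two_le).trans ?_
  rw [add_comm]
  gcongr
  rw [le_div_iff₀ (Real.log_pos (by norm_num)), ← Real.log_pow]
  refine Real.log_le_log (by positivity) ?_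
  have h4 : 2 ^ n.primeFactors.card ≤ ∏ p ∈ n.primeFactors, p :=
    Finset.pow_card_le_prod _ _ _ fun p hp => (Nat.prime_of_mem_primeFactors hp).two_le
  exact_mod_cast h4.trans (Nat.le_of_dvd (by omega) (Nat.prod_primeFactors_dvd n))

lemma sum_inv_totient_le {Q : ℕ} {L : ℝ} (hL : 1 ≤ L) (hQ : Real.log Q ≤ L) :
    ∑ k ∈ Finset.Icc 1 Q, (1 / k.totient : ℝ) ≤ 6 * L ^ 2 := by
  have h1 : ∀ k ∈ Finset.Icc 1 Q, (1 / k.totient : ℝ) ≤ 3 * L * (k : ℝ)⁻¹ := by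
    intro k hk
    rw [Finset.mem_Icc] at hk
    have hk0 : (0 : ℝ) < k := by exact_mod_cast hk.1
    have h2 := natCast_div_totient_le hk.1
    have h3 : Real.log k ≤ L := (Real.log_le_log hk0 (by exact_mod_cast hk.2)).trans hQ
    have h4 : Real.log k / Real.log 2 ≤ 2 * L := by
      rw [div_le_iff₀ (Real.log_pos (by norm_num))]
      have := Real.log_two_gt_d9
      nlinarith
    have h5 : (1 / k.totient : ℝ) = (k / k.totient) * (k : ℝ)⁻¹ := by field_simp
    rw [h5]
    gcongr
    linarith
  refine (Finset.sum_le_sum h1).trans ?_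
  rw [← Finset.mul_sum]
  have h2 : ∑ k ∈ Finset.Icc 1 Q, (k : ℝ)⁻¹ ≤ 1 + L := by
    have := harmonic_le_one_add_log Q
    rw [harmonic_eq_sum_Icc] at this
    push_cast at this
    linarith
  nlinarith

open ArithmeticFunction in
lemma sum_vonMangoldt_not_coprime_le (m N : ℕ) (hm : m ≠ 0) :
    ∑ n ∈ Finset.range (N + 1), (if n.Coprime m then 0 else Λ n) ≤ Nat.log 2 N * Real.log m := by
  rw [← Real.log_pow]
  have h : ((m : ℝ) ^ Nat.log 2 N) = (m ^ Nat.log 2 N : ℕ) := by push_cast; rfl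
  have h' : ∀ n : ℕ, (if n.Coprime m then 0 else Λ n) = if ¬ n.Coprime m then Λ n else 0 :=
    fun n => (ite_not _ _ _).symm
  simp only [h']
  rw [h, ← vonMangoldt_sum, ← Finset.sum_filter, ← Finset.sum_filter_ne_zero]
  refine Finset.sum_le_sum_of_subset_of_nonneg (fun n hn => ?_) fun _ _ _ => vonMangoldt_nonneg
  simp only [Finset.mem_filter, Finset.mem_range] at hn
  obtain ⟨⟨hnN, hnm⟩, h0⟩ := hn
  rw [vonMangoldt_ne_zero_iff, isPrimePow_nat_iff] at h0
  obtain ⟨p, k, hp, hk, rfl⟩ := h0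
  rw [Nat.mem_divisors]
  refine ⟨?_, by positivity⟩
  have hpm : p ∣ m := by
    by_contra hpm
    exact hnm (((Nat.Prime.coprime_iff_not_dvd hp).2 hpm).pow_left k)
  have hkN : k ≤ Nat.log 2 N := by
    refine Nat.le_log_of_pow_le (by norm_num) ?_
    exact (Nat.pow_le_pow_left hp.two_le k).trans (Nat.lt_succ_iff.1 hnN)
  exact (pow_dvd_pow_of_dvd hpm k).trans (pow_dvd_pow m hkN)

lemma norm_sum_sub_sum_primitiveCharacter_le {m : ℕ} [NeZero m] (χ : DirichletCharacter ℂ m)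
    (N : ℕ) : ‖∑ n ∈ Finset.range (N + 1), (ArithmeticFunction.vonMangoldt n : ℂ) * χ n -
      ∑ n ∈ Finset.range (N + 1), (ArithmeticFunction.vonMangoldt n : ℂ) * χ.primitiveCharacter n‖ ≤
      Nat.log 2 N * Real.log m := by
  rw [← Finset.sum_sub_distrib]
  refine (norm_sum_le_of_le _ fun n _ => ?_).trans (sum_vonMangoldt_not_coprime_le m N (NeZero.ne m))
  split_ifs with h
  · have h1 := χ.primitiveCharacter_apply_of_isCoprime (a := n) (Nat.isCoprime_iff_coprime.2 h)
    push_cast at h1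
    rw [h1, sub_self, norm_zero]
  · have h1 : χ n = 0 := χ.map_nonunit fun h2 => h ((ZMod.isUnit_iff_coprime n m).1 h2)
    rw [h1, mul_zero, zero_sub, norm_neg, norm_mul, norm_real,
      Real.norm_of_nonneg ArithmeticFunction.vonMangoldt_nonneg]
    exact mul_le_of_le_one_right ArithmeticFunction.vonMangoldt_nonneg
      (χ.primitiveCharacter.norm_le_one _)

lemma sum_nontrivial_characters_le {m : ℕ} [NeZero m] (G : ∀ q, DirichletCharacter ℂ q → ℝ)
    (hG : ∀ q χ, 0 ≤ G q χ) :
    ∑ χ ∈ Finset.univ.filter (fun χ : DirichletCharacter ℂ m => χ ≠ 1),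
      G χ.conductor χ.primitiveCharacter ≤
      ∑ q ∈ m.divisors.filter (2 ≤ ·), ∑ χ ∈ primitiveCharacters q, G q χ := by
  classical
  set e : DirichletCharacter ℂ m → (Σ q, DirichletCharacter ℂ q) :=
    fun χ => ⟨χ.conductor, χ.primitiveCharacter⟩ with he
  set r : (Σ q, DirichletCharacter ℂ q) → DirichletCharacter ℂ m := fun x =>
    if h : x.1 ∣ m then DirichletCharacter.changeLevel h x.2 else 1 with hr
  have hre : Function.LeftInverse r e := by
    intro χ
    simp only [hr, he]
    rw [dif_pos χ.conductor_dvd_level]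
    exact χ.changeLevel_primitiveCharacter
  rw [Finset.sum_sigma', ← Finset.sum_image (f := fun x : (Σ q, DirichletCharacter ℂ q) => G x.1 x.2)
    (g := e) (hre.injective.injOn)]
  refine Finset.sum_le_sum_of_subset_of_nonneg (fun x hx => ?_) fun _ _ _ => hG _ _
  obtain ⟨χ, hχ, rfl⟩ := Finset.mem_image.1 hx
  have hχ1 := (Finset.mem_filter.1 hχ).2
  rw [Finset.mem_sigma, Finset.mem_filter, Nat.mem_divisors, mem_primitiveCharacters]
  refine ⟨⟨⟨χ.conductor_dvd_level, NeZero.ne m⟩, ?_⟩, χ.primitiveCharacter_isPrimitive⟩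
  have h0 := χ.conductor_ne_zero
  have h1 : χ.conductor ≠ 1 := fun h => hχ1 (DirichletCharacter.eq_one_iff_conductor_eq_one.2 h)
  simp only [he]
  omega

lemma sum_totient_divisors_le (Q : ℕ) (H : ℕ → ℝ) (hH : ∀ q, 0 ≤ H q) :
    ∑ m ∈ Finset.Icc 1 Q, (1 / m.totient : ℝ) * ∑ q ∈ m.divisors.filter (2 ≤ ·), H q ≤
      (∑ k ∈ Finset.Icc 1 Q, (1 / k.totient : ℝ)) *
        ∑ q ∈ Finset.Icc 2 Q, (1 / q.totient : ℝ) * H q := by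
  have h1 : ∀ m ∈ Finset.Icc 1 Q, (1 / m.totient : ℝ) * ∑ q ∈ m.divisors.filter (2 ≤ ·), H q ≤
      ∑ q ∈ Finset.Icc 2 Q, ∑ k ∈ Finset.Icc 1 Q,
        if q * k = m then (1 / k.totient : ℝ) * ((1 / q.totient : ℝ) * H q) else 0 := by
    intro m hm
    rw [Finset.mem_Icc] at hm
    rw [Finset.mul_sum]
    calc _ ≤ ∑ q ∈ m.divisors.filter (2 ≤ ·), ∑ k ∈ Finset.Icc 1 Q,
        (if q * k = m then (1 / k.totient : ℝ) * ((1 / q.totient : ℝ) * H q) else 0) := by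
          refine Finset.sum_le_sum fun q hq => ?_
          simp only [Finset.mem_filter, Nat.mem_divisors] at hq
          obtain ⟨⟨⟨k, rfl⟩, hm0⟩, hq2⟩ := hq
          have hk : 1 ≤ k := Nat.one_le_iff_ne_zero.2 (right_ne_zero_of_mul hm0)
          have hkQ : k ≤ Q := (Nat.le_mul_of_pos_left k (by omega)).trans hm.2
          have hpos : ∀ k : ℕ, 0 ≤ (if q * k = q * k then
            (1 / k.totient : ℝ) * ((1 / q.totient : ℝ) * H q) else 0) := by
            intro k
            have := hH q
            split_ifs <;> positivity
          refine le_trans ?_ (Finset.single_le_sum (f := fun k' => if q * k' = q * k then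
            (1 / k'.totient : ℝ) * ((1 / q.totient : ℝ) * H q) else 0) (fun k' _ => ?_)
            (Finset.mem_Icc.2 ⟨hk, hkQ⟩))
          · rw [if_pos rfl, ← mul_assoc]
            refine mul_le_mul_of_nonneg_right ?_ (hH q)
            rw [one_div_mul_one_div]
            have h2 : (0 : ℝ) < k.totient := by exact_mod_cast Nat.totient_pos.2 hk
            have h3 : (0 : ℝ) < q.totient := by exact_mod_cast Nat.totient_pos.2 (by omega)
            refine one_div_le_one_div_of_le (by positivity) ?_
            rw [mul_comm]
            exact_mod_cast Nat.totient_super_multiplicative q k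
          · have := hH q
            split_ifs <;> positivity
      _ ≤ _ := by
          refine Finset.sum_le_sum_of_subset_of_nonneg (fun q hq => ?_) fun q _ _ => ?_
          · simp only [Finset.mem_filter, Nat.mem_divisors] at hq
            exact Finset.mem_Icc.2 ⟨hq.2, (Nat.le_of_dvd (by omega) hq.1.1).trans hm.2⟩
          · refine Finset.sum_nonneg fun k _ => ?_
            have := hH q
            split_ifs <;> positivity
  refine (Finset.sum_le_sum h1).trans ?_
  rw [Finset.sum_comm, Finset.sum_mul_sum, Finset.sum_comm (s := Finset.Icc 1 Q) (t := Finset.Icc 2 Q)]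
  refine Finset.sum_le_sum fun q _ => ?_
  rw [Finset.sum_comm]
  refine Finset.sum_le_sum fun k _ => ?_
  rw [Finset.sum_ite_eq]
  have := hH q
  split_ifs
  · rfl
  · positivity

lemma sum_div_le_of_sum_le {h : ℕ → ℝ} {D Q : ℕ} {a b c : ℝ} (hD : 1 ≤ D) (hDQ : D ≤ Q)
    (hh : ∀ q, 0 ≤ h q) (ha : 0 ≤ a) (hb : 0 ≤ b) (hc : 0 ≤ c)
    (H : ∀ R, D ≤ R → R ≤ Q → ∑ q ∈ Finset.Icc 2 R, h q ≤ a + b * R + c * R ^ 2) :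
    ∑ q ∈ Finset.Ioc D Q, h q / q ≤ 2 * a / D + b * (2 + Real.log Q) + 2 * c * Q := by
  set G : ℕ → ℝ := fun R => ∑ q ∈ Finset.Icc 2 R, h q with hG
  have h1 : ∀ Q, D ≤ Q → ∑ q ∈ Finset.Ioc D Q, h q / q ≤ G Q / (Q + 1) +
      ∑ R ∈ Finset.Ioc D Q, G R / (R * (R + 1)) := by
    intro Q hQ
    induction Q, hQ using Nat.le_induction with
    | base =>
      simp only [Finset.Ioc_self, Finset.sum_empty, add_zero]
      exact div_nonneg (Finset.sum_nonneg fun q _ => hh q) (by positivity)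
    | succ Q hQ ih =>
      rw [← Finset.insert_Ioc_right_eq_Ioc_add_one hQ, Finset.sum_insert (by simp),
        Finset.sum_insert (by simp)]
      have h2 : G (Q + 1) = G Q + h (Q + 1) := by
        simp only [hG]
        rw [Finset.sum_Icc_succ_top (by omega)]
      have h3 : h (Q + 1) / ((Q + 1 : ℕ) : ℝ) + G Q / (Q + 1) = G (Q + 1) / ((Q + 1 : ℕ) + 1) +
          G (Q + 1) / ((Q + 1 : ℕ) * ((Q + 1 : ℕ) + 1)) := by
        rw [h2]
        push_cast
        field_simp
        ring
      linarith
  have h2 : ∀ Q, D ≤ Q → ∑ R ∈ Finset.Ioc D Q, (a + b * R + c * R ^ 2) / ((R : ℝ) * (R + 1)) ≤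
      a * (1 / D - 1 / (Q + 1)) + b * ∑ R ∈ Finset.Ioc D Q, (R : ℝ)⁻¹ + c * (Q - D) := by
    intro Q hQ
    induction Q, hQ using Nat.le_induction with
    | base =>
      simp only [Finset.Ioc_self, Finset.sum_empty, mul_zero, add_zero, sub_self]
      refine mul_nonneg ha (sub_nonneg.2 ?_)
      have : (0 : ℝ) < D := by exact_mod_cast hD
      exact one_div_le_one_div_of_le this (by linarith)
    | succ Q hQ ih =>
      rw [← Finset.insert_Ioc_right_eq_Ioc_add_one hQ, Finset.sum_insert (by simp),
        Finset.sum_insert (by simp)]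
      have h3 : (a + b * ((Q + 1 : ℕ) : ℝ) + c * ((Q + 1 : ℕ) : ℝ) ^ 2) /
          (((Q + 1 : ℕ) : ℝ) * ((Q + 1 : ℕ) + 1)) =
          a * (1 / (Q + 1) - 1 / ((Q + 1 : ℕ) + 1)) + b * (1 / ((Q + 1 : ℕ) + 1)) +
            c * ((Q + 1) / ((Q + 1 : ℕ) + 1)) := by
        push_cast
        field_simp
        ring
      have h4 : b * (1 / (((Q + 1 : ℕ) : ℝ) + 1)) ≤ b * ((Q + 1 : ℕ) : ℝ)⁻¹ := by
        refine mul_le_mul_of_nonneg_left ?_ hb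
        rw [inv_eq_one_div]
        exact one_div_le_one_div_of_le (by positivity) (by linarith)
      have h5 : c * ((Q + 1) / (((Q + 1 : ℕ) : ℝ) + 1)) ≤ c * 1 := by
        refine mul_le_mul_of_nonneg_left ?_ hc
        rw [div_le_one (by positivity)]
        push_cast
        linarith
      rw [h3]
      push_cast at h4 h5 ⊢
      linarith
  have hD0 : (0 : ℝ) < D := by exact_mod_cast hD
  have hDQ' : (D : ℝ) ≤ Q := by exact_mod_cast hDQ
  have hQ0 : (0 : ℝ) < Q := hD0.trans_le hDQ'
  have h3 : ∑ R ∈ Finset.Ioc D Q, G R / ((R : ℝ) * (R + 1)) ≤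
      ∑ R ∈ Finset.Ioc D Q, (a + b * R + c * R ^ 2) / ((R : ℝ) * (R + 1)) := by
    refine Finset.sum_le_sum fun R hR => ?_
    rw [Finset.mem_Ioc] at hR
    gcongr
    exact H R hR.1.le hR.2
  have h4 : ∑ R ∈ Finset.Ioc D Q, (R : ℝ)⁻¹ ≤ 1 + Real.log Q := by
    have := harmonic_le_one_add_log Q
    rw [harmonic_eq_sum_Icc] at this
    push_cast at this
    refine le_trans (Finset.sum_le_sum_of_subset_of_nonneg (fun x hx => ?_)
      fun _ _ _ => by positivity) this
    rw [Finset.mem_Ioc] at hx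
    exact Finset.mem_Icc.2 ⟨by omega, hx.2⟩
  have h5 : G Q / (Q + 1) ≤ a / (Q + 1) + b + c * Q := by
    rw [div_le_iff₀ (by positivity)]
    refine (H Q hDQ le_rfl).trans ?_
    have : a / ((Q : ℝ) + 1) * (Q + 1) = a := by field_simp
    nlinarith [mul_nonneg hc hQ0.le]
  have h6 := mul_le_mul_of_nonneg_left h4 hb
  have h7 : 0 ≤ a / D := by positivity
  have h8 := h1 Q hDQ
  have h9 := h2 Q hDQ
  have h10 : a * (1 / D - 1 / ((Q : ℝ) + 1)) = a / D - a / (Q + 1) := by ring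
  have h11 : 2 * a / D = a / D + a / D := by ring
  have h12 := mul_nonneg hc hD0.le
  rw [h11]
  rw [h10] at h9
  linarith

section

open scoped ArithmeticFunction.vonMangoldt

lemma psi_natCast_eq (N m a : ℕ) :
    psi N m a = ∑ n ∈ Finset.range (N + 1), if (a : ZMod m) = n then Λ n else 0 := by
  rw [psi, Nat.floor_natCast, Finset.range_eq_Ico, Finset.sum_eq_sum_Ico_succ_bot (by omega)]
  have h1 : (if (a : ZMod m) = (0 : ℕ) then Λ 0 else 0) = 0 := by simp
  rw [h1, zero_add]
  refine Finset.sum_congr rfl fun n _ => ?_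
  have : (a : ZMod m) = n ↔ n % m = a % m := by
    rw [ZMod.natCast_eq_natCast_iff, Nat.ModEq, eq_comm]
  simp only [this]

lemma totient_mul_psi_eq {m a : ℕ} [NeZero m] (N : ℕ) (ha : a.Coprime m) :
    ((m.totient * psi N m a : ℝ) : ℂ) = ∑ χ : DirichletCharacter ℂ m,
      χ (a : ZMod m)⁻¹ * ∑ n ∈ Finset.range (N + 1), (Λ n : ℂ) * χ n := by
  have hu : IsUnit (a : ZMod m) := (ZMod.isUnit_iff_coprime a m).2 ha
  simp only [Finset.mul_sum]
  rw [Finset.sum_comm, psi_natCast_eq]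
  push_cast
  rw [Finset.mul_sum]
  refine Finset.sum_congr rfl fun n _ => ?_
  have h := DirichletCharacter.sum_char_inv_mul_char_eq ℂ hu (n : ZMod m)
  calc _ = (Λ n : ℂ) * (if (a : ZMod m) = n then (m.totient : ℂ) else 0) := by
        split_ifs <;> push_cast <;> ring
    _ = _ := by
        rw [← h, Finset.mul_sum]
        exact Finset.sum_congr rfl fun χ _ => by ring

lemma abs_psi_sub_le {m a : ℕ} (N : ℕ) (hm : 1 ≤ m) (ha : a.Coprime m) :
    |psi N m a - N / m.totient| ≤ Nat.log 2 N * Real.log m + 1 / m.totient *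
      |∑ n ∈ Finset.range (N + 1), Λ n - N| + 1 / m.totient *
        ∑ q ∈ m.divisors.filter (2 ≤ ·), ∑ χ ∈ primitiveCharacters q,
          ‖∑ n ∈ Finset.range (N + 1), (Λ n : ℂ) * χ n‖ := by
  classical
  have : NeZero m := ⟨by omega⟩
  have hφ : (0 : ℝ) < m.totient := by exact_mod_cast Nat.totient_pos.2 hm
  have hu : IsUnit (a : ZMod m)⁻¹ := by
    have hu : IsUnit (a : ZMod m) := (ZMod.isUnit_iff_coprime a m).2 ha
    obtain ⟨u, hu⟩ := hu
    rw [← hu, ZMod.inv_coe_unit]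
    exact Units.isUnit _
  set K : ℝ := Nat.log 2 N * Real.log m with hK
  have h1 : ‖∑ n ∈ Finset.range (N + 1), (Λ n : ℂ) * (1 : DirichletCharacter ℂ m) n -
      ((∑ n ∈ Finset.range (N + 1), Λ n : ℝ) : ℂ)‖ ≤ K := by
    push_cast
    rw [← Finset.sum_sub_distrib]
    refine (norm_sum_le_of_le _ fun n _ => ?_).trans
      (sum_vonMangoldt_not_coprime_le m N (NeZero.ne m))
    split_ifs with h
    · rw [MulChar.one_apply ((ZMod.isUnit_iff_coprime n m).2 h), mul_one, sub_self, norm_zero]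
    · have h1 : (1 : DirichletCharacter ℂ m) n = 0 :=
        MulChar.map_nonunit _ fun h2 => h ((ZMod.isUnit_iff_coprime n m).1 h2)
      rw [h1, mul_zero, zero_sub, norm_neg, norm_real,
        Real.norm_of_nonneg ArithmeticFunction.vonMangoldt_nonneg]
  have h2 : ‖∑ χ ∈ Finset.univ.filter (fun χ : DirichletCharacter ℂ m => χ ≠ 1),
      χ (a : ZMod m)⁻¹ * ∑ n ∈ Finset.range (N + 1), (Λ n : ℂ) * χ n‖ ≤
      (m.totient - 1) * K + ∑ q ∈ m.divisors.filter (2 ≤ ·), ∑ χ ∈ primitiveCharacters q,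
          ‖∑ n ∈ Finset.range (N + 1), (Λ n : ℂ) * χ n‖ := by
    have h3 := sum_nontrivial_characters_le (m := m)
      (fun q χ => ‖∑ n ∈ Finset.range (N + 1), (Λ n : ℂ) * χ n‖) fun q χ => norm_nonneg _
    have h4 : ∀ χ ∈ Finset.univ.filter (fun χ : DirichletCharacter ℂ m => χ ≠ 1),
        ‖χ (a : ZMod m)⁻¹ * ∑ n ∈ Finset.range (N + 1), (Λ n : ℂ) * χ n‖ ≤
        K + ‖∑ n ∈ Finset.range (N + 1), (Λ n : ℂ) * χ.primitiveCharacter n‖ := by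
      intro χ _
      rw [norm_mul]
      refine (mul_le_of_le_one_left (norm_nonneg _) (χ.norm_le_one _)).trans ?_
      have := norm_sum_sub_sum_primitiveCharacter_le χ N
      have := (norm_sub_norm_le _ _).trans this
      linarith
    refine (norm_sum_le_of_le _ h4).trans ?_
    rw [Finset.sum_add_distrib]
    refine add_le_add (le_of_eq ?_) h3
    rw [Finset.sum_const, nsmul_eq_mul, Finset.filter_ne', Finset.card_erase_of_mem (Finset.mem_univ _),
      Finset.card_univ]
    have h5 := DirichletCharacter.card_eq_totient_of_hasEnoughRootsOfUnity ℂ m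
    rw [Nat.card_eq_fintype_card] at h5
    rw [h5, Nat.cast_sub (Nat.totient_pos.2 hm), Nat.cast_one]
  have h3 := totient_mul_psi_eq N ha
  rw [← Finset.sum_filter_add_sum_filter_not _ (fun χ : DirichletCharacter ℂ m => χ = 1),
    Finset.filter_eq', if_pos (Finset.mem_univ _), Finset.sum_singleton,
    MulChar.one_apply hu, one_mul] at h3
  have h4 : ((m.totient * psi N m a - N : ℝ) : ℂ) =
      (∑ n ∈ Finset.range (N + 1), (Λ n : ℂ) * (1 : DirichletCharacter ℂ m) n -
      ((∑ n ∈ Finset.range (N + 1), Λ n : ℝ) : ℂ)) +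
      ((∑ n ∈ Finset.range (N + 1), Λ n - N : ℝ) : ℂ) +
      ∑ χ ∈ Finset.univ.filter (fun χ : DirichletCharacter ℂ m => χ ≠ 1),
      χ (a : ZMod m)⁻¹ * ∑ n ∈ Finset.range (N + 1), (Λ n : ℂ) * χ n := by
    rw [ofReal_sub, h3]
    push_cast
    ring
  have h5 : |m.totient * psi N m a - N| ≤ m.totient * K +
      |∑ n ∈ Finset.range (N + 1), Λ n - N| +
      ∑ q ∈ m.divisors.filter (2 ≤ ·), ∑ χ ∈ primitiveCharacters q,
          ‖∑ n ∈ Finset.range (N + 1), (Λ n : ℂ) * χ n‖ := by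
    rw [← Real.norm_eq_abs, ← norm_real, h4]
    refine (norm_add_le_of_le (norm_add_le_of_le h1 (le_of_eq (norm_real _))) h2).trans ?_
    rw [Real.norm_eq_abs]
    linarith
  have h6 : psi N m a - N / m.totient = (m.totient * psi N m a - N) / m.totient := by
    field_simp
  rw [h6, abs_div, abs_of_pos hφ, div_le_iff₀ hφ]
  refine h5.trans (le_of_eq ?_)
  field_simp

lemma exists_div_log_pow_le (k : ℕ) : ∃ C : ℝ, 1 ≤ C ∧ ∀ Z N : ℕ, 3 ≤ Z → 3 ≤ N → N ≤ 2 * Z →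
    N / Real.log N ^ k ≤ C * (Z / Real.log Z ^ k) := by
  obtain ⟨C, hC1, hC⟩ := log_pow_le_mul_sqrt k
  refine ⟨C + 2 ^ (k + 1), by have : (0 : ℝ) ≤ 2 ^ (k + 1) := by positivity
                              linarith, fun Z N hZ hN hNZ => ?_⟩
  have hZ0 : (0 : ℝ) < Z := by exact_mod_cast (by omega : 0 < Z)
  have hZ1 : (1 : ℝ) ≤ Z := by exact_mod_cast (by omega : 1 ≤ Z)
  have hN0 : (0 : ℝ) < N := by exact_mod_cast (by omega : 0 < N)
  have hL := one_le_log_of_three_le hZ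
  have hLN := one_le_log_of_three_le hN
  rw [add_mul]
  rcases le_total (N : ℝ) (√Z) with h | h
  · have h1 : (N : ℝ) / Real.log N ^ k ≤ √Z :=
      (div_le_self hN0.le (one_le_pow₀ hLN)).trans h
    have h2 : √(Z : ℝ) ≤ C * (Z / Real.log Z ^ k) := by
      rw [← mul_div_assoc, le_div_iff₀ (by positivity)]
      calc √(Z : ℝ) * Real.log Z ^ k ≤ √(Z : ℝ) * (C * √Z) := by
            gcongr
            exact hC Z hZ1
        _ = C * (√(Z : ℝ) * √Z) := by ring
        _ = C * Z := by rw [Real.mul_self_sqrt hZ0.le]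
    have h3 : 0 ≤ 2 ^ (k + 1) * ((Z : ℝ) / Real.log Z ^ k) := by positivity
    linarith
  · have h1 : Real.log Z ≤ 2 * Real.log N := by
      have := Real.log_le_log (by positivity) h
      rw [Real.log_sqrt hZ0.le] at this
      linarith
    have h2 : (N : ℝ) / Real.log N ^ k ≤ 2 ^ (k + 1) * ((Z : ℝ) / Real.log Z ^ k) := by
      rw [← mul_div_assoc, div_le_div_iff₀ (by positivity) (by positivity)]
      have h3 : (N : ℝ) ≤ 2 * Z := by exact_mod_cast hNZ
      calc (N : ℝ) * Real.log Z ^ k ≤ (2 * Z) * (2 * Real.log N) ^ k := by gcongr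
        _ = _ := by rw [mul_pow, pow_succ]; ring
    have h3 : 0 ≤ C * ((Z : ℝ) / Real.log Z ^ k) := by positivity
    linarith

lemma exists_log_pow_le_mul_rpow (m : ℕ) : ∃ C : ℝ, 1 ≤ C ∧ ∀ Z : ℝ, 1 ≤ Z →
    Real.log Z ^ m ≤ C * Z ^ (1 / 16 : ℝ) := by
  obtain ⟨C, hC1, hC⟩ := log_pow_le_mul_sqrt (8 * m)
  refine ⟨C, hC1, fun Z hZ => ?_⟩
  have h0 : 0 ≤ Real.log Z := Real.log_nonneg hZ
  refine le_of_pow_le_pow_left₀ (n := 8) (by norm_num) (by positivity) ?_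
  have h1 : (Z ^ (1 / 16 : ℝ)) ^ 8 = √Z := by
    rw [← Real.rpow_natCast, ← Real.rpow_mul (by positivity), Real.sqrt_eq_rpow]
    norm_num
  rw [mul_pow, h1, ← pow_mul, mul_comm m 8]
  refine (hC Z hZ).trans ?_
  gcongr
  exact le_self_pow₀ hC1 (by norm_num)

lemma sum_range_vonMangoldt_mul_eq_zero {N : ℕ} (hN : N < 2) (f : ℕ → ℂ) :
    ∑ n ∈ Finset.range (N + 1), (Λ n : ℂ) * f n = 0 := by
  refine Finset.sum_eq_zero fun n hn => ?_
  rw [Finset.mem_range] at hn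
  have : n = 0 ∨ n = 1 := by omega
  rcases this with rfl | rfl <;> simp

lemma sum_small_conductor_le (k : ℕ) : ∃ C : ℝ, 1 ≤ C ∧ ∀ Z N D : ℕ, 3 ≤ Z → N ≤ Z →
    ∑ q ∈ Finset.Icc 2 D, (1 / q.totient : ℝ) * ∑ χ ∈ primitiveCharacters q,
      ‖∑ n ∈ Finset.range (N + 1), (Λ n : ℂ) * χ n‖ ≤ C * D ^ 2 * (Z / Real.log Z ^ k) := by
  obtain ⟨C₁, hC₁, h₁⟩ := siegel_walfisz_primitive k
  obtain ⟨C₂, hC₂, h₂⟩ := exists_div_log_pow_le k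
  refine ⟨C₁ * C₂, one_le_mul_of_one_le_of_one_le hC₁ hC₂, fun Z N D hZ hN => ?_⟩
  have hL := one_le_log_of_three_le hZ
  have key : ∀ q ∈ Finset.Icc 2 D, (1 / q.totient : ℝ) * ∑ χ ∈ primitiveCharacters q,
      ‖∑ n ∈ Finset.range (N + 1), (Λ n : ℂ) * χ n‖ ≤ C₁ * D * (C₂ * (Z / Real.log Z ^ k)) := by
    intro q hq
    rw [Finset.mem_Icc] at hq
    have : NeZero q := ⟨by omega⟩
    have hφ : (0 : ℝ) < q.totient := by exact_mod_cast Nat.totient_pos.2 (by omega)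
    have h3 : ∀ χ ∈ primitiveCharacters q, ‖∑ n ∈ Finset.range (N + 1), (Λ n : ℂ) * χ n‖ ≤
        C₁ * D * (C₂ * (Z / Real.log Z ^ k)) := by
      intro χ hχ
      rw [mem_primitiveCharacters] at hχ
      rcases lt_or_ge N 2 with hN2 | hN2
      · rw [sum_range_vonMangoldt_mul_eq_zero hN2 fun n => χ n, norm_zero]
        positivity
      · have hχ1 : χ ≠ 1 := by
          rw [Ne, DirichletCharacter.eq_one_iff_conductor_eq_one,
            (DirichletCharacter.isPrimitive_def χ).1 hχ]
          omega
        refine (h₁ q χ hχ hχ1 (N + 1) (by omega)).trans ?_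
        have h4 := h₂ Z (N + 1) hZ (by omega) (by omega)
        have h5 : (q : ℝ) ≤ D := by exact_mod_cast hq.2
        gcongr
    calc _ ≤ (1 / q.totient : ℝ) * (q.totient * (C₁ * D * (C₂ * (Z / Real.log Z ^ k)))) := by
          refine mul_le_mul_of_nonneg_left ?_ (by positivity)
          refine (Finset.sum_le_sum h3).trans ?_
          rw [Finset.sum_const, nsmul_eq_mul]
          exact mul_le_mul_of_nonneg_right (card_primitiveCharacters_le q (by omega)) (by positivity)
      _ = _ := by field_simp
  refine (Finset.sum_le_sum key).trans ?_
  rw [Finset.sum_const, nsmul_eq_mul, Nat.card_Icc]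
  have h6 : ((D + 1 - 2 : ℕ) : ℝ) ≤ D := by exact_mod_cast (by omega : D + 1 - 2 ≤ D)
  calc _ ≤ (D : ℝ) * (C₁ * D * (C₂ * (Z / Real.log Z ^ k))) := by gcongr
    _ = _ := by ring

lemma sum_primitive_le (k : ℕ) : ∃ C : ℝ, 1 ≤ C ∧ ∀ Z N Q : ℕ, 3 ≤ Z → N ≤ Z →
    (Q : ℝ) ^ 2 ≤ Z →
    ∑ q ∈ Finset.Icc 2 Q, (1 / q.totient : ℝ) * ∑ χ ∈ primitiveCharacters q,
      ‖∑ n ∈ Finset.range (N + 1), (Λ n : ℂ) * χ n‖ ≤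
      C * (Z / Real.log Z ^ k + Real.log Z ^ 4 * (√Z * Q)) := by
  obtain ⟨C₁, hC₁, h₁⟩ := sum_small_conductor_le (3 * k + 8)
  obtain ⟨C₂, hC₂, h₂⟩ := exists_log_pow_le_mul_rpow (k + 5)
  refine ⟨4 * C₁ + 800 + 1200 * C₂, by linarith, fun Z N Q hZ hN hQ => ?_⟩
  set H : ℕ → ℝ := fun q => ∑ χ ∈ primitiveCharacters q,
    ‖∑ n ∈ Finset.range (N + 1), (Λ n : ℂ) * χ n‖ with hH
  have hH0 : ∀ q, 0 ≤ H q := fun q => Finset.sum_nonneg fun _ _ => norm_nonneg _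
  have hL := one_le_log_of_three_le hZ
  set L := Real.log Z with hLdef
  have hZ1 : (1 : ℝ) ≤ Z := by exact_mod_cast (by omega : 1 ≤ Z)
  set E := (Z : ℝ) ^ (1 / 16 : ℝ) with hE
  have hE0 : 0 < E := by positivity
  have hE16 : E ^ 16 = Z := by
    rw [hE, ← Real.rpow_natCast, ← Real.rpow_mul (by positivity)]
    norm_num
  have hE8 : E ^ 8 = √Z := by
    rw [← hE16, show E ^ 16 = (E ^ 8) ^ 2 by ring, Real.sqrt_sq (by positivity)]
  set D := ⌈L ^ (k + 4)⌉₊ with hD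
  have hLk : 1 ≤ L ^ (k + 4) := one_le_pow₀ hL
  have hD1 : L ^ (k + 4) ≤ D := Nat.le_ceil _
  have hD2 : (D : ℝ) ≤ 2 * L ^ (k + 4) := by
    have := (Nat.ceil_lt_add_one (zero_le_one.trans hLk)).le
    linarith
  have hD0 : 1 ≤ D := by exact_mod_cast hLk.trans hD1
  have hsmall : ∑ q ∈ Finset.Icc 2 D, (1 / q.totient : ℝ) * H q ≤ 4 * C₁ * (Z / L ^ k) := by
    refine (h₁ Z N D hZ hN).trans ?_
    calc C₁ * (D : ℝ) ^ 2 * (Z / L ^ (3 * k + 8)) ≤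
        C₁ * (2 * L ^ (k + 4)) ^ 2 * (Z / L ^ (3 * k + 8)) := by gcongr
      _ = _ := by
        have hL0 : L ≠ 0 := by positivity
        field_simp
        ring
  have hlarge : ∑ q ∈ Finset.Ioc D Q, (1 / q.totient : ℝ) * H q ≤
      (800 + 1200 * C₂) * (Z / L ^ k + L ^ 4 * (√Z * Q)) := by
    rcases lt_or_ge Q D with hQD | hQD
    · rw [Finset.Ioc_eq_empty (by omega), Finset.sum_empty]
      positivity
    have hQ1 : (1 : ℝ) ≤ Q := by exact_mod_cast hD0.trans hQD
    have hQE : (Q : ℝ) ≤ E ^ 8 := by rw [hE8]; exact Real.le_sqrt_of_sq_le hQ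
    have hlogQ : Real.log Q ≤ L := by
      refine Real.log_le_log (by positivity) (le_trans ?_ hQ)
      exact le_self_pow₀ hQ1 (by norm_num)
    have h3 := sum_div_le_of_sum_le (h := fun q => (q / q.totient : ℝ) * H q) (D := D) (Q := Q)
      (a := 400 * L ^ 4 * E ^ 16) (b := 400 * L ^ 4 * E ^ 15) (c := 400 * L ^ 4 * E ^ 8) hD0 hQD
      (fun q => mul_nonneg (by positivity) (hH0 q)) (by positivity) (by positivity) (by positivity)
      (fun R hR hRQ => by
        have hRQ' : (R : ℝ) ≤ Q := by exact_mod_cast hRQ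
        refine (basic_mean_value hE hLdef hZ hN (hD0.trans hR) (hRQ'.trans hQE)).trans ?_
        exact le_of_eq (by ring))
    have h4 : ∀ q ∈ Finset.Ioc D Q, (1 / q.totient : ℝ) * H q =
        (q / q.totient : ℝ) * H q / q := by
      intro q hq
      rw [Finset.mem_Ioc] at hq
      have : (q : ℝ) ≠ 0 := by exact_mod_cast (by omega : q ≠ 0)
      field_simp
    rw [Finset.sum_congr rfl h4]
    refine h3.trans ?_
    have h5 : 2 * (400 * L ^ 4 * E ^ 16) / D ≤ 800 * (Z / L ^ k) := by
      calc 2 * (400 * L ^ 4 * E ^ 16) / D ≤ 2 * (400 * L ^ 4 * E ^ 16) / L ^ (k + 4) := by gcongr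
        _ = _ := by
          rw [hE16]
          have hL0 : L ≠ 0 := by positivity
          field_simp
          ring
    have h6 : 400 * L ^ 4 * E ^ 15 * (2 + Real.log Q) ≤ 1200 * C₂ * (Z / L ^ k) := by
      calc 400 * L ^ 4 * E ^ 15 * (2 + Real.log Q) ≤ 400 * L ^ 4 * E ^ 15 * (3 * L) := by
            gcongr
            linarith
        _ = 1200 * E ^ 15 * L ^ (k + 5) / L ^ k := by
          have hL0 : L ≠ 0 := by positivity
          field_simp
          ring
        _ ≤ 1200 * E ^ 15 * (C₂ * E) / L ^ k := by
          gcongr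
          exact h₂ Z hZ1
        _ = 1200 * C₂ * (E ^ 16 / L ^ k) := by ring
        _ = _ := by rw [hE16]
    have h7 : 2 * (400 * L ^ 4 * E ^ 8) * Q = 800 * (L ^ 4 * (√Z * Q)) := by
      rw [hE8]
      ring
    have h8 : 0 ≤ L ^ 4 * (√Z * Q) := by positivity
    have h9 := mul_nonneg (by linarith : 0 ≤ 1200 * C₂) h8
    linarith
  have hsub : ∑ q ∈ Finset.Icc 2 Q, (1 / q.totient : ℝ) * H q ≤
      ∑ q ∈ Finset.Icc 2 D, (1 / q.totient : ℝ) * H q +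
      ∑ q ∈ Finset.Ioc D Q, (1 / q.totient : ℝ) * H q := by
    rw [← Finset.sum_union]
    · refine Finset.sum_le_sum_of_subset_of_nonneg (fun q hq => ?_) fun q _ _ =>
        mul_nonneg (by positivity) (hH0 q)
      rw [Finset.mem_union, Finset.mem_Icc, Finset.mem_Ioc]
      rw [Finset.mem_Icc] at hq
      omega
    · refine Finset.disjoint_left.2 fun q hq hq' => ?_
      rw [Finset.mem_Icc] at hq
      rw [Finset.mem_Ioc] at hq'
      omega
  have h8 : 0 ≤ L ^ 4 * (√Z * Q) := by positivity
  have h9 := mul_nonneg (by linarith : 0 ≤ 4 * C₁) h8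
  linarith

theorem sum_abs_psi_sub_le (k : ℕ) : ∃ C : ℝ, 1 ≤ C ∧ ∀ Z N Q : ℕ, 3 ≤ Z → N ≤ Z → 1 ≤ Q →
    (Q : ℝ) ^ 2 ≤ Z → ∀ a : ℕ → ℕ, (∀ m, (a m).Coprime m) →
    ∑ m ∈ Finset.Icc 1 Q, |psi N m (a m) - N / m.totient| ≤
      C * (Z / Real.log Z ^ k + Real.log Z ^ 6 * (√Z * Q)) := by
  obtain ⟨C₁, hC₁, h₁⟩ := sum_primitive_le (k + 2)
  obtain ⟨C₂, hC₂, h₂⟩ := prime_number_theorem_log_pow (k + 2)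
  obtain ⟨C₃, hC₃, h₃⟩ := exists_div_log_pow_le (k + 2)
  refine ⟨6 * C₁ + 6 * (C₂ * C₃) + 14, by nlinarith, fun Z N Q hZ hN hQ1 hQ a ha => ?_⟩
  have hL := one_le_log_of_three_le hZ
  set L := Real.log Z with hLdef
  have hZ1 : (1 : ℝ) ≤ Z := by exact_mod_cast (by omega : 1 ≤ Z)
  have hQ1' : (1 : ℝ) ≤ Q := by exact_mod_cast hQ1
  have hlogQ : Real.log Q ≤ L := by
    refine Real.log_le_log (by positivity) (le_trans ?_ hQ)
    exact le_self_pow₀ hQ1' (by norm_num)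
  have hS := sum_inv_totient_le hL hlogQ
  set H : ℕ → ℝ := fun q => ∑ χ ∈ primitiveCharacters q,
    ‖∑ n ∈ Finset.range (N + 1), (Λ n : ℂ) * χ n‖ with hH
  have hH0 : ∀ q, 0 ≤ H q := fun q => Finset.sum_nonneg fun _ _ => norm_nonneg _
  set P := |∑ n ∈ Finset.range (N + 1), Λ n - N| with hP
  have hlogN : (Nat.log 2 N : ℝ) ≤ 2 * L := by
    rcases Nat.eq_zero_or_pos N with rfl | hN0
    · simp only [Nat.log_zero_right, CharP.cast_eq_zero]
      linarith
    have h1 : (2 : ℝ) ^ Nat.log 2 N ≤ Z := by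
      exact_mod_cast (Nat.pow_log_le_self 2 (by omega)).trans hN
    have h2 := Real.log_le_log (by positivity) h1
    rw [Real.log_pow] at h2
    have h3 : (Nat.log 2 N : ℝ) * 0.5 ≤ Nat.log 2 N * Real.log 2 := by
      gcongr
      linarith [Real.log_two_gt_d9]
    linarith
  have hP1 : P ≤ C₂ * C₃ * (Z / L ^ (k + 2)) + 1 := by
    have h0 : 0 ≤ C₂ * C₃ * (Z / L ^ (k + 2)) := by positivity
    rcases lt_or_ge N 2 with hN2 | hN2
    · have h1 := sum_range_vonMangoldt_mul_eq_zero hN2 fun _ => 1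
      simp only [mul_one] at h1
      have h2 : ∑ n ∈ Finset.range (N + 1), Λ n = 0 := by exact_mod_cast h1
      rw [hP, h2, zero_sub, abs_neg, abs_of_nonneg (by positivity)]
      have : (N : ℝ) ≤ 1 := by exact_mod_cast (by omega : N ≤ 1)
      linarith
    · have h1 := h₂ (N + 1) (by omega)
      have h2 := h₃ Z (N + 1) hZ (by omega) (by omega)
      have h3 : P ≤ |∑ n ∈ Finset.range (N + 1), Λ n - (N + 1 : ℕ)| + 1 := by
        have : ∑ n ∈ Finset.range (N + 1), Λ n - N =
          (∑ n ∈ Finset.range (N + 1), Λ n - (N + 1 : ℕ)) + 1 := by push_cast; ring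
        rw [hP, this]
        exact (abs_add_le _ _).trans (by rw [abs_one])
      have h4 := mul_le_mul_of_nonneg_left h2 (zero_le_one.trans hC₂)
      linarith
  have key : ∀ m ∈ Finset.Icc 1 Q, |psi N m (a m) - N / m.totient| ≤ 2 * L * L +
      (1 / m.totient : ℝ) * P + (1 / m.totient : ℝ) * ∑ q ∈ m.divisors.filter (2 ≤ ·), H q := by
    intro m hm
    rw [Finset.mem_Icc] at hm
    refine (abs_psi_sub_le N hm.1 (ha m)).trans ?_
    have h1 : Real.log m ≤ L :=
      (Real.log_le_log (by exact_mod_cast hm.1) (by exact_mod_cast hm.2)).trans hlogQ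
    have h2 : (Nat.log 2 N : ℝ) * Real.log m ≤ 2 * L * L :=
      mul_le_mul hlogN h1 (Real.log_natCast_nonneg m) (by positivity)
    simp only [hH, hP]
    linarith
  refine (Finset.sum_le_sum key).trans ?_
  rw [Finset.sum_add_distrib, Finset.sum_add_distrib, ← Finset.sum_mul _ _ P, Finset.sum_const,
    nsmul_eq_mul, Nat.card_Icc, Nat.add_sub_cancel]
  have h1 := sum_totient_divisors_le Q H hH0
  have h2 := h₁ Z N Q hZ hN hQ
  set S := ∑ k ∈ Finset.Icc 1 Q, (1 / k.totient : ℝ) with hSdef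
  have hS0 : 0 ≤ S := Finset.sum_nonneg fun _ _ => by positivity
  have hs1 : 1 ≤ √(Z : ℝ) := Real.one_le_sqrt.2 hZ1
  have h3 : S * ∑ q ∈ Finset.Icc 2 Q, (1 / q.totient : ℝ) * H q ≤
      6 * L ^ 2 * (C₁ * (Z / L ^ (k + 2) + L ^ 4 * (√Z * Q))) := by
    refine mul_le_mul hS h2 (Finset.sum_nonneg fun q _ => mul_nonneg (by positivity) (hH0 q))
      (by positivity)
  have h4 : S * P ≤ 6 * L ^ 2 * (C₂ * C₃ * (Z / L ^ (k + 2)) + 1) :=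
    mul_le_mul hS hP1 (abs_nonneg _) (by positivity)
  have h5 : L ^ 2 * (Z / L ^ (k + 2)) = Z / L ^ k := by
    have hL0 : L ≠ 0 := by positivity
    field_simp
    ring
  have h6 : L ^ 2 * Q ≤ L ^ 6 * (√Z * Q) := by
    refine mul_le_mul (pow_le_pow_right₀ hL (by norm_num)) ?_ (by positivity) (by positivity)
    exact le_mul_of_one_le_left (by positivity) hs1
  have h7 : L ^ 2 ≤ L ^ 2 * Q := le_mul_of_one_le_right (by positivity) hQ1'
  have h8 : 0 ≤ (Z : ℝ) / L ^ k := by positivity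
  have h9 : 0 ≤ L ^ 6 * (√Z * Q) := by positivity
  calc _ ≤ 2 * (L ^ 2 * Q) + 6 * (C₂ * C₃) * (L ^ 2 * (Z / L ^ (k + 2))) + 6 * L ^ 2 +
        6 * C₁ * (L ^ 2 * (Z / L ^ (k + 2)) + L ^ 6 * (√Z * Q)) := by linarith
    _ ≤ _ := by
      rw [h5]
      have := mul_nonneg (mul_nonneg (zero_le_one.trans hC₂) (zero_le_one.trans hC₃)) h9
      linarith

lemma psi_mono (m a : ℕ) : Monotone fun y => psi y m a := by
  intro y z hyz
  refine Finset.sum_le_sum_of_subset_of_nonneg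
    (Finset.Icc_subset_Icc le_rfl (Nat.floor_le_floor hyz)) fun n _ _ => ?_
  split_ifs
  · exact ArithmeticFunction.vonMangoldt_nonneg
  · exact le_rfl

lemma abs_psi_sub_le_sum {D J m a : ℕ} {y : ℝ} (hD : 1 ≤ D) (hm : 1 ≤ m) (hy : 0 ≤ y)
    (hJ : ⌊y⌋₊ < J * D) : |psi y m a - y / m.totient| ≤
      ∑ j ∈ Finset.range (J + 1), |psi (j * D : ℕ) m a - (j * D : ℕ) / m.totient| +
        D * (1 / m.totient) := by
  have hφ : (0 : ℝ) < m.totient := by exact_mod_cast Nat.totient_pos.2 hm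
  set j := ⌊y⌋₊ / D with hj
  have hjJ : j < J := Nat.div_lt_of_lt_mul (by rwa [mul_comm] at hJ)
  have h1 : j * D ≤ ⌊y⌋₊ := Nat.div_mul_le_self _ _
  have h2 : ⌊y⌋₊ + 1 ≤ (j + 1) * D := by
    have := Nat.lt_mul_div_succ ⌊y⌋₊ hD
    rw [mul_comm] at this
    exact this
  have h3 : ((j * D : ℕ) : ℝ) ≤ y := le_trans (by exact_mod_cast h1) (Nat.floor_le hy)
  have h4 : y ≤ (((j + 1) * D : ℕ) : ℝ) :=
    (Nat.lt_floor_add_one y).le.trans (by exact_mod_cast h2)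
  have h5 : ∀ i ∈ Finset.range (J + 1), |psi (i * D : ℕ) m a - (i * D : ℕ) / m.totient| ≤
      ∑ j ∈ Finset.range (J + 1), |psi (j * D : ℕ) m a - (j * D : ℕ) / m.totient| := fun i hi =>
    Finset.single_le_sum (f := fun j : ℕ => |psi (j * D : ℕ) m a - (j * D : ℕ) / m.totient|)
      (fun _ _ => abs_nonneg _) hi
  have h6 := (abs_le.1 (h5 j (Finset.mem_range.2 (by omega)))).1
  have h7 := (abs_le.1 (h5 (j + 1) (Finset.mem_range.2 (by omega)))).2
  have h8 : psi (j * D : ℕ) m a ≤ psi y m a := psi_mono m a h3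
  have h9 : psi y m a ≤ psi ((j + 1) * D : ℕ) m a := psi_mono m a h4
  have h10 : (((j + 1) * D : ℕ) : ℝ) / m.totient = (j * D : ℕ) / m.totient + D * (1 / m.totient) := by
    push_cast
    field_simp
  have h11 : ((j * D : ℕ) : ℝ) / m.totient ≤ y / m.totient := by gcongr
  have h12 : y / m.totient ≤ (((j + 1) * D : ℕ) : ℝ) / m.totient := by gcongr
  rw [abs_le]
  constructor <;> linarith

lemma bombieri_vinogradov_natCast_exponent (k : ℕ) : ∃ C : ℝ, 0 < C ∧ ∀ z : ℝ, 3 < z →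
    ∀ y : ℕ → ℝ, ∀ a : ℕ → ℕ, (∀ m : ℕ, 0 < y m ∧ y m ≤ z) → (∀ m : ℕ, Nat.gcd (a m) m = 1) →
    ∀ Q : ℕ, (Q : ℝ) ≤ √z / Real.log z ^ (2 * k + 8) →
      ∑ m ∈ Finset.Icc 1 Q, |psi (y m) m (a m) - y m / m.totient| ≤ C * (z / Real.log z ^ k) := by
  obtain ⟨C₁, hC₁, h₁⟩ := sum_abs_psi_sub_le (2 * k + 2)
  obtain ⟨C₂, hC₂, h₂⟩ := log_pow_le_mul_sqrt (k + 2)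
  refine ⟨390 * C₁ + 6 + 12 * C₂, by linarith, fun z hz y a hy ha Q hQ => ?_⟩
  set l := Real.log z with hl
  set Z := ⌊z⌋₊ with hZ
  have hZ3 : 3 ≤ Z := Nat.le_floor (by exact_mod_cast hz.le)
  have hZz : (Z : ℝ) ≤ z := Nat.floor_le (by linarith)
  have hzZ : z ≤ 2 * Z := by
    have h1 := (Nat.lt_floor_add_one z).le
    have h2 : (3 : ℝ) ≤ Z := by exact_mod_cast hZ3
    linarith
  have hl1 : 1 ≤ l := (one_le_log_of_three_le hZ3).trans
    (Real.log_le_log (by exact_mod_cast (by omega : 0 < Z)) hZz)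
  have hl0 : 0 < l := by linarith
  have hz0 : 0 < z := by linarith
  have hlk : 0 ≤ z / l ^ k := by positivity
  rcases Nat.eq_zero_or_pos Q with rfl | hQ0
  · simp only [Finset.Icc_eq_empty_of_lt zero_lt_one, Finset.sum_empty]
    positivity
  set J := min ⌈l ^ (k + 2)⌉₊ Z with hJ
  have hlk2 : 1 ≤ l ^ (k + 2) := one_le_pow₀ hl1
  have hceil : 1 ≤ ⌈l ^ (k + 2)⌉₊ := by exact_mod_cast hlk2.trans (Nat.le_ceil _)
  have hJ1 : 1 ≤ J := le_min hceil (by omega)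
  have hJZ : J ≤ Z := min_le_right _ _
  have hJl : (J : ℝ) + 1 ≤ 3 * l ^ (k + 2) := by
    have h1 : (J : ℝ) ≤ ⌈l ^ (k + 2)⌉₊ := by exact_mod_cast min_le_left _ _
    have h2 := (Nat.ceil_lt_add_one (zero_le_one.trans hlk2)).le
    linarith
  set D := Z / J + 1 with hD
  have hJD : Z < J * D := Nat.lt_mul_div_succ Z hJ1
  have hJD2 : J * D ≤ 2 * Z := by
    have := Nat.mul_div_le Z J
    rw [hD, mul_add, mul_one]
    omega
  have hDl : (D : ℝ) ≤ z / l ^ (k + 2) + 2 := by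
    have h1 : (D : ℝ) ≤ Z / J + 1 := by
      rw [hD]
      push_cast
      gcongr
      exact Nat.cast_div_le
    have h2 : (0 : ℝ) < Z := by exact_mod_cast (by omega : 0 < Z)
    rcases min_choice ⌈l ^ (k + 2)⌉₊ Z with h | h
    · have h3 : (Z : ℝ) / J ≤ z / l ^ (k + 2) := by
        rw [hJ, h]
        gcongr
        exact Nat.le_ceil _
      linarith
    · have h3 : (Z : ℝ) / J = 1 := by
        rw [hJ, h]
        exact div_self h2.ne'
      have h4 : 0 ≤ z / l ^ (k + 2) := by positivity
      linarith
  have hQz : (Q : ℝ) ≤ √z := hQ.trans (div_le_self (Real.sqrt_nonneg z) (one_le_pow₀ hl1))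
  have hQ2 : (Q : ℝ) ^ 2 ≤ (2 * Z : ℕ) := by
    push_cast
    refine le_trans ?_ hzZ
    calc (Q : ℝ) ^ 2 ≤ √z ^ 2 := by gcongr
      _ = z := Real.sq_sqrt hz0.le
  have hlW : l ≤ Real.log (2 * Z : ℕ) := by
    push_cast
    exact Real.log_le_log hz0 hzZ
  have hWz : ((2 * Z : ℕ) : ℝ) ≤ 2 * z := by
    push_cast
    linarith
  have hW0 : (0 : ℝ) < (2 * Z : ℕ) := by exact_mod_cast (by omega : 0 < 2 * Z)
  have hWl : Real.log (2 * Z : ℕ) ≤ 2 * l := by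
    have h1 := Real.log_le_log hW0 hWz
    rw [Real.log_mul (by norm_num) hz0.ne'] at h1
    have := Real.log_two_lt_d9
    linarith
  have hW : ∀ j ∈ Finset.range (J + 1), ∑ m ∈ Finset.Icc 1 Q,
      |psi (j * D : ℕ) m (a m) - (j * D : ℕ) / m.totient| ≤ C₁ * (130 * (z / l ^ (2 * k + 2))) := by
    intro j hj
    rw [Finset.mem_range] at hj
    have hjD : j * D ≤ 2 * Z := (Nat.mul_le_mul_right D (by omega)).trans hJD2
    refine (h₁ (2 * Z) (j * D) Q (by omega) hjD hQ0 hQ2 a ha).trans ?_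
    refine mul_le_mul_of_nonneg_left ?_ (by linarith)
    have e1 : ((2 * Z : ℕ) : ℝ) / Real.log (2 * Z : ℕ) ^ (2 * k + 2) ≤
        2 * z / l ^ (2 * k + 2) := by gcongr
    have e2 : √((2 * Z : ℕ) : ℝ) ≤ 2 * √z := by
      refine Real.sqrt_le_iff.2 ⟨by positivity, ?_⟩
      rw [mul_pow, Real.sq_sqrt hz0.le]
      linarith
    have e3 : Real.log (2 * Z : ℕ) ^ 6 * (√((2 * Z : ℕ) : ℝ) * Q) ≤
        128 * (z / l ^ (2 * k + 2)) := by
      calc Real.log (2 * Z : ℕ) ^ 6 * (√((2 * Z : ℕ) : ℝ) * Q) ≤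
          (2 * l) ^ 6 * (2 * √z * (√z / l ^ (2 * k + 8))) := by gcongr
        _ = 128 * (√z * √z) * (l ^ 6 / l ^ (2 * k + 8)) := by ring
        _ = _ := by
          rw [Real.mul_self_sqrt hz0.le]
          field_simp
          ring
    have e4 : 2 * z / l ^ (2 * k + 2) = 2 * (z / l ^ (2 * k + 2)) := by ring
    linarith
  have hS := sum_inv_totient_le (Q := Q) hl1 (by
    refine Real.log_le_log (by exact_mod_cast hQ0) (hQz.trans ?_)
    exact Real.sqrt_le_self_iff.2 (Or.inr (by linarith)))
  calc ∑ m ∈ Finset.Icc 1 Q, |psi (y m) m (a m) - y m / m.totient|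
      ≤ ∑ m ∈ Finset.Icc 1 Q, (∑ j ∈ Finset.range (J + 1),
          |psi (j * D : ℕ) m (a m) - (j * D : ℕ) / m.totient| + D * (1 / m.totient)) := by
        refine Finset.sum_le_sum fun m hm => ?_
        refine abs_psi_sub_le_sum (Nat.succ_pos _) (Finset.mem_Icc.1 hm).1 (hy m).1.le ?_
        exact (Nat.floor_le_floor (hy m).2).trans_lt hJD
    _ = ∑ j ∈ Finset.range (J + 1), ∑ m ∈ Finset.Icc 1 Q,
          |psi (j * D : ℕ) m (a m) - (j * D : ℕ) / m.totient| +
          D * ∑ m ∈ Finset.Icc 1 Q, (1 / m.totient : ℝ) := by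
        rw [Finset.sum_add_distrib, Finset.sum_comm, ← Finset.mul_sum]
    _ ≤ (J + 1) * (C₁ * (130 * (z / l ^ (2 * k + 2)))) + (z / l ^ (k + 2) + 2) * (6 * l ^ 2) := by
        refine add_le_add ?_ ?_
        · refine (Finset.sum_le_sum hW).trans (le_of_eq ?_)
          rw [Finset.sum_const, Finset.card_range, nsmul_eq_mul]
          push_cast
          ring
        · gcongr
    _ ≤ 3 * l ^ (k + 2) * (C₁ * (130 * (z / l ^ (2 * k + 2)))) +
        (z / l ^ (k + 2) + 2) * (6 * l ^ 2) := by gcongr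
    _ = (390 * C₁ + 6) * (z / l ^ k) + 12 * l ^ 2 := by
        field_simp
        ring
    _ ≤ (390 * C₁ + 6) * (z / l ^ k) + 12 * (C₂ * (z / l ^ k)) := by
        gcongr
        rw [← mul_div_assoc, le_div_iff₀ (by positivity), ← pow_add, add_comm 2 k]
        refine (h₂ z (by linarith)).trans ?_
        gcongr
        exact Real.sqrt_le_self_iff.2 (Or.inr (by linarith))
    _ = _ := by ring

end

end

/-- **Bombieri–Vinogradov theorem.** For every real `A > 0` there exist
`B > 0` and `C > 0` such that for all real `z > 3`, the sum over `m ≤ √z / (log z)^B` of the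
maximum over reals `0 < y ≤ z` and residues `a` coprime to `m` of `|ψ(y; m, a) − y/φ(m)|` is
at most `C·z/(log z)^A`. (The maxima are expressed via arbitrary choices `y m`, `a m`.) -/
theorem bombieri_vinogradov (A : ℝ) (hA : 0 < A) :
    ∃ B C : ℝ, 0 < B ∧ 0 < C ∧ ∀ z : ℝ, 3 < z →
      ∀ y : ℕ → ℝ, ∀ a : ℕ → ℕ,
        (∀ m : ℕ, 0 < y m ∧ y m ≤ z) →
        (∀ m : ℕ, Nat.gcd (a m) m = 1) →
        ∑ m ∈ Finset.Icc 1 ⌊Real.sqrt z / Real.log z ^ B⌋₊,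
            |psi (y m) m (a m) - y m / (Nat.totient m : ℝ)| ≤
          C * z / Real.log z ^ A := by
  obtain ⟨C, hC, h⟩ := bombieri_vinogradov_natCast_exponent ⌈A⌉₊
  refine ⟨(2 * ⌈A⌉₊ + 8 : ℕ), C, by positivity, hC, fun z hz y a hy ha => ?_⟩
  have hl : 1 ≤ Real.log z := by
    have := one_le_log_of_three_le (N := 3) le_rfl
    exact this.trans (Real.log_le_log (by norm_num) (by exact_mod_cast hz.le))
  have hz0 : 0 < z := by linarith
  rw [Real.rpow_natCast]
  refine (h z hz y a hy ha _ (Nat.floor_le (by positivity))).trans ?_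
  rw [mul_div_assoc, ← Real.rpow_natCast]
  gcongr
  exact Nat.le_ceil A
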